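/- For every H_n^f-module M there is an isomorphism of H_{n+1}^f-modules, natural in M: H_{n+1}^f ⊗_{H_n^f} M ≅ Hom_{H_n^f}(H_{n+1}^f, M). Consequently the induction functor from H_n^f-modules to H_{n+1}^f-modules is both left and right adjoint to restriction. -/

import Mathlib

set_option maxHeartbeats 1000000

namespace HC

/-- Generators of the affine Hecke–Clifford superalgebra `H_n`. -/
inductive Gen (n : ℕ) : Type
  | X : Fin n → Gen n
  | Xinv : Fin n → Gen n
  | C : Fin n → Gen n
  | T : Fin (n - 1) → Gen n

/-- The node `i` of `Fin n`, for `i : Fin (n-1)` (1-based: the node `i`). -/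
def lo {n : ℕ} (i : Fin (n - 1)) : Fin n :=
  ⟨i.val, by have := i.isLt; omega⟩

/-- The node `i+1` of `Fin n`, for `i : Fin (n-1)`. -/
def hi {n : ℕ} (i : Fin (n - 1)) : Fin n :=
  ⟨i.val + 1, by have := i.isLt; omega⟩

variable (F : Type) [Field F]

/-- The free algebra on the generators. -/
abbrev FA (n : ℕ) : Type := FreeAlgebra F (Gen n)

noncomputable def fx {n : ℕ} (i : Fin n) : FA F n := FreeAlgebra.ι F (Gen.X i)
noncomputable def fxinv {n : ℕ} (i : Fin n) : FA F n := FreeAlgebra.ι F (Gen.Xinv i)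
noncomputable def fc {n : ℕ} (i : Fin n) : FA F n := FreeAlgebra.ι F (Gen.C i)
noncomputable def ft {n : ℕ} (i : Fin (n - 1)) : FA F n := FreeAlgebra.ι F (Gen.T i)

/-- The defining relations of the affine Hecke–Clifford superalgebra, with parameter
`q` and `ξ = q - q⁻¹`. -/
inductive Rel (q : F) (n : ℕ) : FA F n → FA F n → Prop
  | XXinv (i : Fin n) : Rel q n (fx F i * fxinv F i) 1
  | XinvX (i : Fin n) : Rel q n (fxinv F i * fx F i) 1
  | XX (i j : Fin n) : Rel q n (fx F i * fx F j) (fx F j * fx F i)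
  | XiXi (i j : Fin n) : Rel q n (fxinv F i * fxinv F j) (fxinv F j * fxinv F i)
  | XXi (i j : Fin n) (h : i ≠ j) : Rel q n (fx F i * fxinv F j) (fxinv F j * fx F i)
  | CC (i : Fin n) : Rel q n (fc F i * fc F i) 1
  | Canti (i j : Fin n) (h : i ≠ j) : Rel q n (fc F i * fc F j) (-(fc F j * fc F i))
  | CX (i : Fin n) : Rel q n (fc F i * fx F i) (fxinv F i * fc F i)
  | CXi (i : Fin n) : Rel q n (fc F i * fxinv F i) (fx F i * fc F i)
  | CXo (i j : Fin n) (h : i ≠ j) : Rel q n (fc F i * fx F j) (fx F j * fc F i)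
  | CXio (i j : Fin n) (h : i ≠ j) : Rel q n (fc F i * fxinv F j) (fxinv F j * fc F i)
  | Tquad (i : Fin (n - 1)) : Rel q n (ft F i * ft F i) ((q - q⁻¹) • ft F i + 1)
  | Tbraid (i j : Fin (n - 1)) (h : (j : ℕ) = (i : ℕ) + 1) :
      Rel q n (ft F i * ft F j * ft F i) (ft F j * ft F i * ft F j)
  | TTfar (i j : Fin (n - 1)) (h : (i : ℕ) + 1 < (j : ℕ)) :
      Rel q n (ft F i * ft F j) (ft F j * ft F i)
  | TC (i : Fin (n - 1)) : Rel q n (ft F i * fc F (lo i)) (fc F (hi i) * ft F i)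
  | TCo (i : Fin (n - 1)) (j : Fin n) (h1 : j ≠ lo i) (h2 : j ≠ hi i) :
      Rel q n (ft F i * fc F j) (fc F j * ft F i)
  | TXo (i : Fin (n - 1)) (j : Fin n) (h1 : j ≠ lo i) (h2 : j ≠ hi i) :
      Rel q n (ft F i * fx F j) (fx F j * ft F i)
  | TXio (i : Fin (n - 1)) (j : Fin n) (h1 : j ≠ lo i) (h2 : j ≠ hi i) :
      Rel q n (ft F i * fxinv F j) (fxinv F j * ft F i)
  | cross (i : Fin (n - 1)) :
      Rel q n ((ft F i + (q - q⁻¹) • (fc F (lo i) * fc F (hi i))) * fx F (lo i) * ft F i)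
        (fx F (hi i))

/-- The affine Hecke–Clifford superalgebra `H_n` over `F` with parameter `q`. -/
abbrev H (q : F) (n : ℕ) : Type := RingQuot (Rel F q n)

noncomputable def X (q : F) {n : ℕ} (i : Fin n) : H F q n :=
  RingQuot.mkAlgHom F (Rel F q n) (fx F i)

noncomputable def Xinv (q : F) {n : ℕ} (i : Fin n) : H F q n :=
  RingQuot.mkAlgHom F (Rel F q n) (fxinv F i)

noncomputable def C (q : F) {n : ℕ} (i : Fin n) : H F q n :=
  RingQuot.mkAlgHom F (Rel F q n) (fc F i)

noncomputable def T (q : F) {n : ℕ} (i : Fin (n - 1)) : H F q n :=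
  RingQuot.mkAlgHom F (Rel F q n) (ft F i)

/-- `q` is either a primitive root of unity of odd order (including `q = 1`)
or not a root of unity at all (and `q ≠ 0`). -/
def GoodParam (q : F) : Prop :=
  q ≠ 0 ∧ ((∃ m : ℕ, Odd m ∧ IsPrimitiveRoot q m) ∨ ∀ m : ℕ, 0 < m → q ^ m ≠ 1)

/-- `X_i^a` for an integer exponent `a ∈ ℤ`. -/
noncomputable def XZ (q : F) {n : ℕ} (i : Fin n) (a : ℤ) : H F q n :=
  if 0 ≤ a then X F q i ^ a.toNat else Xinv F q i ^ (-a).toNat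

/-- The monomial `X^α = X_1^{α_1} ⋯ X_n^{α_n}` for `α ∈ ℤ^n`. -/
noncomputable def Xmon (q : F) {n : ℕ} (α : Fin n → ℤ) : H F q n :=
  ((List.finRange n).map fun i => XZ F q i (α i)).prod

/-- The monomial `C^β = C_1^{β_1} ⋯ C_n^{β_n}` for `β ∈ {0,1}^n`. -/
noncomputable def Cmon (q : F) {n : ℕ} (β : Fin n → Bool) : H F q n :=
  ((List.finRange n).map fun i => if β i then C F q i else 1).prod

/-- The basic transposition `s_i = (i, i+1)` of `S_n`. -/
def s {n : ℕ} (i : Fin (n - 1)) : Equiv.Perm (Fin n) := Equiv.swap (lo i) (hi i)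

/-- The Coxeter length (number of inversions) of a permutation of `Fin n`. -/
def len {n : ℕ} (w : Equiv.Perm (Fin n)) : ℕ :=
  ((Finset.univ : Finset (Fin n × Fin n)).filter fun p => p.1 < p.2 ∧ w p.2 < w p.1).card

/-- `Tw` is the family of standard basis elements `T_w`, `w ∈ S_n`: it satisfies
`T_1 = 1`, `T_{s_i} = T_i`, and `T_{s_i w} = T_i T_w` whenever `ℓ(s_i w) = ℓ(w) + 1`.
These conditions determine the family uniquely. -/
def IsTFam (q : F) {n : ℕ} (Tw : Equiv.Perm (Fin n) → H F q n) : Prop :=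
  Tw 1 = 1 ∧ (∀ i : Fin (n - 1), Tw (s i) = T F q i) ∧
    ∀ (i : Fin (n - 1)) (w : Equiv.Perm (Fin n)),
      len (s i * w) = len w + 1 → Tw (s i * w) = T F q i * Tw w

/-- `h` is the quantum characteristic of `q`:  the smallest positive integer with
`q^{1-h} + q^{3-h} + ⋯ + q^{h-1} = 0`. -/
def qcharEq (q : F) (h : ℕ) : Prop :=
  0 < h ∧ (∑ k ∈ Finset.range h, q ^ (1 - (h : ℤ) + 2 * (k : ℤ))) = 0 ∧
    ∀ h' : ℕ, 0 < h' → h' < h →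
      (∑ k ∈ Finset.range h', q ^ (1 - (h' : ℤ) + 2 * (k : ℤ))) ≠ 0

/-- `i ∈ I = {0, 1, …, ℓ}` where `ℓ = (h-1)/2` (no condition if the quantum
characteristic is infinite). -/
def memI (q : F) (i : ℕ) : Prop := ∀ h : ℕ, qcharEq F q h → 2 * i + 1 ≤ h

/-- `q(i) = 2(q^{2i+1} + q^{-2i-1})/(q + q⁻¹)`. -/
noncomputable def qres (q : F) (i : ℕ) : F :=
  2 * (q ^ (2 * i + 1) + q⁻¹ ^ (2 * i + 1)) / (q + q⁻¹)

/-- Index of the block containing position `k` (0-based), for a composition given as a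
list of parts. -/
def blk : List ℕ → ℕ → ℕ
  | [], _ => 0
  | a :: rest, k => if k < a then 0 else blk rest (k - a) + 1

/-- Membership in the Young subgroup `S_μ ⊆ S_n`. -/
def InYoung {n : ℕ} (μ : List ℕ) (w : Equiv.Perm (Fin n)) : Prop :=
  ∀ k : Fin n, blk μ (w k).val = blk μ k.val

/-- `μ` is a composition of `n`. -/
def IsComposition (μ : List ℕ) (n : ℕ) : Prop := (∀ a ∈ μ, 0 < a) ∧ μ.sum = n

/-- The parabolic subalgebra generated by all `X_i^{±1}`, `C_i`, and the `T_j` with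
`j` in a set `J` of admissible indices. -/
def parabolicJ (q : F) {n : ℕ} (J : Set (Fin (n - 1))) : Subalgebra F (H F q n) :=
  Algebra.adjoin F
    ((Set.range fun i : Fin n => X F q i) ∪ (Set.range fun i : Fin n => Xinv F q i) ∪
      (Set.range fun i : Fin n => C F q i) ∪ {h | ∃ j ∈ J, h = T F q j})

/-- The parabolic subalgebra `H_μ` for a composition `μ`. -/
def parabolicC (q : F) {n : ℕ} (μ : List ℕ) : Subalgebra F (H F q n) :=
  parabolicJ F q {j | InYoung μ (s j)}

/-- The classical parabolic subalgebra `H^cl_μ`, generated by the `T_j` with `s_j ∈ S_μ`. -/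
def clparC (q : F) {n : ℕ} (μ : List ℕ) : Subalgebra F (H F q n) :=
  Algebra.adjoin F {h | ∃ j : Fin (n - 1), InYoung μ (s j) ∧ h = T F q j}

/-- The finite Hecke–Clifford subalgebra `H^fn_n`, generated by all `C_i` and `T_j`. -/
def Hfin (q : F) (n : ℕ) : Subalgebra F (H F q n) :=
  Algebra.adjoin F
    ((Set.range fun i : Fin n => C F q i) ∪ {h | ∃ j : Fin (n - 1), h = T F q j})

/-- `x` is a minimal length `(S_μ, S_ν)`-double coset representative. -/
def IsMinDC {n : ℕ} (μ ν : List ℕ) (x : Equiv.Perm (Fin n)) : Prop :=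
  ∀ u v : Equiv.Perm (Fin n), InYoung μ u → InYoung ν v → len x ≤ len (u * x * v)

/-- `w ∈ S_μ x S_ν`. -/
def InDC {n : ℕ} (μ ν : List ℕ) (x w : Equiv.Perm (Fin n)) : Prop :=
  ∃ u v : Equiv.Perm (Fin n), InYoung μ u ∧ InYoung ν v ∧ w = u * x * v

/-- A covering step in the Bruhat order: multiplication by a reflection increasing length. -/
def BruhatStep {n : ℕ} (v w : Equiv.Perm (Fin n)) : Prop :=
  ∃ a b : Fin n, a ≠ b ∧ w = Equiv.swap a b * v ∧ len v < len w

/-- The Bruhat order on `S_n`. -/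
def BruhatLE {n : ℕ} : Equiv.Perm (Fin n) → Equiv.Perm (Fin n) → Prop :=
  Relation.ReflTransGen BruhatStep

/-- The space of `A`-equivariant linear maps between two representations of the
`F`-algebra `A`. -/
def eqvHoms {A : Type} [Ring A] [Algebra F A] {M N : Type}
    [AddCommGroup M] [Module F M] [AddCommGroup N] [Module F N]
    (ρM : A →ₐ[F] Module.End F M) (ρN : A →ₐ[F] Module.End F N) :
    Submodule F (M →ₗ[F] N) where
  carrier := {f | ∀ (x : A) (m : M), f (ρM x m) = ρN x (f m)}
  add_mem' := by
    intro f g hf hg x m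
    simp only [LinearMap.add_apply, hf x m, hg x m, map_add]
  zero_mem' := by
    intro x m
    simp only [LinearMap.zero_apply, map_zero]
  smul_mem' := by
    intro c f hf x m
    simp only [LinearMap.smul_apply, hf x m, map_smul]

/-- `(E, ρE, ι)` is the module induced along the algebra morphism `φ : B →ₐ A` from
the `B`-representation `(M, ρ)`, i.e. `E = A ⊗_B M`, characterized by its universal
property. -/
def IsInducedAlong {A B : Type} [Ring A] [Ring B] [Algebra F A] [Algebra F B]
    (φ : B →ₐ[F] A) {M : Type} [AddCommGroup M] [Module F M]
    (ρ : B →ₐ[F] Module.End F M) {E : Type} [AddCommGroup E] [Module F E]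
    (ρE : A →ₐ[F] Module.End F E) (ι : M →ₗ[F] E) : Prop :=
  (∀ (b : B) (m : M), ι (ρ b m) = ρE (φ b) (ι m)) ∧
    ∀ (P : Type) [AddCommGroup P] [Module F P],
      ∀ (ρP : A →ₐ[F] Module.End F P) (f : M →ₗ[F] P),
        (∀ (b : B) (m : M), f (ρ b m) = ρP (φ b) (f m)) →
        ∃! g : E →ₗ[F] P,
          (∀ (x : A) (e : E), g (ρE x e) = ρP x (g e)) ∧ ∀ m : M, g (ι m) = f m

/-- `δ` is the grading automorphism of the superalgebra `H_n`
(identity on even generators, `-1` on the odd generators `C_i`). -/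
def IsGradingAut (q : F) {n : ℕ} (δ : H F q n →ₐ[F] H F q n) : Prop :=
  (∀ i : Fin n, δ (X F q i) = X F q i) ∧ (∀ i : Fin n, δ (Xinv F q i) = Xinv F q i) ∧
    (∀ i : Fin n, δ (C F q i) = -C F q i) ∧ ∀ i : Fin (n - 1), δ (T F q i) = T F q i

/-- `τ` is the antiautomorphism of `H_n` with `τ(T_i) = T_i + ξ C_i C_{i+1}`,
`τ(C_j) = C_j`, `τ(X_j) = X_j`. -/
def IsTauAntiAut (q : F) {n : ℕ} (τ : H F q n →ₗ[F] H F q n) : Prop :=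
  Function.Bijective τ ∧ (∀ a b : H F q n, τ (a * b) = τ b * τ a) ∧ τ 1 = 1 ∧
    (∀ i : Fin (n - 1),
      τ (T F q i) = T F q i + (q - q⁻¹) • (C F q (lo i) * C F q (hi i))) ∧
    (∀ j : Fin n, τ (C F q j) = C F q j) ∧ (∀ j : Fin n, τ (X F q j) = X F q j) ∧
    ∀ j : Fin n, τ (Xinv F q j) = Xinv F q j

/-- `ρ'` is the representation of the subalgebra `B` obtained from the
`H_ν`-representation `ρν` by twisting with the isomorphism `φ_{x⁻¹}`
(determined by `X_i ↦ X_{x⁻¹ i}`, `C_i ↦ C_{x⁻¹ i}`, `T_w ↦ T_{x⁻¹ w x}`). -/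
def IsTwistedRep (q : F) {n : ℕ} (ν : List ℕ) (x : Equiv.Perm (Fin n))
    (B : Subalgebra F (H F q n)) {M : Type} [AddCommGroup M] [Module F M]
    (ρν : ↥(parabolicC F q (n := n) ν) →ₐ[F] Module.End F M)
    (ρ' : ↥B →ₐ[F] Module.End F M) : Prop :=
  (∀ (i : Fin n) (a : ↥B) (b : ↥(parabolicC F q (n := n) ν)),
      (a : H F q n) = X F q i → (b : H F q n) = X F q (x⁻¹ i) → ρ' a = ρν b) ∧
  (∀ (i : Fin n) (a : ↥B) (b : ↥(parabolicC F q (n := n) ν)),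
      (a : H F q n) = Xinv F q i → (b : H F q n) = Xinv F q (x⁻¹ i) → ρ' a = ρν b) ∧
  (∀ (i : Fin n) (a : ↥B) (b : ↥(parabolicC F q (n := n) ν)),
      (a : H F q n) = C F q i → (b : H F q n) = C F q (x⁻¹ i) → ρ' a = ρν b) ∧
  ∀ (j j' : Fin (n - 1)) (a : ↥B) (b : ↥(parabolicC F q (n := n) ν)),
      lo j' = x⁻¹ (lo j) → (a : H F q n) = T F q j → (b : H F q n) = T F q j' → ρ' a = ρν b

/-- The element `f = a_d X_1^d + ⋯ + a_1 X_1 + a_0` of `H_n`. -/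
noncomputable def felem (q : F) (n d : ℕ) (aa : ℕ → F) : H F q n :=
  if h : 0 < n then ∑ i ∈ Finset.range (d + 1), aa i • X F q (⟨0, h⟩ : Fin n) ^ i else 0

/-- The conditions on the coefficients of `f`: degree `d ≥ 1`, monic, and
`a_i = a_0 a_{d-i}`. -/
def GoodPoly (d : ℕ) (aa : ℕ → F) : Prop :=
  1 ≤ d ∧ aa d = 1 ∧ (∀ i ≤ d, aa i = aa 0 * aa (d - i)) ∧ ∀ i : ℕ, d < i → aa i = 0

/-- The relation generating the two-sided ideal `I_f` of `H_n`. -/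
inductive CycRel (q : F) (n d : ℕ) (aa : ℕ → F) : H F q n → H F q n → Prop
  | rel : CycRel q n d aa (felem F q n d aa) 0

/-- The cyclotomic Hecke–Clifford superalgebra `H_n^f = H_n / I_f`. -/
abbrev Hf (q : F) (n d : ℕ) (aa : ℕ → F) : Type := RingQuot (CycRel F q n d aa)

/-- The canonical quotient map `H_n → H_n^f`. -/
noncomputable def cyc (q : F) (n d : ℕ) (aa : ℕ → F) : H F q n →ₐ[F] Hf F q n d aa :=
  RingQuot.mkAlgHom F (CycRel F q n d aa)

noncomputable def Xf (q : F) (n d : ℕ) (aa : ℕ → F) (i : Fin n) : Hf F q n d aa :=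
  cyc F q n d aa (X F q i)
noncomputable def Xinvf (q : F) (n d : ℕ) (aa : ℕ → F) (i : Fin n) : Hf F q n d aa :=
  cyc F q n d aa (Xinv F q i)
noncomputable def Cf (q : F) (n d : ℕ) (aa : ℕ → F) (i : Fin n) : Hf F q n d aa :=
  cyc F q n d aa (C F q i)
noncomputable def Tf (q : F) (n d : ℕ) (aa : ℕ → F) (i : Fin (n - 1)) : Hf F q n d aa :=
  cyc F q n d aa (T F q i)

/-- `e` is the canonical embedding `H_k^f → H_N^f` (shifting all indices by `sh`;
for `sh = 0` this is the standard identification of `H_k^f` with a subalgebra of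
`H_N^f`). -/
def IsCycEmb (q : F) (k N d : ℕ) (aa : ℕ → F) (sh : ℕ)
    (e : Hf F q k d aa →ₐ[F] Hf F q N d aa) : Prop :=
  (∀ (i : Fin k) (i' : Fin N), (i' : ℕ) = sh + (i : ℕ) →
      e (Xf F q k d aa i) = Xf F q N d aa i') ∧
  (∀ (i : Fin k) (i' : Fin N), (i' : ℕ) = sh + (i : ℕ) →
      e (Xinvf F q k d aa i) = Xinvf F q N d aa i') ∧
  (∀ (i : Fin k) (i' : Fin N), (i' : ℕ) = sh + (i : ℕ) →
      e (Cf F q k d aa i) = Cf F q N d aa i') ∧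
  ∀ (j : Fin (k - 1)) (j' : Fin (N - 1)), (j' : ℕ) = sh + (j : ℕ) →
      e (Tf F q k d aa j) = Tf F q N d aa j'

/-- `δ` is the grading automorphism of the superalgebra `H_n^f`. -/
def IsCycGrading (q : F) (n d : ℕ) (aa : ℕ → F)
    (δ : Hf F q n d aa →ₐ[F] Hf F q n d aa) : Prop :=
  (∀ i : Fin n, δ (Xf F q n d aa i) = Xf F q n d aa i) ∧
  (∀ i : Fin n, δ (Xinvf F q n d aa i) = Xinvf F q n d aa i) ∧
  (∀ i : Fin n, δ (Cf F q n d aa i) = -Cf F q n d aa i) ∧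
  ∀ j : Fin (n - 1), δ (Tf F q n d aa j) = Tf F q n d aa j

/-- The elements `f_1 = f`, `f_{i+1} = (T_i + ξ C_i C_{i+1}) f_i T_i` of `H_n`
(0-based indexing: `fseq k = f_{k+1}`). -/
noncomputable def fseq (q : F) (n d : ℕ) (aa : ℕ → F) : ℕ → H F q n
  | 0 => felem F q n d aa
  | k + 1 =>
    if h : k < n - 1 then
      (T F q (⟨k, h⟩ : Fin (n - 1)) +
          (q - q⁻¹) • (C F q (lo (⟨k, h⟩ : Fin (n - 1))) *
            C F q (hi (⟨k, h⟩ : Fin (n - 1))))) *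
        fseq q n d aa k * T F q (⟨k, h⟩ : Fin (n - 1))
    else 0

/-- `f_Z = f_{z_1} ⋯ f_{z_u}` for `Z = {z_1 < ⋯ < z_u} ⊆ {1,…,n}` (0-based). -/
noncomputable def fZ (q : F) (n d : ℕ) (aa : ℕ → F) (Z : Finset (Fin n)) : H F q n :=
  ((Z.sort (· ≤ ·)).map fun z => fseq F q n d aa (z : ℕ)).prod

/-- The coinduced module `Hom_B(A, M)` along an algebra morphism `φ : B →ₐ A`:
the space of `F`-linear maps `ψ : A → M` with `ψ(φ(b)x) = b·ψ(x)`, on which `A` acts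
by right translation. -/
def coindAlong (F : Type) [Field F] {A B : Type} [Ring A] [Ring B]
    [Algebra F A] [Algebra F B] (φ : B →ₐ[F] A) {M : Type} [AddCommGroup M]
    [Module F M] (ρ : B →ₐ[F] Module.End F M) : Submodule F (A →ₗ[F] M) where
  carrier := {ψ | ∀ (b : B) (x : A), ψ (φ b * x) = ρ b (ψ x)}
  add_mem' := by
    intro f g hf hg b x
    simp only [LinearMap.add_apply, hf b x, hg b x, map_add]
  zero_mem' := by intro b x; simp only [LinearMap.zero_apply, map_zero]
  smul_mem' := by
    intro cc f hf b x
    simp only [LinearMap.smul_apply, hf b x, map_smul]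

section Frobenius

variable {F}
variable {A B : Type} [Ring A] [Ring B] [Algebra F A] [Algebra F B]

/-- `θ : A → B` is a `B`-bimodule map. -/
structure IsBimoduleMap (e : B →ₐ[F] A) (θ : A →ₗ[F] B) : Prop where
  left : ∀ b x, θ (e b * x) = b * θ x
  right : ∀ x b, θ (x * e b) = θ x * b

/-- Maps of the form `x ↦ ∑ i, θ(x aᵢ) bᵢ`. -/
def IsLeftExpansion (e : B →ₐ[F] A) (θ : A →ₗ[F] B) (φ : A → A) : Prop :=
  ∃ (ι : Type) (_ : Fintype ι) (a b : ι → A), ∀ x, φ x = ∑ i, e (θ (x * a i)) * b i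

/-- Maps of the form `x ↦ ∑ i, aᵢ θ(bᵢ x)`. -/
def IsRightExpansion (e : B →ₐ[F] A) (θ : A →ₗ[F] B) (φ : A → A) : Prop :=
  ∃ (ι : Type) (_ : Fintype ι) (a b : ι → A), ∀ x, φ x = ∑ i, a i * e (θ (b i * x))

variable {e : B →ₐ[F] A} {θ : A →ₗ[F] B}

theorem IsLeftExpansion.single (a b : A) :
    IsLeftExpansion e θ fun x => e (θ (x * a)) * b :=
  ⟨Unit, inferInstance, fun _ => a, fun _ => b, fun x => by simp⟩

theorem IsRightExpansion.single (a b : A) :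
    IsRightExpansion e θ fun x => a * e (θ (b * x)) :=
  ⟨Unit, inferInstance, fun _ => a, fun _ => b, fun x => by simp⟩

theorem IsLeftExpansion.add {φ ψ : A → A} (hφ : IsLeftExpansion e θ φ)
    (hψ : IsLeftExpansion e θ ψ) : IsLeftExpansion e θ fun x => φ x + ψ x := by
  obtain ⟨ι, _, a, b, h⟩ := hφ
  obtain ⟨κ, _, a', b', h'⟩ := hψ
  exact ⟨ι ⊕ κ, inferInstance, Sum.elim a a', Sum.elim b b', fun x => by
    simp [Fintype.sum_sum_type, h, h']⟩

theorem IsRightExpansion.add {φ ψ : A → A} (hφ : IsRightExpansion e θ φ)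
    (hψ : IsRightExpansion e θ ψ) : IsRightExpansion e θ fun x => φ x + ψ x := by
  obtain ⟨ι, _, a, b, h⟩ := hφ
  obtain ⟨κ, _, a', b', h'⟩ := hψ
  exact ⟨ι ⊕ κ, inferInstance, Sum.elim a a', Sum.elim b b', fun x => by
    simp [Fintype.sum_sum_type, h, h']⟩

theorem IsLeftExpansion.neg {φ : A → A} (hφ : IsLeftExpansion e θ φ) :
    IsLeftExpansion e θ fun x => -φ x := by
  obtain ⟨ι, _, a, b, h⟩ := hφ
  exact ⟨ι, inferInstance, a, fun i => -b i, fun x => by simp [h]⟩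

theorem IsRightExpansion.neg {φ : A → A} (hφ : IsRightExpansion e θ φ) :
    IsRightExpansion e θ fun x => -φ x := by
  obtain ⟨ι, _, a, b, h⟩ := hφ
  exact ⟨ι, inferInstance, fun i => -a i, b, fun x => by simp [h]⟩

theorem IsLeftExpansion.comp (hθ : IsBimoduleMap e θ) {φ ψ : A → A}
    (hφ : IsLeftExpansion e θ φ) (hψ : IsLeftExpansion e θ ψ) :
    IsLeftExpansion e θ fun x => φ (ψ x) := by
  obtain ⟨ι, _, a, b, h⟩ := hφ
  obtain ⟨κ, _, a', b', h'⟩ := hψ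
  refine ⟨ι × κ, inferInstance, fun p => a' p.2 * e (θ (b' p.2 * a p.1)), fun p => b p.1,
    fun x => ?_⟩
  simp only [h, h', Fintype.sum_prod_type, Finset.sum_mul, map_sum, mul_assoc, hθ.left]
  simp only [← mul_assoc, hθ.right]

theorem IsRightExpansion.comp (hθ : IsBimoduleMap e θ) {φ ψ : A → A}
    (hφ : IsRightExpansion e θ φ) (hψ : IsRightExpansion e θ ψ) :
    IsRightExpansion e θ fun x => φ (ψ x) := by
  obtain ⟨ι, _, a, b, h⟩ := hφ
  obtain ⟨κ, _, a', b', h'⟩ := hψ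
  refine ⟨ι × κ, inferInstance, fun p => a p.1, fun p => e (θ (b p.1 * a' p.2)) * b' p.2,
    fun x => ?_⟩
  simp only [h, h', Fintype.sum_prod_type, Finset.mul_sum, map_sum, mul_assoc, hθ.left]
  simp only [← mul_assoc, hθ.right]

/-- Some left expansion is the identity on `U`. -/
def LeftRecovers (e : B →ₐ[F] A) (θ : A →ₗ[F] B) (U : A → Prop) : Prop :=
  ∃ φ, IsLeftExpansion e θ φ ∧ ∀ x, U x → φ x = x

/-- Some right expansion is the identity on `U`. -/
def RightRecovers (e : B →ₐ[F] A) (θ : A →ₗ[F] B) (U : A → Prop) : Prop :=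
  ∃ φ, IsRightExpansion e θ φ ∧ ∀ x, U x → φ x = x

theorem LeftRecovers.step (hθ : IsBimoduleMap e θ) {U V : A → Prop}
    (hU : LeftRecovers e θ U) (φ : A → A) (hφ : IsLeftExpansion e θ φ)
    (h : ∀ x, V x → U (x - φ x)) : LeftRecovers e θ V := by
  obtain ⟨ψ, hψ, hid⟩ := hU
  have hadd : ∀ x y, ψ (x - y) = ψ x - ψ y := by
    obtain ⟨ι, _, a, b, hab⟩ := hψ
    intro x y
    simp [hab, sub_mul, Finset.sum_sub_distrib]
  refine ⟨_, hφ.add (hψ.add (hψ.comp hθ hφ).neg), fun x hx => ?_⟩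
  have := hid _ (h x hx)
  rw [hadd] at this
  rw [← sub_eq_add_neg, this]
  abel

theorem RightRecovers.step (hθ : IsBimoduleMap e θ) {U V : A → Prop}
    (hU : RightRecovers e θ U) (φ : A → A) (hφ : IsRightExpansion e θ φ)
    (h : ∀ x, V x → U (x - φ x)) : RightRecovers e θ V := by
  obtain ⟨ψ, hψ, hid⟩ := hU
  have hadd : ∀ x y, ψ (x - y) = ψ x - ψ y := by
    obtain ⟨ι, _, a, b, hab⟩ := hψ
    intro x y
    simp [hab, mul_sub, Finset.sum_sub_distrib]
  refine ⟨_, hφ.add (hψ.add (hψ.comp hθ hφ).neg), fun x hx => ?_⟩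
  have := hid _ (h x hx)
  rw [hadd] at this
  rw [← sub_eq_add_neg, this]
  abel

/-- `θ` is the trace form of a Frobenius extension `e`, with dual bases `a`, `b`. -/
def IsFrobeniusForm (e : B →ₐ[F] A) (θ : A →ₗ[F] B) : Prop :=
  IsBimoduleMap e θ ∧ ∃ (ι : Type) (_ : Fintype ι) (a b : ι → A),
    (∀ x, ∑ i, e (θ (x * a i)) * b i = x) ∧ ∀ x, ∑ i, a i * e (θ (b i * x)) = x

theorem IsFrobeniusForm.of_recovers (hθ : IsBimoduleMap e θ)
    (hl : LeftRecovers e θ fun _ => True) (hr : RightRecovers e θ fun _ => True) :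
    IsFrobeniusForm e θ := by
  obtain ⟨φ, ⟨ι, _, a, b, hab⟩, hφ⟩ := hl
  obtain ⟨ψ, ⟨κ, _, a', b', hab'⟩, hψ⟩ := hr
  have h1 : ∀ x, ∑ i, e (θ (x * a i)) * b i = x := fun x => by rw [← hab, hφ x trivial]
  have inj : ∀ x, (∀ y, θ (y * x) = 0) → x = 0 := fun x hx => by
    rw [← hψ x trivial, hab']; simp [hx]
  refine ⟨hθ, ι, inferInstance, a, b, h1, fun x => ?_⟩
  rw [← sub_eq_zero]
  refine inj _ fun y => ?_
  have h2 : θ (y * x) = ∑ i, θ (y * a i) * θ (b i * x) := by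
    conv_lhs => rw [← h1 y]
    simp [Finset.sum_mul, mul_assoc, hθ.left]
  rw [mul_sub, map_sub, h2, Finset.mul_sum, map_sum, sub_eq_zero]
  exact Finset.sum_congr rfl fun i _ => by rw [← mul_assoc, hθ.right]

end Frobenius

section IndCoind

variable {A B : Type} [Ring A] [Ring B] [Algebra F A] [Algebra F B]
  {e : B →ₐ[F] A} {θ : A →ₗ[F] B}
  {M : Type} [AddCommGroup M] [Module F M] (ρ : B →ₐ[F] Module.End F M)
  {E : Type} [AddCommGroup E] [Module F E] {ρE : A →ₐ[F] Module.End F E}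
  {ι : M →ₗ[F] E}

/-- The action of `A` on the coinduced module by right translation. -/
def coindAction (e : B →ₐ[F] A) : A →ₐ[F] Module.End F (coindAlong F e ρ) where
  toFun a :=
    { toFun := fun ψ => ⟨ψ.val.comp (LinearMap.mulRight F a), fun b x => by
        simp only [LinearMap.comp_apply, LinearMap.mulRight_apply, mul_assoc]
        exact ψ.2 b (x * a)⟩
      map_add' := fun _ _ => rfl
      map_smul' := fun _ _ => rfl }
  map_one' := by ext; simp
  map_mul' := fun a b => by ext; simp [mul_assoc]
  map_zero' := by ext; simp
  map_add' := fun a b => by ext; simp [mul_add]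
  commutes' := fun r => by
    ext ψ x
    simp [Algebra.algebraMap_eq_smul_one]

@[simp] theorem coindAction_apply (a : A) (ψ : coindAlong F e ρ) (x : A) :
    (coindAction F ρ e a ψ).val x = ψ.val (x * a) := rfl

/-- The map `M → Hom_B(A, M)` given by a bimodule form. -/
def coindUnit (hθ : IsBimoduleMap e θ) : M →ₗ[F] coindAlong F e ρ where
  toFun m := ⟨(LinearMap.applyₗ m).comp (ρ.toLinearMap.comp θ), fun b x => by
    simp [hθ.left]⟩
  map_add' := fun _ _ => by ext; simp
  map_smul' := fun _ _ => by ext; simp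

@[simp] theorem coindUnit_apply (hθ : IsBimoduleMap e θ) (m : M) (x : A) :
    (coindUnit F ρ hθ m).val x = ρ (θ x) m := rfl

theorem IsFrobeniusForm.exists_equiv (h : IsFrobeniusForm e θ)
    (hInd : IsInducedAlong F e ρ ρE ι) :
    ∃ Φ : E ≃ₗ[F] coindAlong F e ρ,
      ∀ (x y : A) (v : E), (Φ (ρE x v)).val y = (Φ v).val (y * x) := by
  obtain ⟨hθ, κ, _, a, b, h1, h2⟩ := h
  obtain ⟨hι, huniv⟩ := hInd
  obtain ⟨Φ, ⟨hΦ, hΦι⟩, -⟩ := huniv _ (coindAction F ρ e) (coindUnit F ρ hθ)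
    (fun c m => by ext x; simp [hθ.right])
  let Ψ : coindAlong F e ρ →ₗ[F] E :=
    ∑ i, (ρE (a i)).comp (ι.comp ((LinearMap.applyₗ (b i)).comp (Submodule.subtype _)))
  have Ψap : ∀ ψ, Ψ ψ = ∑ i, ρE (a i) (ι (ψ.val (b i))) := fun ψ => by simp [Ψ]
  have hΦΨ : ∀ ψ, Φ (Ψ ψ) = ψ := fun ψ => by
    ext x
    simp only [Ψap, map_sum, hΦ, hΦι]
    rw [AddSubmonoidClass.coe_finsetSum, LinearMap.sum_apply]
    simp only [coindAction_apply, coindUnit_apply]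
    conv_rhs => rw [← h1 x, map_sum]
    exact Finset.sum_congr rfl fun i _ => (ψ.2 _ _).symm
  have hΨΦι : ∀ m, Ψ (Φ (ι m)) = ι m := fun m => by
    rw [hΦι, Ψap]
    simp only [coindUnit_apply, hι, ← Module.End.mul_apply, ← map_mul]
    rw [← LinearMap.sum_apply, ← map_sum]
    have := h2 1
    simp only [mul_one] at this
    rw [this, map_one, Module.End.one_apply]
  have hΨ : ∀ x ψ, Ψ (coindAction F ρ e x ψ) = ρE x (Ψ ψ) := fun x ψ => by
    simp only [Ψap, coindAction_apply, map_sum]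
    have e1 : ∀ i, b i * x = ∑ j, e (θ (b i * x * a j)) * b j := fun i => (h1 _).symm
    have e2 : ∀ j, x * a j = ∑ i, a i * e (θ (b i * (x * a j))) := fun j => (h2 _).symm
    have hl : ∀ i, ρE (a i) (ι (ψ.val (b i * x))) =
        ∑ j, ρE (a i * e (θ (b i * (x * a j)))) (ι (ψ.val (b j))) := fun i => by
      rw [e1 i, map_sum, map_sum, map_sum]
      refine Finset.sum_congr rfl fun j _ => ?_
      rw [show ψ.val (e (θ (b i * x * a j)) * b j) = _ from ψ.2 _ _, hι, map_mul ρE,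
        mul_assoc (b i)]
      rfl
    simp only [hl]
    rw [Finset.sum_comm]
    refine Finset.sum_congr rfl fun j _ => ?_
    rw [← LinearMap.sum_apply, ← map_sum, ← e2, map_mul]
    rfl
  have hΨΦ : ∀ v, Ψ (Φ v) = v := fun v => by
    obtain ⟨g, -, hg⟩ := huniv E ρE ι hι
    have e1 := hg (Ψ.comp Φ) ⟨fun x v => by simp only [LinearMap.comp_apply, hΦ, hΨ], hΨΦι⟩
    have e2 := hg LinearMap.id ⟨fun x v => rfl, fun m => rfl⟩
    exact LinearMap.congr_fun (e1.trans e2.symm) v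
  exact ⟨LinearEquiv.ofLinearMap Φ Ψ (LinearMap.ext hΦΨ) (LinearMap.ext hΨΦ),
    fun x y v => by simp [hΦ]⟩

theorem IsInducedAlong.adjunction (hInd : IsInducedAlong F e ρ ρE ι)
    {P : Type} [AddCommGroup P] [Module F P] (ρP : A →ₐ[F] Module.End F P) :
    Nonempty (eqvHoms F ρE ρP ≃ₗ[F] eqvHoms F ρ (ρP.comp e)) := by
  obtain ⟨hι, huniv⟩ := hInd
  let res : eqvHoms F ρE ρP →ₗ[F] eqvHoms F ρ (ρP.comp e) :=
    { toFun := fun g => ⟨g.val.comp ι, fun b m => by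
        simp only [LinearMap.comp_apply, hι, AlgHom.comp_apply]
        exact g.2 _ _⟩
      map_add' := fun _ _ => rfl
      map_smul' := fun _ _ => rfl }
  refine ⟨LinearEquiv.ofBijective res ⟨fun g g' hgg => ?_, fun f => ?_⟩⟩
  · have hm : ∀ m, g.val (ι m) = g'.val (ι m) := fun m =>
      LinearMap.congr_fun (congrArg Subtype.val hgg) m
    obtain ⟨k, -, hk⟩ := huniv P ρP (g.val.comp ι)
      (fun b m => (res g).2 b m)
    exact Subtype.ext ((hk _ ⟨g.2, fun _ => rfl⟩).trans (hk _ ⟨g'.2, fun m => (hm m).symm⟩).symm)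
  · obtain ⟨g, ⟨hg, hgι⟩, -⟩ := huniv P ρP f.val f.2
    exact ⟨⟨g, hg⟩, Subtype.ext (LinearMap.ext hgι)⟩

theorem IsFrobeniusForm.coadjunction (h : IsFrobeniusForm e θ)
    (hInd : IsInducedAlong F e ρ ρE ι)
    {P : Type} [AddCommGroup P] [Module F P] (ρP : A →ₐ[F] Module.End F P) :
    Nonempty (eqvHoms F ρP ρE ≃ₗ[F] eqvHoms F (ρP.comp e) ρ) := by
  obtain ⟨Φ, hΦ⟩ := h.exists_equiv F ρ hInd
  let ev : eqvHoms F ρP ρE →ₗ[F] eqvHoms F (ρP.comp e) ρ :=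
    { toFun := fun g => ⟨(LinearMap.applyₗ (1 : A)).comp
          ((Submodule.subtype _).comp (Φ.toLinearMap.comp g.val)), fun b p => by
        have h1 : g.val (ρP (e b) p) = ρE (e b) (g.val p) := g.2 _ _
        have h2 := (Φ (g.val p)).2 b 1
        simp only [LinearMap.comp_apply, AlgHom.comp_apply, Submodule.subtype_apply,
          LinearEquiv.coe_coe, LinearMap.applyₗ_apply_apply, h1, hΦ, one_mul]
        rw [← h2, mul_one]⟩
      map_add' := fun _ _ => by ext; simp
      map_smul' := fun _ _ => by ext; simp }
  have evap : ∀ g p, (ev g).val p = (Φ (g.val p)).val 1 := fun _ _ => rfl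
  refine ⟨LinearEquiv.ofBijective ev ⟨fun g g' hgg => ?_, fun f => ?_⟩⟩
  · refine Subtype.ext (LinearMap.ext fun p => Φ.injective (Subtype.ext
      (LinearMap.ext fun x => ?_)))
    have key : ∀ k : eqvHoms F ρP ρE, (Φ (k.val p)).val x = (ev k).val (ρP x p) := fun k => by
      rw [evap, show k.val (ρP x p) = ρE x (k.val p) from k.2 _ _, hΦ, one_mul]
    rw [key, key, hgg]
  · let co : P →ₗ[F] coindAlong F e ρ :=
      { toFun := fun p => ⟨f.val.comp ((LinearMap.applyₗ p).comp ρP.toLinearMap), fun b x => by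
          simp only [LinearMap.comp_apply, AlgHom.toLinearMap_apply, map_mul,
            LinearMap.applyₗ_apply_apply, Module.End.mul_apply]
          exact f.2 b (ρP x p)⟩
        map_add' := fun _ _ => by ext; simp
        map_smul' := fun _ _ => by ext; simp }
    have coap : ∀ p x, (co p).val x = f.val (ρP x p) := fun _ _ => rfl
    refine ⟨⟨Φ.symm.toLinearMap.comp co, fun x p => ?_⟩, ?_⟩
    · apply Φ.injective
      ext y
      simp only [LinearMap.comp_apply, LinearEquiv.coe_coe, LinearEquiv.apply_symm_apply, hΦ,
        coap, map_mul, Module.End.mul_apply]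
    · ext p
      rw [evap]
      simp [coap]

end IndCoind

section Relations

variable {F}

/-- Sequences of elements of an algebra, the first `n` (respectively `n - 1`) terms of which
satisfy the defining relations of the affine Hecke–Clifford superalgebra. -/
structure IsHData {R : Type} [Ring R] [Algebra F R] (q : F) (n : ℕ) (x xi c t : ℕ → R) :
    Prop where
  x_xi : ∀ i < n, x i * xi i = 1
  xi_x : ∀ i < n, xi i * x i = 1
  xx : ∀ i < n, ∀ j < n, x i * x j = x j * x i
  xixi : ∀ i < n, ∀ j < n, xi i * xi j = xi j * xi i
  xxi : ∀ i < n, ∀ j < n, i ≠ j → x i * xi j = xi j * x i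
  cc : ∀ i < n, c i * c i = 1
  canti : ∀ i < n, ∀ j < n, i ≠ j → c i * c j = -(c j * c i)
  cx : ∀ i < n, c i * x i = xi i * c i
  cxi : ∀ i < n, c i * xi i = x i * c i
  cxo : ∀ i < n, ∀ j < n, i ≠ j → c i * x j = x j * c i
  cxio : ∀ i < n, ∀ j < n, i ≠ j → c i * xi j = xi j * c i
  quad : ∀ i, i + 1 < n → t i * t i = (q - q⁻¹) • t i + 1
  braid : ∀ i, i + 2 < n → t i * t (i + 1) * t i = t (i + 1) * t i * t (i + 1)
  far : ∀ i j, i + 1 < j → j + 1 < n → t i * t j = t j * t i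
  tc : ∀ i, i + 1 < n → t i * c i = c (i + 1) * t i
  tco : ∀ i, i + 1 < n → ∀ j < n, j ≠ i → j ≠ i + 1 → t i * c j = c j * t i
  txo : ∀ i, i + 1 < n → ∀ j < n, j ≠ i → j ≠ i + 1 → t i * x j = x j * t i
  txio : ∀ i, i + 1 < n → ∀ j < n, j ≠ i → j ≠ i + 1 → t i * xi j = xi j * t i
  cross : ∀ i, i + 1 < n →
    (t i + (q - q⁻¹) • (c i * c (i + 1))) * x i * t i = x (i + 1)

theorem comm_inv_of_comm {R : Type} [Ring R] {a x xi : R} (h1 : x * xi = 1)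
    (h2 : xi * x = 1) (h : a * x = x * a) : a * xi = xi * a := by
  calc a * xi = xi * (x * a) * xi := by rw [← mul_assoc xi, h2, one_mul]
    _ = xi * a := by rw [← h, mul_assoc, mul_assoc, h1, mul_one]

theorem skew_inv_of_skew {R : Type} [Ring R] {a x xi : R} (h1 : x * xi = 1)
    (h : a * x = xi * a) : a * xi = x * a := by
  calc a * xi = x * (xi * a) * xi := by rw [← mul_assoc x, h1, one_mul]
    _ = x * a := by rw [← h, mul_assoc, mul_assoc, h1, mul_one]

/-- The relations for the inverses `X_i⁻¹` follow from the other ones. -/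
theorem IsHData.of_basic {R : Type} [Ring R] [Algebra F R] {q : F} {n : ℕ}
    {x xi c t : ℕ → R}
    (x_xi : ∀ i < n, x i * xi i = 1) (xi_x : ∀ i < n, xi i * x i = 1)
    (xx : ∀ i < n, ∀ j < n, x i * x j = x j * x i)
    (cc : ∀ i < n, c i * c i = 1)
    (canti : ∀ i < n, ∀ j < n, i ≠ j → c i * c j = -(c j * c i))
    (cx : ∀ i < n, c i * x i = xi i * c i)
    (cxo : ∀ i < n, ∀ j < n, i ≠ j → c i * x j = x j * c i)
    (quad : ∀ i, i + 1 < n → t i * t i = (q - q⁻¹) • t i + 1)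
    (braid : ∀ i, i + 2 < n → t i * t (i + 1) * t i = t (i + 1) * t i * t (i + 1))
    (far : ∀ i j, i + 1 < j → j + 1 < n → t i * t j = t j * t i)
    (tc : ∀ i, i + 1 < n → t i * c i = c (i + 1) * t i)
    (tco : ∀ i, i + 1 < n → ∀ j < n, j ≠ i → j ≠ i + 1 → t i * c j = c j * t i)
    (txo : ∀ i, i + 1 < n → ∀ j < n, j ≠ i → j ≠ i + 1 → t i * x j = x j * t i)
    (cross : ∀ i, i + 1 < n →
      (t i + (q - q⁻¹) • (c i * c (i + 1))) * x i * t i = x (i + 1)) :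
    IsHData q n x xi c t where
  x_xi := x_xi
  xi_x := xi_x
  xx := xx
  xixi i hi j hj := (comm_inv_of_comm (x_xi j hj) (xi_x j hj)
    (comm_inv_of_comm (x_xi i hi) (xi_x i hi) (xx j hj i hi)).symm)
  xxi i hi j hj _ := comm_inv_of_comm (x_xi j hj) (xi_x j hj) (xx i hi j hj)
  cc := cc
  canti := canti
  cx := cx
  cxi i hi := skew_inv_of_skew (x_xi i hi) (cx i hi)
  cxo := cxo
  cxio i hi j hj h := comm_inv_of_comm (x_xi j hj) (xi_x j hj) (cxo i hi j hj h)
  quad := quad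
  braid := braid
  far := far
  tc := tc
  tco := tco
  txo := txo
  txio i hi j hj h h' := comm_inv_of_comm (x_xi j hj) (xi_x j hj) (txo i hi j hj h h')
  cross := cross

/-- Fewer generators satisfy fewer relations. -/
theorem IsHData.mono {R : Type} [Ring R] [Algebra F R] {q : F} {n m : ℕ} {x xi c t : ℕ → R}
    (h : IsHData q n x xi c t) (hmn : m ≤ n) : IsHData q m x xi c t :=
  .of_basic (fun i hi => h.x_xi i (by omega)) (fun i hi => h.xi_x i (by omega))
    (fun i hi j hj => h.xx i (by omega) j (by omega))
    (fun i hi => h.cc i (by omega))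
    (fun i hi j hj => h.canti i (by omega) j (by omega))
    (fun i hi => h.cx i (by omega))
    (fun i hi j hj => h.cxo i (by omega) j (by omega))
    (fun i hi => h.quad i (by omega)) (fun i hi => h.braid i (by omega))
    (fun i j hi hj => h.far i j (by omega) (by omega))
    (fun i hi => h.tc i (by omega)) (fun i hi j hj => h.tco i (by omega) j (by omega))
    (fun i hi j hj => h.txo i (by omega) j (by omega)) (fun i hi => h.cross i (by omega))

theorem IsHData.map {R S : Type} [Ring R] [Algebra F R] [Ring S] [Algebra F S] {q : F} {n : ℕ}
    {x xi c t : ℕ → R} (h : IsHData q n x xi c t) (φ : R →ₐ[F] S) :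
    IsHData q n (fun i => φ (x i)) (fun i => φ (xi i)) (fun i => φ (c i))
      (fun i => φ (t i)) := by
  apply IsHData.of_basic
  · intro i hi; simp only [← map_mul, h.x_xi i hi, map_one]
  · intro i hi; simp only [← map_mul, h.xi_x i hi, map_one]
  · intro i hi j hj; simp only [← map_mul, h.xx i hi j hj]
  · intro i hi; simp only [← map_mul, h.cc i hi, map_one]
  · intro i hi j hj hij; simp only [← map_mul, ← map_neg, h.canti i hi j hj hij]
  · intro i hi; simp only [← map_mul, h.cx i hi]
  · intro i hi j hj hij; simp only [← map_mul, h.cxo i hi j hj hij]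
  · intro i hi; simp only [← map_mul, h.quad i hi, map_add, map_smul, map_one]
  · intro i hi; simp only [← map_mul, h.braid i hi]
  · intro i j hij hj; simp only [← map_mul, h.far i j hij hj]
  · intro i hi; simp only [← map_mul, h.tc i hi]
  · intro i hi j hj h1 h2; simp only [← map_mul, h.tco i hi j hj h1 h2]
  · intro i hi j hj h1 h2; simp only [← map_mul, h.txo i hi j hj h1 h2]
  · intro i hi; simp only [← map_mul, ← map_smul, ← map_add, h.cross i hi]

variable (F)

/-- Generators of `H_n` indexed by natural numbers. -/
noncomputable def Xn (q : F) (n i : ℕ) : H F q n := if h : i < n then X F q ⟨i, h⟩ else 1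
noncomputable def Xin (q : F) (n i : ℕ) : H F q n := if h : i < n then Xinv F q ⟨i, h⟩ else 1
noncomputable def Cn (q : F) (n i : ℕ) : H F q n := if h : i < n then C F q ⟨i, h⟩ else 1
noncomputable def Tn (q : F) (n i : ℕ) : H F q n := if h : i < n - 1 then T F q ⟨i, h⟩ else 1

theorem rel_eq {q : F} {n : ℕ} {a b : FA F n} (h : Rel F q n a b) :
    RingQuot.mkAlgHom F (Rel F q n) a = RingQuot.mkAlgHom F (Rel F q n) b :=
  RingQuot.mkAlgHom_rel F h

theorem isHData_H (q : F) (n : ℕ) :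
    IsHData q n (Xn F q n) (Xin F q n) (Cn F q n) (Tn F q n) := by
  apply IsHData.of_basic
  · intro i hi
    simpa [Xn, Xin, hi, X, Xinv] using rel_eq F (Rel.XXinv (q := q) ⟨i, hi⟩)
  · intro i hi
    simpa [Xn, Xin, hi, X, Xinv] using rel_eq F (Rel.XinvX (q := q) ⟨i, hi⟩)
  · intro i hi j hj
    simpa [Xn, hi, hj, X] using rel_eq F (Rel.XX (q := q) ⟨i, hi⟩ ⟨j, hj⟩)
  · intro i hi
    simpa [Cn, hi, C] using rel_eq F (Rel.CC (q := q) ⟨i, hi⟩)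
  · intro i hi j hj hij
    simpa [Cn, hi, hj, C] using
      rel_eq F (Rel.Canti (q := q) ⟨i, hi⟩ ⟨j, hj⟩ (by simpa using hij))
  · intro i hi
    simpa [Cn, Xn, Xin, hi, C, X, Xinv] using rel_eq F (Rel.CX (q := q) ⟨i, hi⟩)
  · intro i hi j hj hij
    simpa [Cn, Xn, hi, hj, C, X] using
      rel_eq F (Rel.CXo (q := q) ⟨i, hi⟩ ⟨j, hj⟩ (by simpa using hij))
  · intro i hi
    have hi' : i < n - 1 := by omega
    simpa [Tn, hi', T] using rel_eq F (Rel.Tquad (q := q) ⟨i, hi'⟩)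
  · intro i hi
    have hi' : i < n - 1 := by omega
    have hi'' : i + 1 < n - 1 := by omega
    simpa [Tn, hi', hi'', T] using rel_eq F (Rel.Tbraid (q := q) ⟨i, hi'⟩ ⟨i + 1, hi''⟩ rfl)
  · intro i j hij hj
    have hi' : i < n - 1 := by omega
    have hj' : j < n - 1 := by omega
    simpa [Tn, hi', hj', T] using rel_eq F (Rel.TTfar (q := q) ⟨i, hi'⟩ ⟨j, hj'⟩ hij)
  · intro i hi
    have hi' : i < n - 1 := by omega
    have hi'' : i < n := by omega
    simpa [Tn, Cn, hi, hi', hi'', T, C, lo, HC.hi] using rel_eq F (Rel.TC (q := q) ⟨i, hi'⟩)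
  · intro i hi j hj h1 h2
    have hi' : i < n - 1 := by omega
    simpa [Tn, Cn, hj, hi', T, C] using rel_eq F (Rel.TCo (q := q) ⟨i, hi'⟩ ⟨j, hj⟩
      (by simpa [lo] using h1) (by simpa [HC.hi] using h2))
  · intro i hi j hj h1 h2
    have hi' : i < n - 1 := by omega
    simpa [Tn, Xn, hj, hi', T, X] using rel_eq F (Rel.TXo (q := q) ⟨i, hi'⟩ ⟨j, hj⟩
      (by simpa [lo] using h1) (by simpa [HC.hi] using h2))
  · intro i hi
    have hi' : i < n - 1 := by omega
    have hi'' : i < n := by omega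
    have := rel_eq F (Rel.cross (q := q) ⟨i, hi'⟩)
    simp only [map_mul, map_add, map_smul] at this
    simpa only [Tn, Xn, Cn, hi, hi', hi'', T, X, C, lo, HC.hi, dif_pos] using this

variable {F}
variable {R : Type} [Ring R] [Algebra F R] {q : F} {n : ℕ} {x xi c t : ℕ → R}

/-- The images of the generators prescribed by four sequences. -/
def genMap (n : ℕ) (x xi c t : ℕ → R) : Gen n → R
  | .X i => x i
  | .Xinv i => xi i
  | .C i => c i
  | .T i => t i

/-- The homomorphism out of `H_n` determined by elements satisfying the relations. -/
noncomputable def IsHData.lift (h : IsHData q n x xi c t) : H F q n →ₐ[F] R :=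
  RingQuot.liftAlgHom F ⟨FreeAlgebra.lift F (genMap n x xi c t), by
    intro a b hab
    induction hab with
    | XXinv i => simpa [fx, fxinv, genMap] using h.x_xi i i.2
    | XinvX i => simpa [fx, fxinv, genMap] using h.xi_x i i.2
    | XX i j => simpa [fx, fxinv, genMap] using h.xx i i.2 j j.2
    | XiXi i j => simpa [fx, fxinv, genMap] using h.xixi i i.2 j j.2
    | XXi i j hij =>
      simpa [fx, fxinv, genMap] using h.xxi i i.2 j j.2 (fun hh => hij (Fin.ext hh))
    | CC i => simpa [fc, genMap] using h.cc i i.2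
    | Canti i j hij => simpa [fc, genMap] using h.canti i i.2 j j.2 (fun hh => hij (Fin.ext hh))
    | CX i => simpa [fx, fxinv, fc, genMap] using h.cx i i.2
    | CXi i => simpa [fx, fxinv, fc, genMap] using h.cxi i i.2
    | CXo i j hij =>
      simpa [fx, fc, genMap] using h.cxo i i.2 j j.2 (fun hh => hij (Fin.ext hh))
    | CXio i j hij =>
      simpa [fxinv, fc, genMap] using h.cxio i i.2 j j.2 (fun hh => hij (Fin.ext hh))
    | Tquad i => simpa [ft, genMap] using h.quad i (by omega)
    | Tbraid i j hij =>
      simpa [ft, genMap, hij] using h.braid i (by omega)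
    | TTfar i j hij => simpa [ft, genMap] using h.far i j hij (by omega)
    | TC i => simpa [ft, fc, genMap, lo, hi] using h.tc i (by omega)
    | TCo i j h1 h2 =>
      simpa [ft, fc, genMap] using h.tco i (by omega) j j.2
        (fun hh => h1 (Fin.ext hh)) (fun hh => h2 (Fin.ext hh))
    | TXo i j h1 h2 =>
      simpa [ft, fx, genMap] using h.txo i (by omega) j j.2
        (fun hh => h1 (Fin.ext hh)) (fun hh => h2 (Fin.ext hh))
    | TXio i j h1 h2 =>
      simpa [ft, fxinv, genMap] using h.txio i (by omega) j j.2
        (fun hh => h1 (Fin.ext hh)) (fun hh => h2 (Fin.ext hh))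
    | cross i =>
      have := h.cross i (by omega)
      simp only [map_mul, map_add, map_smul, ft, fx, fc, FreeAlgebra.lift_ι_apply, genMap, lo, hi]
      exact this⟩

theorem IsHData.lift_X (h : IsHData q n x xi c t) (i : Fin n) : h.lift (X F q i) = x i := by
  simp [IsHData.lift, X, fx, genMap]
theorem IsHData.lift_Xinv (h : IsHData q n x xi c t) (i : Fin n) :
    h.lift (Xinv F q i) = xi i := by
  simp [IsHData.lift, Xinv, fxinv, genMap]
theorem IsHData.lift_C (h : IsHData q n x xi c t) (i : Fin n) : h.lift (C F q i) = c i := by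
  simp [IsHData.lift, C, fc, genMap]
theorem IsHData.lift_T (h : IsHData q n x xi c t) (i : Fin (n - 1)) :
    h.lift (T F q i) = t i := by
  simp [IsHData.lift, T, ft, genMap]

theorem IsHData.lift_Xn (h : IsHData q n x xi c t) {i : ℕ} (hi : i < n) :
    h.lift (Xn F q n i) = x i := by
  simp [Xn, hi, h.lift_X]
theorem IsHData.lift_Xin (h : IsHData q n x xi c t) {i : ℕ} (hi : i < n) :
    h.lift (Xin F q n i) = xi i := by
  simp [Xin, hi, h.lift_Xinv]
theorem IsHData.lift_Cn (h : IsHData q n x xi c t) {i : ℕ} (hi : i < n) :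
    h.lift (Cn F q n i) = c i := by
  simp [Cn, hi, h.lift_C]
theorem IsHData.lift_Tn (h : IsHData q n x xi c t) {i : ℕ} (hi : i + 1 < n) :
    h.lift (Tn F q n i) = t i := by
  simp [Tn, Nat.lt_sub_of_add_lt hi, h.lift_T]

/-- The set of generators given by four sequences. -/
def genSet (n : ℕ) (x xi c t : ℕ → R) : Set R :=
  {a | (∃ i < n, a = x i) ∨ (∃ i < n, a = xi i) ∨ (∃ i < n, a = c i) ∨
    ∃ i, i + 1 < n ∧ a = t i}

variable (F)

theorem adjoin_genSet_H (q : F) (n : ℕ) :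
    Algebra.adjoin F (genSet n (Xn F q n) (Xin F q n) (Cn F q n) (Tn F q n)) = ⊤ := by
  have hs := RingQuot.mkAlgHom_surjective F (Rel F q n)
  rw [← AlgHom.range_eq_top] at hs
  rw [← top_le_iff, ← hs, ← Algebra.map_top, ← FreeAlgebra.adjoin_range_ι, AlgHom.map_adjoin,
    Algebra.adjoin_le_iff]
  rintro _ ⟨_, ⟨g, rfl⟩, rfl⟩
  apply Algebra.subset_adjoin
  cases g with
  | X i => exact Or.inl ⟨i, i.2, by simp [Xn, X, fx]⟩
  | Xinv i => exact Or.inr (Or.inl ⟨i, i.2, by simp [Xin, Xinv, fxinv]⟩)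
  | C i => exact Or.inr (Or.inr (Or.inl ⟨i, i.2, by simp [Cn, C, fc]⟩))
  | T i => exact Or.inr (Or.inr (Or.inr ⟨i, by omega, by simp [Tn, T, ft]⟩))

end Relations

section Elimination

variable {F}
variable {A B : Type} [Ring A] [Ring B] [Algebra F A] [Algebra F B]

/-- The additive subgroup `B T B` of `A`. -/
def midSpan (e : B →ₐ[F] A) (T : A) : AddSubgroup A :=
  AddSubgroup.closure {a | ∃ b b', a = e b * T * e b'}

/-- The additive subgroup spanned by `B X^i` for `i < j`, `B X^i C` for `i < k` and `B T B`. -/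
def levelSpan (e : B →ₐ[F] A) (X C T : A) (j k : ℕ) : AddSubgroup A :=
  AddSubgroup.closure ({a | ∃ i < j, ∃ b, a = e b * X ^ i} ∪
    {a | ∃ i < k, ∃ b, a = e b * (X ^ i * C)} ∪ {a | ∃ b b', a = e b * T * e b'})

theorem levelSpan_zero (e : B →ₐ[F] A) (X C T : A) :
    levelSpan e X C T 0 0 = midSpan e T := by
  simp [levelSpan, midSpan]

section
variable {e : B →ₐ[F] A} {X C T : A} {j k : ℕ}

theorem levelSpan_pow {i : ℕ} (hi : i < j) (b : B) : e b * X ^ i ∈ levelSpan e X C T j k :=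
  AddSubgroup.subset_closure (Or.inl (Or.inl ⟨i, hi, b, rfl⟩))

theorem levelSpan_pow_C {i : ℕ} (hi : i < k) (b : B) :
    e b * (X ^ i * C) ∈ levelSpan e X C T j k :=
  AddSubgroup.subset_closure (Or.inl (Or.inr ⟨i, hi, b, rfl⟩))

theorem levelSpan_mid (b b' : B) : e b * T * e b' ∈ levelSpan e X C T j k :=
  AddSubgroup.subset_closure (Or.inr ⟨b, b', rfl⟩)

theorem levelSpan_induction {p : A → Prop} (h1 : ∀ i < j, ∀ b, p (e b * X ^ i))
    (h2 : ∀ i < k, ∀ b, p (e b * (X ^ i * C))) (h3 : ∀ b b', p (e b * T * e b'))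
    (h0 : p 0) (hadd : ∀ x y, p x → p y → p (x + y)) (hneg : ∀ x, p x → p (-x))
    {a : A} (ha : a ∈ levelSpan e X C T j k) : p a := by
  induction ha using AddSubgroup.closure_induction with
  | mem a ha =>
    rcases ha with (⟨i, hi, b, rfl⟩ | ⟨i, hi, b, rfl⟩) | ⟨b, b', rfl⟩
    exacts [h1 i hi b, h2 i hi b, h3 b b']
  | zero => exact h0
  | add x y _ _ hx hy => exact hadd x y hx hy
  | neg x _ hx => exact hneg x hx

end

/-- The values and relations of the trace form `θ` of the extension `e`, where `A` is
generated by `B` together with `X`, `C` and `T`. -/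
structure IsTrace (e : B →ₐ[F] A) (θ : A →ₗ[F] B) (δ : B →ₐ[F] B) (X Xi C T : A)
    (d : ℕ) (a : F) : Prop where
  bim : IsBimoduleMap e θ
  a_ne : a ≠ 0
  d_pos : 0 < d
  X_Xi : X * Xi = 1
  Xi_X : Xi * X = 1
  CC : C * C = 1
  CX : C * X = Xi * C
  Xe : ∀ b, X * e b = e b * X
  Ce : ∀ b, C * e b = e (δ b) * C
  one : θ 1 = a⁻¹ • 1
  pow : ∀ k, 0 < k → k < d → θ (X ^ k) = 0
  top : θ (X ^ d) = -1
  pow_C : ∀ k, θ (X ^ k * C) = 0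
  C_pow : ∀ k, θ (C * X ^ k) = 0
  pow_T : ∀ k < d, θ (X ^ k * T) = 0
  pow_C_T : ∀ k < d, θ (X ^ k * (C * T)) = 0
  T_pow : ∀ k < d, θ (T * X ^ k) = 0
  T_C_pow : ∀ k, 0 < k → k ≤ d → θ (T * (C * X ^ k)) = 0

namespace IsTrace

variable {e : B →ₐ[F] A} {θ : A →ₗ[F] B} {δ : B →ₐ[F] B} {X Xi C T : A} {d : ℕ} {a : F}

theorem pow_e (h : IsTrace e θ δ X Xi C T d a) (k : ℕ) (b : B) : X ^ k * e b = e b * X ^ k :=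
  (Commute.pow_left (h.Xe b) k)

theorem e_C (h : IsTrace e θ δ X Xi C T d a) (b : B) : e b * C = C * e (δ b) := by
  calc e b * C = C * (C * e b) * C := by rw [← mul_assoc C, h.CC, one_mul]
    _ = C * e (δ b) := by rw [h.Ce, mul_assoc, mul_assoc, h.CC, mul_one]

theorem C_pow_eq (h : IsTrace e θ δ X Xi C T d a) (k : ℕ) : C * X ^ k = Xi ^ k * C :=
  (SemiconjBy.pow_right (h.CX : SemiconjBy C X Xi) k)

theorem pow_mul_pow (h : IsTrace e θ δ X Xi C T d a) {i k : ℕ} (hik : i ≤ k) :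
    X ^ k * Xi ^ i = X ^ (k - i) := by
  have hc : Commute X Xi := by rw [Commute, SemiconjBy, h.X_Xi, h.Xi_X]
  obtain ⟨m, rfl⟩ := Nat.exists_eq_add_of_le' hik
  rw [pow_add, mul_assoc, ← hc.mul_pow, h.X_Xi, one_pow, mul_one, Nat.add_sub_cancel]

theorem pow_C_pow (h : IsTrace e θ δ X Xi C T d a) (i k : ℕ) :
    θ (X ^ i * (C * X ^ k)) = 0 := by
  rcases le_total k i with hik | hik
  · rw [h.C_pow_eq, ← mul_assoc, h.pow_mul_pow hik, h.pow_C]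
  · obtain ⟨m, rfl⟩ := Nat.exists_eq_add_of_le hik
    rw [pow_add, ← mul_assoc C, h.C_pow_eq, mul_assoc, ← mul_assoc, h.pow_mul_pow le_rfl]
    simp [h.C_pow]

theorem pow_C_pow_C (h : IsTrace e θ δ X Xi C T d a) {i k : ℕ} (hik : i ≤ k) :
    X ^ k * C * (X ^ i * C) = X ^ (k - i) := by
  rw [mul_assoc, ← mul_assoc C, h.C_pow_eq, mul_assoc, h.CC, mul_one, h.pow_mul_pow hik]

theorem recovers_left_of_mid (h : IsTrace e θ δ X Xi C T d a)
    (hmid : LeftRecovers e θ (· ∈ midSpan e T)) :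
    LeftRecovers e θ (· ∈ levelSpan e X C T d d) := by
  have hC : ∀ j ≤ d, LeftRecovers e θ (· ∈ levelSpan e X C T 0 j) := by
    intro j
    induction j with
    | zero => intro _; rw [levelSpan_zero]; exact hmid
    | succ j ih =>
      intro hj
      refine (ih (by omega)).step h.bim _
        (IsLeftExpansion.single (e := e) (θ := θ) (C * X ^ (d - j)) (X ^ j * C)).neg
        fun x hx => ?_
      refine levelSpan_induction (p := fun x =>
        x - -(e (θ (x * (C * X ^ (d - j)))) * (X ^ j * C)) ∈ levelSpan e X C T 0 j)
        ?_ ?_ ?_ (by simp) ?_ ?_ hx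
      · intro i hi; omega
      · intro i hi b
        have e1 : e b * (X ^ i * C) * (C * X ^ (d - j)) = e b * X ^ (i + (d - j)) := by
          rw [pow_add, ← mul_assoc (e b), mul_assoc, ← mul_assoc C, h.CC, one_mul, mul_assoc]
        rw [e1, h.bim.left]
        rcases Nat.lt_succ_iff_lt_or_eq.1 hi with hlt | rfl
        · rw [h.pow _ (by omega) (by omega)]
          simpa using levelSpan_pow_C hlt b
        · rw [show i + (d - i) = d by omega, h.top]
          simp
      · intro b b'
        have e1 : e b * T * e b' * (C * X ^ (d - j)) =
            e b * (T * (C * X ^ (d - j)) * e (δ b')) := by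
          rw [mul_assoc _ (e b'), ← mul_assoc (e b'), h.e_C, mul_assoc C, ← h.pow_e]
          simp only [mul_assoc]
        rw [e1, h.bim.left, h.bim.right, h.T_C_pow _ (by omega) (by omega)]
        simpa using levelSpan_mid b b'
      · intro x y hx hy
        have := add_mem hx hy
        convert this using 1
        simp only [add_mul, map_add]; abel
      · intro x hx
        have := neg_mem hx
        convert this using 1
        simp only [neg_mul, map_neg]; abel
  have hX : ∀ j ≤ d, LeftRecovers e θ (· ∈ levelSpan e X C T j d) := by
    intro j
    induction j with
    | zero => intro _; exact hC d le_rfl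
    | succ j ih =>
      intro hj
      have main : ∀ s : A, ∀ u : F, (∀ i ≤ j, θ (X ^ i * s) = if i = j then u⁻¹ • 1 else 0) →
          u ≠ 0 → (∀ i, θ (X ^ i * C * s) = 0) → θ (T * s) = 0 → (∀ b, e b * s = s * e b) →
          LeftRecovers e θ (· ∈ levelSpan e X C T (j + 1) d) := by
        intro s u h1 hu h2 h3 h4
        refine (ih (by omega)).step h.bim _
          (IsLeftExpansion.single (e := e) (θ := θ) s (u • X ^ j)) fun x hx => ?_
        refine levelSpan_induction (p := fun x =>
          x - (e (θ (x * s)) * (u • X ^ j)) ∈ levelSpan e X C T j d)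
          ?_ ?_ ?_ (by simp) ?_ ?_ hx
        · intro i hi b
          rw [mul_assoc, h.bim.left, h1 i (by omega)]
          split_ifs with hij
          · subst hij
            simp [hu]
          · simpa using levelSpan_pow (by omega) b
        · intro i hi b
          rw [mul_assoc, h.bim.left, h2]
          simpa using levelSpan_pow_C hi b
        · intro b b'
          have e1 : e b * T * e b' * s = e b * (T * s) * e b' := by
            rw [mul_assoc _ (e b'), h4]
            simp only [mul_assoc]
          rw [e1, h.bim.right, h.bim.left, h3]
          simpa using levelSpan_mid b b'
        · intro x y hx hy
          have := add_mem hx hy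
          convert this using 1
          simp only [add_mul, map_add]; abel
        · intro x hx
          have := neg_mem hx
          convert this using 1
          simp only [neg_mul, map_neg]; abel
      rcases Nat.eq_zero_or_pos j with rfl | hj0
      · refine main 1 a (fun i hi => ?_) h.a_ne (fun i => ?_) ?_ (fun b => by simp)
        · obtain rfl : i = 0 := by omega
          simp [h.one]
        · simp [h.pow_C]
        · simpa using h.T_pow 0 h.d_pos
      · refine main (X ^ (d - j)) (-1) (fun i hi => ?_) (by simp) (fun i => ?_)
          (h.T_pow _ (by omega)) (fun b => (h.pow_e _ b).symm)
        · rw [← pow_add]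
          split_ifs with hij
          · subst hij
            rw [show i + (d - i) = d by omega, h.top, inv_neg, inv_one, neg_one_smul]
          · exact h.pow _ (by omega) (by omega)
        · rw [mul_assoc, h.pow_C_pow]
  exact hX d le_rfl

theorem recovers_right_of_mid (h : IsTrace e θ δ X Xi C T d a)
    (hmid : RightRecovers e θ (· ∈ midSpan e T)) :
    RightRecovers e θ (· ∈ levelSpan e X C T d d) := by
  have hC : ∀ j ≤ d, RightRecovers e θ (· ∈ levelSpan e X C T 0 j) := by
    intro j
    induction j with
    | zero => intro _; rw [levelSpan_zero]; exact hmid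
    | succ j ih =>
      intro hj
      refine (ih (by omega)).step h.bim _
        (IsRightExpansion.single (e := e) (θ := θ) (a • (X ^ j * C)) (X ^ j * C))
        fun x hx => ?_
      refine levelSpan_induction (p := fun x =>
        x - (a • (X ^ j * C)) * e (θ (X ^ j * C * x)) ∈ levelSpan e X C T 0 j)
        ?_ ?_ ?_ (by simp) ?_ ?_ hx
      · intro i hi; omega
      · intro i hi b
        have e1 : e b * (X ^ i * C) = X ^ i * C * e (δ b) := by
          rw [← mul_assoc, ← h.pow_e, mul_assoc, h.e_C, mul_assoc]
        rw [e1, ← mul_assoc (X ^ j * C), h.pow_C_pow_C (by omega), h.bim.right]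
        rcases Nat.lt_succ_iff_lt_or_eq.1 hi with hlt | rfl
        · rw [h.pow _ (by omega) (by omega), ← e1]
          simpa using levelSpan_pow_C hlt b
        · simp [h.one, h.a_ne]
      · intro b b'
        have e1 : X ^ j * C * (e b * T * e b') = e (δ b) * (X ^ j * (C * T)) * e b' := by
          simp only [← mul_assoc, ← h.pow_e]
          rw [mul_assoc _ C, h.Ce, ← mul_assoc]
        rw [e1, h.bim.right, h.bim.left, h.pow_C_T _ (by omega)]
        simpa using levelSpan_mid b b'
      · intro x y hx hy
        have := add_mem hx hy
        convert this using 1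
        simp only [mul_add, map_add]; abel
      · intro x hx
        have := neg_mem hx
        convert this using 1
        simp only [mul_neg, map_neg]; abel
  have hX : ∀ j ≤ d, RightRecovers e θ (· ∈ levelSpan e X C T j d) := by
    intro j
    induction j with
    | zero => intro _; exact hC d le_rfl
    | succ j ih =>
      intro hj
      have main : ∀ s : A, ∀ u : F, (∀ i ≤ j, θ (s * X ^ i) = if i = j then u⁻¹ • 1 else 0) →
          u ≠ 0 → (∀ i, θ (s * (X ^ i * C)) = 0) → θ (s * T) = 0 → (∀ b, s * e b = e b * s) →
          RightRecovers e θ (· ∈ levelSpan e X C T (j + 1) d) := by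
        intro s u h1 hu h2 h3 h4
        refine (ih (by omega)).step h.bim _
          (IsRightExpansion.single (e := e) (θ := θ) (u • X ^ j) s) fun x hx => ?_
        refine levelSpan_induction (p := fun x =>
          x - ((u • X ^ j) * e (θ (s * x))) ∈ levelSpan e X C T j d)
          ?_ ?_ ?_ (by simp) ?_ ?_ hx
        · intro i hi b
          rw [← mul_assoc, h4, mul_assoc, h.bim.left, h1 i (by omega)]
          split_ifs with hij
          · subst hij
            simp [hu, h.pow_e]
          · simpa using levelSpan_pow (by omega) b
        · intro i hi b
          rw [← mul_assoc s, h4, mul_assoc (e b), h.bim.left, h2]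
          simpa using levelSpan_pow_C hi b
        · intro b b'
          have e1 : s * (e b * T * e b') = e b * (s * T) * e b' := by
            rw [← mul_assoc, ← mul_assoc, h4]
            simp only [mul_assoc]
          rw [e1, h.bim.right, h.bim.left, h3]
          simpa using levelSpan_mid b b'
        · intro x y hx hy
          have := add_mem hx hy
          convert this using 1
          simp only [mul_add, map_add]; abel
        · intro x hx
          have := neg_mem hx
          convert this using 1
          simp only [mul_neg, map_neg]; abel
      rcases Nat.eq_zero_or_pos j with rfl | hj0
      · refine main 1 a (fun i hi => ?_) h.a_ne (fun i => ?_) ?_ (fun b => by simp)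
        · obtain rfl : i = 0 := by omega
          simp [h.one]
        · simp [h.pow_C]
        · simpa using h.pow_T 0 h.d_pos
      · refine main (X ^ (d - j)) (-1) (fun i hi => ?_) (by simp) (fun i => ?_)
          (h.pow_T _ (by omega)) (fun b => (h.pow_e _ b))
        · rw [← pow_add]
          split_ifs with hij
          · subst hij
            rw [show d - i + i = d by omega, h.top, inv_neg, inv_one, neg_one_smul]
          · exact h.pow _ (by omega) (by omega)
        · rw [← mul_assoc, ← pow_add, h.pow_C]
  exact hX d le_rfl

/-- The Frobenius property from a spanning statement and recovery of `B T B`. -/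
theorem isFrobeniusForm (h : IsTrace e θ δ X Xi C T d a)
    (hspan : levelSpan e X C T d d = ⊤)
    (hl : LeftRecovers e θ (· ∈ midSpan e T)) (hr : RightRecovers e θ (· ∈ midSpan e T)) :
    IsFrobeniusForm e θ := by
  refine .of_recovers h.bim ?_ ?_
  · simpa [hspan] using h.recovers_left_of_mid hl
  · simpa [hspan] using h.recovers_right_of_mid hr

end IsTrace
end Elimination

section Step

variable {F}
variable {A B B' : Type} [Ring A] [Ring B] [Ring B'] [Algebra F A] [Algebra F B] [Algebra F B']

/-- Relations between the last generators of two consecutive algebras in the tower. -/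
structure IsStep (ξ : F) (e : B →ₐ[F] A) (e' : B' →ₐ[F] B) (δ : B →ₐ[F] B) (y c T' : B)
    (X C T : A) : Prop where
  CC : C * C = 1
  Xe : ∀ b, X * e b = e b * X
  Ce : ∀ b, C * e b = e (δ b) * C
  δy : δ y = y
  δc : δ c = -c
  Te : ∀ b, T * e (e' b) = e (e' b) * T
  braid : T * e T' * T = e T' * T * e T'
  quad : T * T = ξ • T + 1
  XT : X * T = ξ • X + T * e y + ξ • (e c * C * e y)
  TX : T * X = e y * T - ξ • (e c * C * X) + ξ • X
  CT : C * T = T * e c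
  TC : T * C = e c * T - ξ • e c + ξ • C
  gen : Algebra.adjoin F (Set.range e ∪ {T}) = ⊤

theorem eq_top_of_mul_right_mem (S : AddSubgroup A) (G : Set A)
    (hG : Algebra.adjoin F G = ⊤) (h1 : 1 ∈ S) (hsmul : ∀ (r : F), ∀ s ∈ S, r • s ∈ S)
    (h : ∀ g ∈ G, ∀ s ∈ S, s * g ∈ S) : S = ⊤ := by
  rw [eq_top_iff]
  intro a _
  have key : ∀ a ∈ Algebra.adjoin F G, ∀ s ∈ S, s * a ∈ S := by
    intro a ha
    induction ha using Algebra.adjoin_induction with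
    | mem g hg => exact h g hg
    | algebraMap r =>
      intro s hs
      rw [← Algebra.commutes, ← Algebra.smul_def]
      exact hsmul r s hs
    | add a b _ _ ha hb => intro s hs; rw [mul_add]; exact add_mem (ha s hs) (hb s hs)
    | mul a b _ _ ha hb => intro s hs; rw [← mul_assoc]; exact hb _ (ha s hs)
  simpa using key a (by rw [hG]; trivial) 1 h1

theorem levelSpan_e_mul {e : B →ₐ[F] A} {X C T : A} {j k : ℕ} (b : B) {s : A}
    (hs : s ∈ levelSpan e X C T j k) : e b * s ∈ levelSpan e X C T j k := by
  refine levelSpan_induction (p := fun s => e b * s ∈ levelSpan e X C T j k)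
    ?_ ?_ ?_ (by simp) ?_ ?_ hs
  · intro i hi b'; rw [← mul_assoc, ← map_mul]; exact levelSpan_pow hi _
  · intro i hi b'; rw [← mul_assoc, ← map_mul]; exact levelSpan_pow_C hi _
  · intro b' b''; rw [← mul_assoc, ← mul_assoc, ← map_mul]; exact levelSpan_mid _ _
  · intro x y hx hy; rw [mul_add]; exact add_mem hx hy
  · intro x hx; rw [mul_neg]; exact neg_mem hx

theorem levelSpan_smul {e : B →ₐ[F] A} {X C T : A} {j k : ℕ} (r : F) {s : A}
    (hs : s ∈ levelSpan e X C T j k) : r • s ∈ levelSpan e X C T j k := by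
  have := levelSpan_e_mul (algebraMap F B r) hs
  rwa [AlgHom.commutes, ← Algebra.smul_def] at this

theorem levelSpan_mono {e : B →ₐ[F] A} {X C T : A} {j k j' k' : ℕ} (hj : j ≤ j') (hk : k ≤ k') :
    levelSpan e X C T j k ≤ levelSpan e X C T j' k' := by
  intro s hs
  refine levelSpan_induction (p := fun s => s ∈ levelSpan e X C T j' k')
    ?_ ?_ ?_ (zero_mem _) (fun _ _ => add_mem) (fun _ => neg_mem) hs
  · intro i hi b; exact levelSpan_pow (by omega) _
  · intro i hi b; exact levelSpan_pow_C (by omega) _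
  · intro b b'; exact levelSpan_mid _ _

namespace IsStep

variable {ξ : F} {e : B →ₐ[F] A} {e' : B' →ₐ[F] B} {δ : B →ₐ[F] B} {y c T' : B} {X C T : A}

theorem pow_e (h : IsStep ξ e e' δ y c T' X C T) (k : ℕ) (b : B) : X ^ k * e b = e b * X ^ k :=
  (Commute.pow_left (h.Xe b) k)

theorem e_C (h : IsStep ξ e e' δ y c T' X C T) (b : B) : e b * C = C * e (δ b) := by
  calc e b * C = C * (C * e b) * C := by rw [← mul_assoc C, h.CC, one_mul]
    _ = C * e (δ b) := by rw [h.Ce, mul_assoc, mul_assoc, h.CC, mul_one]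

theorem levelSpan_mul_e (h : IsStep ξ e e' δ y c T' X C T) {j k : ℕ} (b : B) {s : A}
    (hs : s ∈ levelSpan e X C T j k) : s * e b ∈ levelSpan e X C T j k := by
  refine levelSpan_induction (p := fun s => s * e b ∈ levelSpan e X C T j k)
    ?_ ?_ ?_ (by simp) ?_ ?_ hs
  · intro i hi b'; rw [mul_assoc, h.pow_e, ← mul_assoc, ← map_mul]; exact levelSpan_pow hi _
  · intro i hi b'
    rw [mul_assoc, mul_assoc, h.Ce, ← mul_assoc (X ^ i), h.pow_e, mul_assoc (e (δ b)),
      ← mul_assoc, ← map_mul]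
    exact levelSpan_pow_C hi _
  · intro b' b''; rw [mul_assoc _ (e b''), ← map_mul]; exact levelSpan_mid _ _
  · intro x y hx hy; rw [add_mul]; exact add_mem hx hy
  · intro x hx; rw [neg_mul]; exact neg_mem hx

theorem T_mem {j k : ℕ} : T ∈ levelSpan e X C T j k := by
  simpa using levelSpan_mid (e := e) (X := X) (C := C) (T := T) (j := j) (k := k) 1 1

theorem pow_mem {i j k : ℕ} (hi : i < j) : X ^ i ∈ levelSpan e X C T j k := by
  simpa using levelSpan_pow (e := e) (X := X) (C := C) (T := T) (j := j) (k := k) hi 1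

theorem pow_C_mem {i j k : ℕ} (hi : i < k) : X ^ i * C ∈ levelSpan e X C T j k := by
  simpa using levelSpan_pow_C (e := e) (X := X) (C := C) (T := T) (j := j) (k := k) hi 1

theorem pow_T_succ (h : IsStep ξ e e' δ y c T' X C T) (k : ℕ) :
    X ^ (k + 1) * T = ξ • X ^ (k + 1) + X ^ k * T * e y + ξ • (e c * (X ^ k * C) * e y) := by
  rw [pow_succ, mul_assoc, h.XT]
  simp only [mul_add, mul_smul_comm, ← mul_assoc, h.pow_e]

theorem pow_mul_T_mem (h : IsStep ξ e e' δ y c T' X C T) {k j : ℕ} (hk : k < j) :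
    X ^ k * T ∈ levelSpan e X C T j j := by
  induction k with
  | zero => simpa using T_mem
  | succ k ih =>
    rw [h.pow_T_succ]
    exact add_mem (add_mem (levelSpan_smul _ (pow_mem hk))
      (h.levelSpan_mul_e _ (ih (by omega))))
      (levelSpan_smul _ (h.levelSpan_mul_e _ (levelSpan_e_mul _ (pow_C_mem (by omega)))))

theorem X_mul_mem (h : IsStep ξ e e' δ y c T' X C T) {j : ℕ} (hj : 0 < j) {s : A}
    (hs : s ∈ levelSpan e X C T j j) : X * s ∈ levelSpan e X C T (j + 1) (j + 1) := by
  refine levelSpan_induction (p := fun s => X * s ∈ levelSpan e X C T (j + 1) (j + 1))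
    ?_ ?_ ?_ (by simp) ?_ ?_ hs
  · intro i hi b; rw [← mul_assoc, h.Xe, mul_assoc, ← pow_succ']
    exact levelSpan_pow (by omega) _
  · intro i hi b; rw [← mul_assoc, h.Xe, mul_assoc, ← mul_assoc X, ← pow_succ']
    exact levelSpan_pow_C (by omega) _
  · intro b b'
    rw [← mul_assoc, ← mul_assoc, h.Xe, mul_assoc (e b)]
    refine h.levelSpan_mul_e _ (levelSpan_e_mul _ ?_)
    simpa using h.pow_mul_T_mem (k := 1) (j := j + 1) (by omega)
  · intro x y hx hy; rw [mul_add]; exact add_mem hx hy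
  · intro x hx; rw [mul_neg]; exact neg_mem hx

theorem mul_C_mem (h : IsStep ξ e e' δ y c T' X C T) {j : ℕ} (hj : 0 < j) {s : A}
    (hs : s ∈ levelSpan e X C T j j) : s * C ∈ levelSpan e X C T j j := by
  refine levelSpan_induction (p := fun s => s * C ∈ levelSpan e X C T j j)
    ?_ ?_ ?_ (by simp) ?_ ?_ hs
  · intro i hi b; rw [mul_assoc]; exact levelSpan_pow_C (by omega) _
  · intro i hi b; rw [mul_assoc, mul_assoc, h.CC, mul_one]; exact levelSpan_pow (by omega) _
  · intro b b'
    rw [mul_assoc, h.e_C, mul_assoc, ← mul_assoc T, h.TC]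
    refine levelSpan_e_mul _ (h.levelSpan_mul_e _ (add_mem (sub_mem
      (levelSpan_e_mul _ T_mem) (levelSpan_smul _ ?_)) (levelSpan_smul _ ?_)))
    · simpa using levelSpan_pow (e := e) (X := X) (C := C) (T := T) (k := j) hj c
    · simpa using pow_C_mem (e := e) (X := X) (C := C) (T := T) (j := j) hj
  · intro x y hx hy; rw [add_mul]; exact add_mem hx hy
  · intro x hx; rw [neg_mul]; exact neg_mem hx

theorem T_y (h : IsStep ξ e e' δ y c T' X C T) :
    T * e y = X * T - ξ • X - ξ • (e c * C * e y) := by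
  rw [h.XT]; abel

theorem C_pow_y (h : IsStep ξ e e' δ y c T' X C T) (k : ℕ) :
    C * e (y ^ k) = e (y ^ k) * C := by
  rw [h.Ce, map_pow, h.δy]

/-- The basic recursion for `T y^k z T`. -/
theorem T_pow_y_succ (h : IsStep ξ e e' δ y c T' X C T) (k : ℕ) (z : A) :
    T * e (y ^ (k + 1)) * z = X * (T * e (y ^ k) * z) - ξ • (e (y ^ k) * (X * z)) -
      ξ • (e (c * y ^ (k + 1)) * (C * z)) := by
  have e1 : e c * C * e y * e (y ^ k) * z = e (c * y ^ (k + 1)) * (C * z) := by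
    rw [map_mul e c, mul_assoc (e c * C), ← map_mul, ← pow_succ', mul_assoc (e c) C, h.C_pow_y]
    simp only [mul_assoc]
  have e2 : X * e (y ^ k) * z = e (y ^ k) * (X * z) := by rw [h.Xe, mul_assoc]
  rw [pow_succ', map_mul, ← mul_assoc, h.T_y]
  simp only [sub_mul, smul_mul_assoc, ← e2, mul_assoc]
  rw [← pow_succ', ← e1]
  simp only [mul_assoc]

theorem T_pow_y_T_mem (h : IsStep ξ e e' δ y c T' X C T) (k : ℕ) :
    T * e (y ^ k) * T ∈ levelSpan e X C T (k + 1) (k + 1) := by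
  induction k with
  | zero =>
    simp only [pow_zero, map_one, mul_one, h.quad]
    exact add_mem (levelSpan_smul _ T_mem) (by simpa using pow_mem (X := X) (i := 0) (by omega))
  | succ k ih =>
    rw [h.T_pow_y_succ, h.CT]
    refine sub_mem (sub_mem (h.X_mul_mem (by omega) ih) (levelSpan_smul _ (levelSpan_e_mul _ ?_)))
      (levelSpan_smul _ (levelSpan_e_mul _ (h.levelSpan_mul_e _ T_mem)))
    simpa using h.pow_mul_T_mem (k := 1) (by omega)

theorem c_T (h : IsStep ξ e e' δ y c T' X C T) :
    e c * T = T * C + ξ • e c - ξ • C := by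
  rw [h.TC]; abel

theorem T_mul_T_mem (h : IsStep ξ e e' δ y c T' X C T) {d : ℕ} (hd : 0 < d)
    (hB : levelSpan e' y c T' d d = ⊤) (b : B) :
    T * e b * T ∈ levelSpan e X C T d d := by
  have hb : b ∈ levelSpan e' y c T' d d := by rw [hB]; trivial
  refine levelSpan_induction (p := fun b => T * e b * T ∈ levelSpan e X C T d d)
    ?_ ?_ ?_ (by simp) ?_ ?_ hb
  · intro i hi b
    rw [map_mul, ← mul_assoc, h.Te, mul_assoc, mul_assoc, ← mul_assoc T]
    exact levelSpan_e_mul _ (levelSpan_mono (by omega) (by omega) (h.T_pow_y_T_mem i))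
  · intro i hi b
    rw [map_mul, ← mul_assoc, h.Te, mul_assoc, mul_assoc, map_mul, mul_assoc, h.c_T]
    refine levelSpan_e_mul _ ?_
    have e1 : T * (e (y ^ i) * (T * C + ξ • e c - ξ • C)) =
        T * e (y ^ i) * T * C + ξ • (T * e (y ^ i * c)) - ξ • (T * C * e (y ^ i)) := by
      rw [mul_assoc T C, h.C_pow_y]
      simp only [mul_add, mul_sub, mul_smul_comm, map_mul, mul_assoc]
    rw [e1]
    refine sub_mem (add_mem (h.mul_C_mem hd
      (levelSpan_mono (by omega) (by omega) (h.T_pow_y_T_mem i)))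
      (levelSpan_smul _ (h.levelSpan_mul_e _ T_mem)))
      (levelSpan_smul _ (h.levelSpan_mul_e _ (h.mul_C_mem hd T_mem)))
  · intro b b'
    have e1 : T * e (e' b * T' * e' b') * T = e (e' b * T') * T * e (T' * e' b') := by
      calc T * e (e' b * T' * e' b') * T = (T * e (e' b)) * e T' * (e (e' b') * T) := by
            simp only [map_mul, mul_assoc]
        _ = e (e' b) * (T * e T' * T) * e (e' b') := by
            rw [← h.Te b', h.Te b]; simp only [mul_assoc]
        _ = _ := by rw [h.braid]; simp only [map_mul, mul_assoc]
    rw [e1]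
    exact levelSpan_mid _ _
  · intro x y hx hy; rw [map_add, mul_add, add_mul]; exact add_mem hx hy
  · intro x hx; rw [map_neg, mul_neg, neg_mul]; exact neg_mem hx

theorem mul_T_mem (h : IsStep ξ e e' δ y c T' X C T) {d : ℕ} (hd : 0 < d)
    (hB : levelSpan e' y c T' d d = ⊤) {s : A} (hs : s ∈ levelSpan e X C T d d) :
    s * T ∈ levelSpan e X C T d d := by
  refine levelSpan_induction (p := fun s => s * T ∈ levelSpan e X C T d d)
    ?_ ?_ ?_ (by simp) ?_ ?_ hs
  · intro i hi b; rw [mul_assoc]; exact levelSpan_e_mul _ (h.pow_mul_T_mem hi)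
  · intro i hi b
    rw [mul_assoc, mul_assoc, h.CT, ← mul_assoc (X ^ i)]
    exact levelSpan_e_mul _ (h.levelSpan_mul_e _ (h.pow_mul_T_mem hi))
  · intro b b'
    rw [mul_assoc, mul_assoc, ← mul_assoc T]
    exact levelSpan_e_mul _ (h.T_mul_T_mem hd hB b')
  · intro x y hx hy; rw [add_mul]; exact add_mem hx hy
  · intro x hx; rw [neg_mul]; exact neg_mem hx

theorem levelSpan_eq_top (h : IsStep ξ e e' δ y c T' X C T) {d : ℕ} (hd : 0 < d)
    (hB : levelSpan e' y c T' d d = ⊤) : levelSpan e X C T d d = ⊤ := by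
  refine eq_top_of_mul_right_mem _ _ h.gen ?_ (fun r s hs => levelSpan_smul r hs) ?_
  · simpa using pow_mem (e := e) (X := X) (C := C) (T := T) (k := d) hd
  · rintro g (⟨b, rfl⟩ | rfl) s hs
    · exact h.levelSpan_mul_e b hs
    · exact h.mul_T_mem hd hB hs

section Trace

variable {θ : A →ₗ[F] B} {θ' : B →ₗ[F] B'} {δ' : B' →ₐ[F] B'} {Xi : A} {yi : B} {d : ℕ} {a : F}

/-- The values of a trace form on products involving `T`. -/
theorem isTrace (h : IsStep ξ e e' δ y c T' X C T)
    (h0 : IsTrace e θ δ X Xi C 0 d a) (hT : θ T = 0) : IsTrace e θ δ X Xi C T d a := by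
  have V1 : ∀ k < d, θ (X ^ k * T) = 0 := by
    intro k
    induction k with
    | zero => intro _; simpa using hT
    | succ k ih =>
      intro hk
      rw [h.pow_T_succ]
      simp [h0.bim.right, h0.bim.left, ih (by omega), h0.pow _ (by omega) hk, h0.pow_C]
  have V3 : ∀ k, θ (T * X ^ (k + 1)) = y * θ (T * X ^ k) + ξ • θ (X ^ (k + 1)) := by
    intro k
    have e1 : T * X ^ (k + 1) = e y * (T * X ^ k) - ξ • (e c * (C * X ^ (k + 1))) +
        ξ • X ^ (k + 1) := by
      rw [pow_succ', ← mul_assoc, h.TX]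
      simp only [add_mul, sub_mul, smul_mul_assoc, mul_assoc]
    rw [e1]
    simp [h0.bim.left, h0.C_pow]
  have V3' : ∀ k < d, θ (T * X ^ k) = 0 := by
    intro k
    induction k with
    | zero => intro _; simpa using hT
    | succ k ih => intro hk; rw [V3, ih (by omega), h0.pow _ (by omega) hk]; simp
  refine { h0 with pow_T := V1, pow_C_T := ?_, T_pow := V3', T_C_pow := ?_ }
  · intro k hk
    rw [h.CT, ← mul_assoc, h0.bim.right, V1 k hk, zero_mul]
  · intro k hk0 hk
    have e1 : T * (C * X ^ k) = e c * (T * X ^ k) - ξ • (e c * X ^ k) + ξ • (C * X ^ k) := by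
      rw [← mul_assoc, h.TC]
      simp only [add_mul, sub_mul, smul_mul_assoc, mul_assoc]
    rw [e1]
    simp only [map_add, map_sub, map_smul, h0.bim.left, h0.C_pow, smul_zero, add_zero]
    rcases hk.lt_or_eq with hlt | rfl
    · rw [V3' k hlt, h0.pow k hk0 hlt]; simp
    · obtain ⟨m, rfl⟩ := Nat.exists_eq_succ_of_ne_zero hk0.ne'
      rw [V3, V3' m (by omega)]
      simp [h0.top]

theorem trace_T_mul_T (h : IsStep ξ e e' δ y c T' X C T) (h1 : IsTrace e θ δ X Xi C T d a)
    (h1' : IsTrace e' θ' δ' y yi c T' d a) (hB : levelSpan e' y c T' d d = ⊤) (b : B) :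
    θ (T * e b * T) = e' (θ' b) := by
  have hrec : ∀ z : A, (∀ m < d, θ (X ^ m * z) = 0) → (∀ m < d, θ (X ^ m * (C * z)) = 0) →
      ∀ k m, m + k < d → θ (X ^ m * (T * e (y ^ k) * z)) = θ (X ^ (m + k) * (T * z)) := by
    intro z hz hz' k
    induction k with
    | zero => intro m hm; simp
    | succ k ih =>
      intro m hm
      rw [h.T_pow_y_succ]
      have e1 : X ^ m * (X * (T * e (y ^ k) * z) - ξ • (e (y ^ k) * (X * z)) -
          ξ • (e (c * y ^ (k + 1)) * (C * z))) = X ^ (m + 1) * (T * e (y ^ k) * z) -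
          ξ • (e (y ^ k) * (X ^ (m + 1) * z)) -
          ξ • (e (c * y ^ (k + 1)) * (X ^ m * (C * z))) := by
        simp only [mul_sub, mul_smul_comm, ← mul_assoc, pow_succ]
        simp only [h.pow_e]
      rw [e1]
      simp only [map_sub, map_smul, h1.bim.left]
      rw [ih (m + 1) (by omega), hz _ (by omega), hz' _ (by omega)]
      simp [add_assoc, add_comm 1 k]
  have hb : b ∈ levelSpan e' y c T' d d := by rw [hB]; trivial
  refine levelSpan_induction (p := fun b => θ (T * e b * T) = e' (θ' b))
    ?_ ?_ ?_ (by simp) ?_ ?_ hb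
  · intro i hi b
    rw [map_mul e (e' b), ← mul_assoc, h.Te, mul_assoc, mul_assoc, ← mul_assoc T, h1.bim.left,
      h1'.bim.left, map_mul e']
    congr 1
    have := hrec T h1.pow_T h1.pow_C_T i 0 (by omega)
    rw [pow_zero, one_mul, zero_add] at this
    rw [this, h.quad, mul_add, mul_one, map_add, mul_smul_comm, map_smul, h1.pow_T i hi]
    rcases Nat.eq_zero_or_pos i with rfl | hi0
    · simp [h1.one, h1'.one]
    · simp [h1.pow i hi0 hi, h1'.pow i hi0 hi]
  · intro i hi b
    have hc : ∀ m < d, θ (X ^ m * (e c * T)) = 0 := fun m hm => by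
      rw [← mul_assoc, h.pow_e, mul_assoc, h1.bim.left, h1.pow_T m hm, mul_zero]
    have hc' : ∀ m < d, θ (X ^ m * (C * (e c * T))) = 0 := fun m hm => by
      rw [← mul_assoc C, h.Ce, mul_assoc, ← mul_assoc, h.pow_e, mul_assoc, h1.bim.left,
        h1.pow_C_T m hm, mul_zero]
    have := hrec (e c * T) hc hc' i 0 (by omega)
    rw [pow_zero, one_mul, zero_add] at this
    rw [map_mul e (e' b), ← mul_assoc, h.Te, mul_assoc, mul_assoc, map_mul e (y ^ i),
      mul_assoc (e (y ^ i)), ← mul_assoc T, h1.bim.left, h1'.bim.left, map_mul e', this,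
        ← mul_assoc T, ← h.CT,
      mul_assoc, h.quad, mul_add, mul_one, mul_add, mul_smul_comm, mul_smul_comm, map_add,
      map_smul, h1.pow_C_T i hi, h1.pow_C, h1'.pow_C]
    simp
  · intro b b'
    have e1 : T * e (e' b * T' * e' b') * T = e (e' b * T') * T * e (T' * e' b') := by
      calc T * e (e' b * T' * e' b') * T = (T * e (e' b)) * e T' * (e (e' b') * T) := by
            simp only [map_mul, mul_assoc]
        _ = e (e' b) * (T * e T' * T) * e (e' b') := by
            rw [← h.Te b', h.Te b]; simp only [mul_assoc]
        _ = _ := by rw [h.braid]; simp only [map_mul, mul_assoc]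
    have hT := h1.pow_T 0 h1.d_pos
    have hT' := h1'.pow_T 0 h1.d_pos
    rw [pow_zero, one_mul] at hT hT'
    rw [e1, h1.bim.right, h1.bim.left, hT, h1'.bim.right, h1'.bim.left, hT']
    simp
  · intro x y hx hy; rw [map_add, mul_add, add_mul, map_add, hx, hy, map_add, map_add]
  · intro x hx; rw [map_neg, mul_neg, neg_mul, map_neg, hx, map_neg, map_neg]

theorem recovers_mid (h : IsStep ξ e e' δ y c T' X C T) (h1 : IsTrace e θ δ X Xi C T d a)
    (h1' : IsTrace e' θ' δ' y yi c T' d a) (hB : levelSpan e' y c T' d d = ⊤)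
    (hfrob : IsFrobeniusForm e' θ') :
    LeftRecovers e θ (· ∈ midSpan e T) ∧ RightRecovers e θ (· ∈ midSpan e T) := by
  obtain ⟨-, κ, _, u, w, hu, hw⟩ := hfrob
  have key := h.trace_T_mul_T h1 h1' hB
  constructor
  · refine ⟨fun x => ∑ i, e (θ (x * (e (u i) * T))) * (T * e (w i)),
      ⟨κ, inferInstance, _, _, fun _ => rfl⟩, fun x hx => ?_⟩
    induction hx using AddSubgroup.closure_induction with
    | mem x hx =>
      obtain ⟨b, b', rfl⟩ := hx
      calc ∑ i, e (θ (e b * T * e b' * (e (u i) * T))) * (T * e (w i))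
          = ∑ i, e b * T * e (e' (θ' (b' * u i)) * w i) := by
            refine Finset.sum_congr rfl fun i _ => ?_
            have e1 : e b * T * e b' * (e (u i) * T) = e b * (T * e (b' * u i) * T) := by
              simp only [map_mul, mul_assoc]
            rw [e1, h1.bim.left, key, map_mul e b, map_mul e _ (w i), mul_assoc, ← mul_assoc _ T,
              ← h.Te]
            simp only [mul_assoc]
        _ = e b * T * e b' := by rw [← Finset.mul_sum, ← map_sum, hu]
    | zero => simp
    | add x y _ _ hx hy =>
      simp only [add_mul, map_add, Finset.sum_add_distrib] at *; rw [hx, hy]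
    | neg x _ hx => simp only [neg_mul, map_neg, Finset.sum_neg_distrib] at *; rw [hx]
  · refine ⟨fun x => ∑ i, (e (u i) * T) * e (θ ((T * e (w i)) * x)),
      ⟨κ, inferInstance, _, _, fun _ => rfl⟩, fun x hx => ?_⟩
    induction hx using AddSubgroup.closure_induction with
    | mem x hx =>
      obtain ⟨b, b', rfl⟩ := hx
      calc ∑ i, (e (u i) * T) * e (θ ((T * e (w i)) * (e b * T * e b')))
          = ∑ i, e (u i * e' (θ' (w i * b))) * (T * e b') := by
            refine Finset.sum_congr rfl fun i _ => ?_
            have e1 : (T * e (w i)) * (e b * T * e b') = (T * e (w i * b) * T) * e b' := by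
              simp only [map_mul, mul_assoc]
            rw [e1, h1.bim.right, key, map_mul e _ b', map_mul e (u i), mul_assoc, ← mul_assoc T,
              h.Te]
            simp only [mul_assoc]
        _ = e b * T * e b' := by rw [← Finset.sum_mul, ← map_sum, hw, mul_assoc]
    | zero => simp
    | add x y _ _ hx hy =>
      simp only [mul_add, map_add, Finset.sum_add_distrib] at *; rw [hx, hy]
    | neg x _ hx => simp only [mul_neg, map_neg, Finset.sum_neg_distrib] at *; rw [hx]

end Trace
end IsStep
end Step

section Tower

section Generic

variable {F}
variable {A B : Type} [Ring A] [Ring B] [Algebra F A] [Algebra F B]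

theorem skew_of_adjoin_eq_top {G : Set B} (hG : Algebra.adjoin F G = ⊤) (φ ψ : B →ₐ[F] A)
    (a : A) (h : ∀ g ∈ G, a * φ g = ψ g * a) (b : B) : a * φ b = ψ b * a := by
  have hb : b ∈ Algebra.adjoin F G := by rw [hG]; trivial
  induction hb using Algebra.adjoin_induction with
  | mem g hg => exact h g hg
  | algebraMap r => rw [AlgHom.commutes, AlgHom.commutes, Algebra.commutes]
  | add x y _ _ hx hy => rw [map_add, map_add, mul_add, add_mul, hx, hy]
  | mul x y _ _ hx hy => rw [map_mul, map_mul, ← mul_assoc, hx, mul_assoc, hy, mul_assoc]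

theorem eq_top_of_mul_left_mem (S : AddSubgroup A) (G : Set A)
    (hG : Algebra.adjoin F G = ⊤) (h1 : 1 ∈ S) (hsmul : ∀ (r : F), ∀ s ∈ S, r • s ∈ S)
    (h : ∀ g ∈ G, ∀ s ∈ S, g * s ∈ S) : S = ⊤ := by
  rw [eq_top_iff]
  intro a _
  have key : ∀ a ∈ Algebra.adjoin F G, ∀ s ∈ S, a * s ∈ S := by
    intro a ha
    induction ha using Algebra.adjoin_induction with
    | mem g hg => exact h g hg
    | algebraMap r =>
      intro s hs
      rw [← Algebra.smul_def]
      exact hsmul r s hs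
    | add a b _ _ ha hb => intro s hs; rw [add_mul]; exact add_mem (ha s hs) (hb s hs)
    | mul a b _ _ ha hb => intro s hs; rw [mul_assoc]; exact ha _ (hb s hs)
  simpa using key a (by rw [hG]; trivial) 1 h1

variable {ξ : F} {T y X c C : A}

theorem T_mul_C_of_rel (hq : T * T = ξ • T + 1) (tc : T * c = C * T) :
    T * C = c * T - ξ • c + ξ • C := by
  have h1 : T * T - ξ • T = 1 := by rw [hq]; abel
  have h2 : T * C * (T * T - ξ • T) - ξ • (C * (T * T - ξ • T)) =
      (T * T - ξ • T) * c * T - ξ • ((T * T - ξ • T) * c) := by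
    simp only [mul_sub, sub_mul, mul_smul_comm, smul_mul_assoc, smul_sub, smul_smul, mul_assoc]
    simp only [← mul_assoc, tc]
    abel
  rw [h1, mul_one, mul_one, one_mul] at h2
  rw [← sub_eq_iff_eq_add, h2]

theorem X_mul_T_of_rel (hq : T * T = ξ • T + 1)
    (cross : (T + ξ • (c * C)) * y * T = X) :
    X * T = ξ • X + T * y + ξ • (c * C * y) := by
  rw [← cross, mul_assoc _ T T, hq, mul_add, mul_smul_comm, mul_one, add_mul, smul_mul_assoc,
    add_assoc]

theorem T_mul_X_of_rel (hq : T * T = ξ • T + 1) (tc : T * c = C * T)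
    (cross : (T + ξ • (c * C)) * y * T = X) (hc : c * c = 1) (hC : C * C = 1)
    (hcC : C * c = -(c * C)) :
    T * X = y * T - ξ • (c * C * X) + ξ • X := by
  have h1 : T * (c * C) = -(c * C * T) + ξ • (c * C) + ξ • 1 := by
    rw [← mul_assoc, tc, mul_assoc, T_mul_C_of_rel hq tc, mul_add, mul_sub, ← mul_assoc, hcC,
      mul_smul_comm, mul_smul_comm, hcC, hC, smul_neg, neg_mul]
    abel
  have h3 : c * C * (c * C) = -1 := by
    rw [mul_assoc, ← mul_assoc C, hcC, neg_mul, mul_neg, mul_assoc c C C, hC, mul_one, hc]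
  have h2 : (T + ξ • (c * C) - ξ • 1) * (T + ξ • (c * C)) = 1 := by
    simp only [add_mul, sub_mul, mul_add, hq, mul_smul_comm, smul_mul_assoc, h1, h3, one_mul]
    module
  have h4 : (T + ξ • (c * C) - ξ • 1) * X = y * T := by
    rw [← cross, ← mul_assoc, ← mul_assoc, h2, one_mul]
  simp only [add_mul, sub_mul, smul_mul_assoc, one_mul] at h4
  rw [← h4]; abel

end Generic

variable (q : F) (n d : ℕ) (aa : ℕ → F)

/-- The cyclotomic Hecke–Clifford superalgebra, with its ring structure as the primary one. -/
def CycAlg : Type := Hf F q n d aa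

noncomputable instance : Ring (CycAlg F q n d aa) := inferInstanceAs (Ring (Hf F q n d aa))

noncomputable instance : Algebra F (CycAlg F q n d aa) :=
  inferInstanceAs (Algebra F (Hf F q n d aa))

/-- The canonical quotient map `H_n → H_n^f`. -/
noncomputable def cycHom : H F q n →ₐ[F] CycAlg F q n d aa := cyc F q n d aa

noncomputable def xf (i : ℕ) : CycAlg F q n d aa := cycHom F q n d aa (Xn F q n i)
noncomputable def xif (i : ℕ) : CycAlg F q n d aa := cycHom F q n d aa (Xin F q n i)
noncomputable def cf (i : ℕ) : CycAlg F q n d aa := cycHom F q n d aa (Cn F q n i)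
noncomputable def tf (i : ℕ) : CycAlg F q n d aa := cycHom F q n d aa (Tn F q n i)

theorem isHData_CycAlg : IsHData q n (xf F q n d aa) (xif F q n d aa) (cf F q n d aa)
    (tf F q n d aa) :=
  (isHData_H F q n).map _

theorem cycHom_surjective : Function.Surjective (cycHom F q n d aa) :=
  RingQuot.mkAlgHom_surjective F _

theorem adjoin_genSet_CycAlg : Algebra.adjoin F (genSet n (xf F q n d aa) (xif F q n d aa)
    (cf F q n d aa) (tf F q n d aa)) = ⊤ := by
  have hs := cycHom_surjective F q n d aa
  rw [← AlgHom.range_eq_top] at hs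
  rw [← top_le_iff, ← hs, ← Algebra.map_top, ← adjoin_genSet_H, AlgHom.map_adjoin,
    Algebra.adjoin_le_iff]
  rintro _ ⟨g, hg, rfl⟩
  apply Algebra.subset_adjoin
  rcases hg with ⟨i, hi, rfl⟩ | ⟨i, hi, rfl⟩ | ⟨i, hi, rfl⟩ | ⟨i, hi, rfl⟩
  · exact Or.inl ⟨i, hi, rfl⟩
  · exact Or.inr (Or.inl ⟨i, hi, rfl⟩)
  · exact Or.inr (Or.inr (Or.inl ⟨i, hi, rfl⟩))
  · exact Or.inr (Or.inr (Or.inr ⟨i, hi, rfl⟩))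

theorem root_CycAlg (hn : 0 < n) :
    ∑ i ∈ Finset.range (d + 1), aa i • xf F q n d aa 0 ^ i = 0 := by
  have h : cycHom F q n d aa (felem F q n d aa) = 0 :=
    (RingQuot.mkAlgHom_rel F (CycRel.rel (F := F) (q := q) (n := n) (d := d) (aa := aa))).trans
      (map_zero _)
  rw [felem, dif_pos hn, map_sum] at h
  rw [← h]
  refine Finset.sum_congr rfl fun i _ => ?_
  rw [map_smul, map_pow, xf, Xn, dif_pos hn]

section Lift

variable {F q n}
variable {R : Type} [Ring R] [Algebra F R] {x xi c t : ℕ → R}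

/-- The homomorphism out of `H_n^f` determined by elements satisfying the relations. -/
noncomputable def IsHData.cycLift (h : IsHData q n x xi c t)
    (hr : 0 < n → ∑ i ∈ Finset.range (d + 1), aa i • x 0 ^ i = 0) :
    CycAlg F q n d aa →ₐ[F] R :=
  RingQuot.liftAlgHom F ⟨h.lift, by
    rintro _ _ ⟨⟩
    rw [map_zero, felem]
    split_ifs with hn
    · rw [map_sum, ← hr hn]
      refine Finset.sum_congr rfl fun i _ => ?_
      rw [map_smul, map_pow, h.lift_X]
    · rw [map_zero]⟩

variable (h : IsHData q n x xi c t)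
  (hr : 0 < n → ∑ i ∈ Finset.range (d + 1), aa i • x 0 ^ i = 0)

theorem IsHData.cycLift_cycHom (b : H F q n) : h.cycLift d aa hr (cycHom F q n d aa b) = h.lift b :=
  RingQuot.liftAlgHom_mkAlgHom_apply ..

theorem IsHData.cycLift_xf {i : ℕ} (hi : i < n) : h.cycLift d aa hr (xf F q n d aa i) = x i := by
  rw [xf, h.cycLift_cycHom, h.lift_Xn hi]
theorem IsHData.cycLift_xif {i : ℕ} (hi : i < n) :
    h.cycLift d aa hr (xif F q n d aa i) = xi i := by
  rw [xif, h.cycLift_cycHom, h.lift_Xin hi]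
theorem IsHData.cycLift_cf {i : ℕ} (hi : i < n) : h.cycLift d aa hr (cf F q n d aa i) = c i := by
  rw [cf, h.cycLift_cycHom, h.lift_Cn hi]
theorem IsHData.cycLift_tf {i : ℕ} (hi : i + 1 < n) :
    h.cycLift d aa hr (tf F q n d aa i) = t i := by
  rw [tf, h.cycLift_cycHom, h.lift_Tn hi]

end Lift

/-- The canonical morphism `H_n^f → H_{n+1}^f`. -/
noncomputable def cycEmb : CycAlg F q n d aa →ₐ[F] CycAlg F q (n + 1) d aa :=
  ((isHData_CycAlg F q (n + 1) d aa).mono n.le_succ).cycLift d aa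
    fun _ => root_CycAlg F q (n + 1) d aa n.succ_pos

/-- Relations after changing the signs of the odd generators. -/
theorem IsHData.neg_c {R : Type} [Ring R] [Algebra F R] {q : F} {n : ℕ} {x xi c t : ℕ → R}
    (h : IsHData q n x xi c t) : IsHData q n x xi (fun i => -c i) t := by
  refine .of_basic h.x_xi h.xi_x h.xx ?_ ?_ ?_ ?_ h.quad h.braid h.far ?_ ?_ h.txo ?_
  · intro i hi; simpa using h.cc i hi
  · intro i hi j hj hij; simpa using h.canti i hi j hj hij
  · intro i hi; simpa using h.cx i hi
  · intro i hi j hj hij; simpa using h.cxo i hi j hj hij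
  · intro i hi; simpa using h.tc i hi
  · intro i hi j hj hij hij'; simpa using h.tco i hi j hj hij hij'
  · intro i hi; simpa using h.cross i hi

/-- The grading automorphism of `H_n^f`. -/
noncomputable def cycGrad : CycAlg F q n d aa →ₐ[F] CycAlg F q n d aa :=
  (IsHData.neg_c F (isHData_CycAlg F q n d aa)).cycLift d aa (root_CycAlg F q n d aa)

variable {n}

theorem cycEmb_xf {i : ℕ} (hi : i < n) :
    cycEmb F q n d aa (xf F q n d aa i) = xf F q (n + 1) d aa i :=
  IsHData.cycLift_xf _ _ _ _ hi
theorem cycEmb_xif {i : ℕ} (hi : i < n) :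
    cycEmb F q n d aa (xif F q n d aa i) = xif F q (n + 1) d aa i :=
  IsHData.cycLift_xif _ _ _ _ hi
theorem cycEmb_cf {i : ℕ} (hi : i < n) :
    cycEmb F q n d aa (cf F q n d aa i) = cf F q (n + 1) d aa i :=
  IsHData.cycLift_cf _ _ _ _ hi
theorem cycEmb_tf {i : ℕ} (hi : i + 1 < n) :
    cycEmb F q n d aa (tf F q n d aa i) = tf F q (n + 1) d aa i :=
  IsHData.cycLift_tf _ _ _ _ hi
theorem cycGrad_xf {i : ℕ} (hi : i < n) :
    cycGrad F q n d aa (xf F q n d aa i) = xf F q n d aa i :=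
  IsHData.cycLift_xf _ _ _ _ hi
theorem cycGrad_xif {i : ℕ} (hi : i < n) :
    cycGrad F q n d aa (xif F q n d aa i) = xif F q n d aa i :=
  IsHData.cycLift_xif _ _ _ _ hi
theorem cycGrad_cf {i : ℕ} (hi : i < n) :
    cycGrad F q n d aa (cf F q n d aa i) = -cf F q n d aa i :=
  IsHData.cycLift_cf _ _ _ _ hi
theorem cycGrad_tf {i : ℕ} (hi : i + 1 < n) :
    cycGrad F q n d aa (tf F q n d aa i) = tf F q n d aa i :=
  IsHData.cycLift_tf _ _ _ _ hi

variable (n)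

theorem xf_cycEmb (b : CycAlg F q n d aa) :
    xf F q (n + 1) d aa n * cycEmb F q n d aa b = cycEmb F q n d aa b * xf F q (n + 1) d aa n := by
  have h := isHData_CycAlg F q (n + 1) d aa
  refine skew_of_adjoin_eq_top (A := CycAlg F q (n + 1) d aa) (adjoin_genSet_CycAlg F q n d aa)
    (cycEmb F q n d aa) (cycEmb F q n d aa) _ ?_ b
  rintro _ (⟨i, hi, rfl⟩ | ⟨i, hi, rfl⟩ | ⟨i, hi, rfl⟩ | ⟨i, hi, rfl⟩)
  · rw [cycEmb_xf F q d aa hi]; exact h.xx _ (by omega) _ (by omega)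
  · rw [cycEmb_xif F q d aa hi]; exact h.xxi _ (by omega) _ (by omega) (by omega)
  · rw [cycEmb_cf F q d aa hi]; exact (h.cxo _ (by omega) _ (by omega) (by omega)).symm
  · rw [cycEmb_tf F q d aa hi]
    exact (h.txo _ (by omega) _ (by omega) (by omega) (by omega)).symm

theorem cf_cycEmb (b : CycAlg F q n d aa) :
    cf F q (n + 1) d aa n * cycEmb F q n d aa b =
      cycEmb F q n d aa (cycGrad F q n d aa b) * cf F q (n + 1) d aa n := by
  have h := isHData_CycAlg F q (n + 1) d aa
  refine skew_of_adjoin_eq_top (A := CycAlg F q (n + 1) d aa) (adjoin_genSet_CycAlg F q n d aa)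
    (cycEmb F q n d aa) ((cycEmb F q n d aa).comp (cycGrad F q n d aa)) _ ?_ b
  rintro _ (⟨i, hi, rfl⟩ | ⟨i, hi, rfl⟩ | ⟨i, hi, rfl⟩ | ⟨i, hi, rfl⟩) <;>
    rw [AlgHom.comp_apply]
  · rw [cycGrad_xf F q d aa hi, cycEmb_xf F q d aa hi]
    exact h.cxo _ (by omega) _ (by omega) (by omega)
  · rw [cycGrad_xif F q d aa hi, cycEmb_xif F q d aa hi]
    exact h.cxio _ (by omega) _ (by omega) (by omega)
  · rw [cycGrad_cf F q d aa hi, map_neg, cycEmb_cf F q d aa hi, neg_mul]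
    exact h.canti _ (by omega) _ (by omega) (by omega)
  · rw [cycGrad_tf F q d aa hi, cycEmb_tf F q d aa hi]
    exact (h.tco _ (by omega) _ (by omega) (by omega) (by omega)).symm

theorem tf_cycEmb_cycEmb (b : CycAlg F q n d aa) :
    tf F q (n + 2) d aa n * cycEmb F q (n + 1) d aa (cycEmb F q n d aa b) =
      cycEmb F q (n + 1) d aa (cycEmb F q n d aa b) * tf F q (n + 2) d aa n := by
  have h := isHData_CycAlg F q (n + 2) d aa
  refine skew_of_adjoin_eq_top (A := CycAlg F q (n + 2) d aa) (adjoin_genSet_CycAlg F q n d aa)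
    ((cycEmb F q (n + 1) d aa).comp (cycEmb F q n d aa))
    ((cycEmb F q (n + 1) d aa).comp (cycEmb F q n d aa)) _ ?_ b
  rintro _ (⟨i, hi, rfl⟩ | ⟨i, hi, rfl⟩ | ⟨i, hi, rfl⟩ | ⟨i, hi, rfl⟩) <;>
    rw [AlgHom.comp_apply]
  · rw [cycEmb_xf F q d aa hi, cycEmb_xf F q d aa (by omega)]
    exact h.txo _ (by omega) _ (by omega) (by omega) (by omega)
  · rw [cycEmb_xif F q d aa hi, cycEmb_xif F q d aa (by omega)]
    exact h.txio _ (by omega) _ (by omega) (by omega) (by omega)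
  · rw [cycEmb_cf F q d aa hi, cycEmb_cf F q d aa (by omega)]
    exact h.tco _ (by omega) _ (by omega) (by omega) (by omega)
  · rw [cycEmb_tf F q d aa hi, cycEmb_tf F q d aa (by omega)]
    exact (h.far _ _ (by omega) (by omega)).symm

/-- The last generator `T_{n-1}` of `H_n^f`, or `0` if there is none. -/
noncomputable def tlast : CycAlg F q n d aa := if n < 2 then 0 else tf F q n d aa (n - 2)

theorem tlast_add_two : tlast F q (n + 2) d aa = tf F q (n + 2) d aa n := by
  simp [tlast]

theorem isStep_CycAlg : IsStep (q - q⁻¹) (cycEmb F q (n + 1) d aa) (cycEmb F q n d aa)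
    (cycGrad F q (n + 1) d aa) (xf F q (n + 1) d aa n) (cf F q (n + 1) d aa n)
    (tlast F q (n + 1) d aa) (xf F q (n + 2) d aa (n + 1)) (cf F q (n + 2) d aa (n + 1))
    (tf F q (n + 2) d aa n) := by
  have h := isHData_CycAlg F q (n + 2) d aa
  have hq := h.quad n (by omega)
  have tc := h.tc n (by omega)
  have cross := h.cross n (by omega)
  have ey := cycEmb_xf F q d aa (n := n + 1) (i := n) (by omega)
  have ec := cycEmb_cf F q d aa (n := n + 1) (i := n) (by omega)
  have exi := cycEmb_xif F q d aa (n := n + 1) (i := n) (by omega)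
  refine ⟨h.cc _ (by omega), xf_cycEmb F q (n + 1) d aa, cf_cycEmb F q (n + 1) d aa,
    cycGrad_xf F q d aa (by omega), cycGrad_cf F q d aa (by omega), tf_cycEmb_cycEmb F q n d aa,
    ?_, hq, ?_, ?_, ?_, ?_, ?_⟩
  · rcases n with _ | n
    · simp [tlast]
    · rw [tlast_add_two, cycEmb_tf F q d aa (by omega)]
      exact (h.braid n (by omega)).symm
  · rw [ey, ec]
    exact X_mul_T_of_rel hq cross
  · rw [ey, ec]
    exact T_mul_X_of_rel hq tc cross (h.cc n (by omega)) (h.cc (n + 1) (by omega))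
      (h.canti _ (by omega) _ (by omega) (by omega))
  · rw [ec]; exact tc.symm
  · rw [ec]; exact T_mul_C_of_rel hq tc
  · rw [← top_le_iff, ← adjoin_genSet_CycAlg, Algebra.adjoin_le_iff]
    set S := Algebra.adjoin F (Set.range (cycEmb F q (n + 1) d aa) ∪ {tf F q (n + 2) d aa n})
    have hT : tf F q (n + 2) d aa n ∈ S := Algebra.subset_adjoin (Or.inr rfl)
    have he : ∀ b, cycEmb F q (n + 1) d aa b ∈ S := fun b =>
      Algebra.subset_adjoin (Or.inl ⟨b, rfl⟩)
    have h1 : tf F q (n + 2) d aa n * (tf F q (n + 2) d aa n - (q - q⁻¹) • 1) = 1 := by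
      rw [mul_sub, hq, mul_smul_comm, mul_one]; abel
    have h1' : (tf F q (n + 2) d aa n - (q - q⁻¹) • 1) * tf F q (n + 2) d aa n = 1 := by
      rw [sub_mul, hq, smul_mul_assoc, one_mul]; abel
    have hTi : tf F q (n + 2) d aa n - (q - q⁻¹) • 1 ∈ S :=
      sub_mem hT (S.smul_mem (one_mem _) _)
    have hc : cf F q (n + 2) d aa n ∈ S := by rw [← ec]; exact he _
    have hC : cf F q (n + 2) d aa (n + 1) ∈ S := by
      have : cf F q (n + 2) d aa (n + 1) = tf F q (n + 2) d aa n * cf F q (n + 2) d aa n *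
          (tf F q (n + 2) d aa n - (q - q⁻¹) • 1) := by
        rw [tc, mul_assoc, h1, mul_one]
      rw [this]; exact mul_mem (mul_mem hT hc) hTi
    have hy : xf F q (n + 2) d aa n ∈ S := by rw [← ey]; exact he _
    have hyi : xif F q (n + 2) d aa n ∈ S := by rw [← exi]; exact he _
    have hX : xf F q (n + 2) d aa (n + 1) ∈ S := by
      rw [← cross]
      exact mul_mem (mul_mem (add_mem hT (S.smul_mem (mul_mem hc hC) _)) hy) hT
    have hXi : xif F q (n + 2) d aa (n + 1) ∈ S := by
      have hTX := T_mul_X_of_rel hq tc cross (h.cc n (by omega)) (h.cc (n + 1) (by omega))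
        (h.canti _ (by omega) _ (by omega) (by omega))
      have e1 : (tf F q (n + 2) d aa n - (q - q⁻¹) • 1) * xif F q (n + 2) d aa n *
          (tf F q (n + 2) d aa n + (q - q⁻¹) • (cf F q (n + 2) d aa n *
            cf F q (n + 2) d aa (n + 1)) - (q - q⁻¹) • 1) * xf F q (n + 2) d aa (n + 1) = 1 := by
        have : (tf F q (n + 2) d aa n + (q - q⁻¹) • (cf F q (n + 2) d aa n *
            cf F q (n + 2) d aa (n + 1)) - (q - q⁻¹) • 1) * xf F q (n + 2) d aa (n + 1) =
            xf F q (n + 2) d aa n * tf F q (n + 2) d aa n := by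
          rw [sub_mul, add_mul, hTX, smul_mul_assoc, smul_mul_assoc, one_mul]; abel
        rw [mul_assoc, this, mul_assoc, ← mul_assoc (xif F q (n + 2) d aa n),
          h.xi_x n (by omega), one_mul, h1']
      have e2 := left_inv_eq_right_inv e1 (h.x_xi (n + 1) (by omega))
      rw [← e2]
      exact mul_mem (mul_mem hTi hyi)
        (sub_mem (add_mem hT (S.smul_mem (mul_mem hc hC) _)) (S.smul_mem (one_mem _) _))
    rintro _ (⟨i, hi, rfl⟩ | ⟨i, hi, rfl⟩ | ⟨i, hi, rfl⟩ | ⟨i, hi, rfl⟩)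
    · rcases Nat.lt_succ_iff_lt_or_eq.1 hi with hi | rfl
      · rw [← cycEmb_xf F q d aa hi]; exact he _
      · exact hX
    · rcases Nat.lt_succ_iff_lt_or_eq.1 hi with hi | rfl
      · rw [← cycEmb_xif F q d aa hi]; exact he _
      · exact hXi
    · rcases Nat.lt_succ_iff_lt_or_eq.1 hi with hi | rfl
      · rw [← cycEmb_cf F q d aa hi]; exact he _
      · exact hC
    · rcases Nat.lt_succ_iff_lt_or_eq.1 (Nat.lt_of_succ_lt_succ hi) with hi | rfl
      · rw [← cycEmb_tf F q d aa (by omega)]; exact he _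
      · exact hT

end Tower

section Spanning

section Base

variable {F}
variable {A B : Type} [Ring A] [Ring B] [Algebra F A] [Algebra F B]

/-- The spanning property for a rank-one extension cut out by a monic polynomial with
invertible constant term. -/
theorem levelSpan_eq_top_of_root {e : B →ₐ[F] A} {δ : B →ₐ[F] B} {X Xi C : A} {d : ℕ}
    {aa : ℕ → F} (hd : 0 < d) (h0 : aa 0 ≠ 0) (h1 : aa d = 1)
    (X_Xi : X * Xi = 1) (Xi_X : Xi * X = 1) (CC : C * C = 1) (CX : C * X = Xi * C)
    (Xe : ∀ b, X * e b = e b * X) (Ce : ∀ b, C * e b = e (δ b) * C)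
    (hroot : ∑ i ∈ Finset.range (d + 1), aa i • X ^ i = 0)
    (hG : Algebra.adjoin F (Set.range e ∪ {X, Xi, C}) = ⊤) :
    levelSpan e X C 0 d d = ⊤ := by
  set S := levelSpan e X C 0 d d with hS
  have Xie : ∀ b, Xi * e b = e b * Xi := fun b =>
    (comm_inv_of_comm X_Xi Xi_X (Xe b).symm).symm
  have mulC : ∀ s ∈ S, s * C ∈ S := by
    intro s hs
    refine levelSpan_induction (p := fun s => s * C ∈ S) ?_ ?_ ?_ (by simp) ?_ ?_ hs
    · intro i hi b; rw [mul_assoc]; exact levelSpan_pow_C hi b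
    · intro i hi b; rw [mul_assoc, mul_assoc, CC, mul_one]; exact levelSpan_pow hi b
    · intro b b'; simp
    · intro x y hx hy; rw [add_mul]; exact add_mem hx hy
    · intro x hx; rw [neg_mul]; exact neg_mem hx
  have stable : ∀ u : A, (∀ b, ∃ b', u * e b = e b' * u) → (∀ i < d, u * X ^ i ∈ S) →
      ∀ s ∈ S, u * s ∈ S := by
    intro u hu hi s hs
    refine levelSpan_induction (p := fun s => u * s ∈ S) ?_ ?_ ?_ (by simp) ?_ ?_ hs
    · intro i hid b
      obtain ⟨b', hb'⟩ := hu b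
      rw [← mul_assoc, hb', mul_assoc]
      exact levelSpan_e_mul b' (hi i hid)
    · intro i hid b
      obtain ⟨b', hb'⟩ := hu b
      rw [← mul_assoc, hb', mul_assoc, ← mul_assoc u]
      exact levelSpan_e_mul b' (mulC _ (hi i hid))
    · intro b b'; simp
    · intro x y hx hy; rw [mul_add]; exact add_mem hx hy
    · intro x hx; rw [mul_neg]; exact neg_mem hx
  have hpow : ∀ i < d, X ^ i ∈ S := fun i hi => IsStep.pow_mem hi
  have hX : ∀ s ∈ S, X * s ∈ S := by
    refine stable X (fun b => ⟨b, Xe b⟩) fun i hi => ?_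
    rw [← pow_succ']
    rcases Nat.lt_or_ge (i + 1) d with h | h
    · exact hpow _ h
    · obtain rfl : d = i + 1 := by omega
      rw [Finset.sum_range_succ, h1, one_smul, add_comm] at hroot
      rw [eq_neg_of_add_eq_zero_left hroot]
      exact neg_mem (sum_mem fun j hj => levelSpan_smul _ (hpow j (Finset.mem_range.1 hj)))
  have hXi : ∀ s ∈ S, Xi * s ∈ S := by
    refine stable Xi (fun b => ⟨b, Xie b⟩) fun i hi => ?_
    rcases i with _ | i
    · have h2 : aa 0 • Xi + ∑ j ∈ Finset.range d, aa (j + 1) • X ^ j = 0 := by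
        have := congrArg (Xi * ·) hroot
        simp only [mul_zero, Finset.sum_range_succ', pow_zero, mul_add, Finset.mul_sum,
          mul_smul_comm, mul_one] at this
        rw [add_comm, ← this]
        refine congrArg (· + aa 0 • Xi) (Finset.sum_congr rfl fun j _ => ?_)
        rw [pow_succ', ← mul_assoc, Xi_X, one_mul]
      have h3 : Xi = (aa 0)⁻¹ • -∑ j ∈ Finset.range d, aa (j + 1) • X ^ j := by
        rw [← eq_neg_of_add_eq_zero_left h2, smul_smul, inv_mul_cancel₀ h0, one_smul]
      rw [pow_zero, mul_one, h3]
      exact levelSpan_smul _ (neg_mem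
        (sum_mem fun j hj => levelSpan_smul _ (hpow j (Finset.mem_range.1 hj))))
    · rw [pow_succ', ← mul_assoc, Xi_X, one_mul]
      exact hpow _ (by omega)
  have hone : (1 : A) ∈ S := by simpa using hpow 0 hd
  have hC : ∀ s ∈ S, C * s ∈ S := by
    refine stable C (fun b => ⟨δ b, Ce b⟩) fun i hi => ?_
    have e1 : C * X ^ i = Xi ^ i * C := SemiconjBy.pow_right (CX : SemiconjBy C X Xi) i
    rw [e1]
    refine mulC _ ?_
    clear e1 hi
    induction i with
    | zero => simpa using hone
    | succ i ih => rw [pow_succ']; exact hXi _ ih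
  refine eq_top_of_mul_left_mem S _ hG hone (fun r s hs => levelSpan_smul r hs) ?_
  rintro g (⟨b, rfl⟩ | rfl | rfl | rfl) s hs
  · exact levelSpan_e_mul b hs
  · exact hX s hs
  · exact hXi s hs
  · exact hC s hs

end Base

variable (q : F) (n d : ℕ) (aa : ℕ → F)

/-- The trace form on the last step of the tower of cyclotomic algebras. -/
def IsCycTrace (θ : CycAlg F q (n + 1) d aa →ₗ[F] CycAlg F q n d aa) : Prop :=
  IsTrace (cycEmb F q n d aa) θ (cycGrad F q n d aa) (xf F q (n + 1) d aa n)
    (xif F q (n + 1) d aa n) (cf F q (n + 1) d aa n) 0 d (aa 0) ∧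
  θ (tlast F q (n + 1) d aa) = 0

variable {d aa}

theorem levelSpan_CycAlg (hd : 0 < d) (h0 : aa 0 ≠ 0) (h1 : aa d = 1) :
    levelSpan (cycEmb F q n d aa) (xf F q (n + 1) d aa n) (cf F q (n + 1) d aa n)
      (tlast F q (n + 1) d aa) d d = ⊤ := by
  induction n with
  | zero =>
    have h := isHData_CycAlg F q 1 d aa
    have ht : tlast F q (0 + 1) d aa = 0 := by simp [tlast]
    rw [ht]
    refine levelSpan_eq_top_of_root hd h0 h1 (h.x_xi 0 one_pos) (h.xi_x 0 one_pos)
      (h.cc 0 one_pos) (h.cx 0 one_pos) (xf_cycEmb F q 0 d aa) (cf_cycEmb F q 0 d aa)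
      (root_CycAlg F q 1 d aa one_pos) ?_
    rw [← top_le_iff, ← adjoin_genSet_CycAlg]
    refine Algebra.adjoin_mono ?_
    rintro _ (⟨i, hi, rfl⟩ | ⟨i, hi, rfl⟩ | ⟨i, hi, rfl⟩ | ⟨i, hi, rfl⟩)
    · obtain rfl : i = 0 := by omega
      simp
    · obtain rfl : i = 0 := by omega
      simp
    · obtain rfl : i = 0 := by omega
      simp
    · omega
  | succ n ih =>
    rw [tlast_add_two]
    exact (isStep_CycAlg F q n d aa).levelSpan_eq_top hd ih

theorem isFrobeniusForm_CycAlg (hd : 0 < d) (h0 : aa 0 ≠ 0) (h1 : aa d = 1)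
    (hθ : ∀ n, ∃ θ, IsCycTrace F q n d aa θ) :
    ∃ θ, IsTrace (cycEmb F q n d aa) θ (cycGrad F q n d aa) (xf F q (n + 1) d aa n)
        (xif F q (n + 1) d aa n) (cf F q (n + 1) d aa n) (tlast F q (n + 1) d aa) d (aa 0) ∧
      IsFrobeniusForm (cycEmb F q n d aa) θ := by
  induction n with
  | zero =>
    obtain ⟨θ, hθ, -⟩ := hθ 0
    have ht : tlast F q (0 + 1) d aa = 0 := by simp [tlast]
    have hs := levelSpan_CycAlg F q 0 hd h0 h1
    rw [ht] at hs ⊢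
    have hm : ∀ x ∈ midSpan (cycEmb F q 0 d aa) 0, x = 0 := by
      intro x hx
      rw [midSpan] at hx
      induction hx using AddSubgroup.closure_induction with
      | mem x hx => obtain ⟨b, b', rfl⟩ := hx; simp
      | zero => rfl
      | add x y _ _ hx hy => rw [hx, hy, add_zero]
      | neg x _ hx => rw [hx, neg_zero]
    refine ⟨θ, hθ, hθ.isFrobeniusForm hs ?_ ?_⟩
    · exact ⟨fun _ => 0, ⟨Empty, inferInstance, Empty.elim, Empty.elim, by simp⟩,
        fun x hx => (hm x hx).symm⟩
    · exact ⟨fun _ => 0, ⟨Empty, inferInstance, Empty.elim, Empty.elim, by simp⟩,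
        fun x hx => (hm x hx).symm⟩
  | succ n ih =>
    obtain ⟨θ', hθ', hfrob⟩ := ih
    obtain ⟨θ, hθ, hT⟩ := hθ (n + 1)
    have hstep := isStep_CycAlg F q n d aa
    rw [tlast_add_two] at hT ⊢
    have htr := hstep.isTrace hθ hT
    have hs := levelSpan_CycAlg F q n hd h0 h1
    obtain ⟨hl, hr⟩ := hstep.recovers_mid htr hθ' hs hfrob
    exact ⟨θ, htr, htr.isFrobeniusForm (hstep.levelSpan_eq_top hd hs) hl hr⟩

end Spanning

section Local

variable {F}
variable {R : Type} [Ring R] [Algebra F R]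

theorem mul_mul_of_mul_eq {a b r : R} (h : a * b = r) (z : R) : a * (b * z) = r * z := by
  rw [← mul_assoc, h]

/-- The numerator of the coefficient of the intertwiner. -/
def numer (x' c X X' C : R) : R := (x' - X) + (X' - x') * (c * C)

/-- Two anticommuting sites `(x, c)` and `(X, C)`. -/
structure IsPair (x x' c X X' C : R) : Prop where
  xx' : x * x' = 1
  x'x : x' * x = 1
  XX' : X * X' = 1
  X'X : X' * X = 1
  Xx : X * x = x * X
  cc : c * c = 1
  CC : C * C = 1
  Cc : C * c = -(c * C)
  cx : c * x = x' * c
  cX : c * X = X * c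
  Cx : C * x = x * C
  CX : C * X = X' * C

set_option linter.unusedSimpArgs false in
theorem IsPair.numer_rels {x x' c X X' C : R} (h : IsPair x x' c X X' C) :
    numer x' c X X' C * c = C * numer x' c X X' C ∧
    numer x' c X X' C * C = c * numer x' c X X' C + ((x + x') - (X + X')) * (C - c) ∧
    numer x' c X X' C * ((x + x') - (X + X') - numer x' c X X' C) =
      4 - (x + x') * (X + X') ∧
    numer x' c X X' C * X = x * numer x' c X X' C +
      ((x + x') - (X + X')) * (X + C * c * X) ∧
    numer x' c X X' C * x = X * numer x' c X X' C -
      ((x + x') - (X + X')) * (X + c * C * x) := by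
  have X'x : X' * x = x * X' := (comm_inv_of_comm h.XX' h.X'X h.Xx.symm).symm
  have Xx' : X * x' = x' * X := comm_inv_of_comm h.xx' h.x'x h.Xx
  have XxI : X' * x' = x' * X' := comm_inv_of_comm h.xx' h.x'x X'x
  have cx' : c * x' = x * c := skew_inv_of_skew h.xx' h.cx
  have cX' : c * X' = X' * c := comm_inv_of_comm h.XX' h.X'X h.cX
  have Cx' : C * x' = x' * C := comm_inv_of_comm h.xx' h.x'x h.Cx
  have CX' : C * X' = X * C := skew_inv_of_skew h.XX' h.CX
  have h4 : (4 : R) = 1 + 1 + 1 + 1 := by norm_num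
  refine ⟨?_, ?_, ?_, ?_, ?_⟩ <;>
  simp only [numer, h4, mul_add, add_mul, mul_sub, sub_mul, mul_assoc,
    smul_add, smul_sub, smul_neg, mul_neg, neg_mul, mul_one, one_mul,
    h.xx', h.x'x, h.XX', h.X'X, h.Xx, X'x, Xx', XxI,
    h.cc, h.CC, h.Cc, h.cx, cx', h.cX, cX', h.Cx, Cx', h.CX, CX',
    mul_mul_of_mul_eq h.xx', mul_mul_of_mul_eq h.x'x,
    mul_mul_of_mul_eq h.XX', mul_mul_of_mul_eq h.X'X,
    mul_mul_of_mul_eq h.Xx, mul_mul_of_mul_eq X'x, mul_mul_of_mul_eq Xx', mul_mul_of_mul_eq XxI,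
    mul_mul_of_mul_eq h.cc, mul_mul_of_mul_eq h.CC, mul_mul_of_mul_eq h.Cc,
    mul_mul_of_mul_eq h.cx, mul_mul_of_mul_eq cx',
    mul_mul_of_mul_eq h.cX, mul_mul_of_mul_eq cX',
    mul_mul_of_mul_eq h.Cx, mul_mul_of_mul_eq Cx',
    mul_mul_of_mul_eq h.CX, mul_mul_of_mul_eq CX'] <;> abel

/-- A pair of adjacent sites together with a further commuting site `(X, C)`. -/
structure IsTriple (ξ : F) (x x' y y' c k t X X' C : R) : Prop where
  xx' : x * x' = 1
  x'x : x' * x = 1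
  yy' : y * y' = 1
  y'y : y' * y = 1
  XX' : X * X' = 1
  X'X : X' * X = 1
  yx : y * x = x * y
  Xx : X * x = x * X
  Xy : X * y = y * X
  cc : c * c = 1
  kk : k * k = 1
  CC : C * C = 1
  kc : k * c = -(c * k)
  Cc : C * c = -(c * C)
  Ck : C * k = -(k * C)
  cx : c * x = x' * c
  cy : c * y = y * c
  cX : c * X = X * c
  kx : k * x = x * k
  ky : k * y = y' * k
  kX : k * X = X * k
  Cx : C * x = x * C
  Cy : C * y = y * C
  CX : C * X = X' * C
  tX : t * X = X * t
  tC : t * C = C * t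
  tt : t * t = ξ • t + 1
  tc : t * c = k * t
  cross : (t + ξ • (c * k)) * x * t = y

namespace IsTriple

variable {ξ : F} {x x' y y' c k t X X' C : R}

theorem t_k (h : IsTriple ξ x x' y y' c k t X X' C) : t * k = c * t - ξ • c + ξ • k :=
  T_mul_C_of_rel h.tt h.tc

theorem t_y (h : IsTriple ξ x x' y y' c k t X X' C) :
    t * y = x * t - ξ • (c * k * y) + ξ • y :=
  T_mul_X_of_rel h.tt h.tc h.cross h.cc h.kk h.kc

theorem t_x (h : IsTriple ξ x x' y y' c k t X X' C) :
    t * x = y * t - ξ • y - ξ • (c * k * x) := by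
  rw [X_mul_T_of_rel h.tt h.cross]; abel

theorem t_x' (h : IsTriple ξ x x' y y' c k t X X' C) :
    t * x' = y' * t + ξ • x' + ξ • (y' * c * k) := by
  have h1 := congrArg (fun r => y' * r * x') h.t_x
  simp only [mul_sub, sub_mul, mul_smul_comm, smul_mul_assoc, mul_assoc, h.xx', mul_one,
    mul_mul_of_mul_eq h.y'y, one_mul] at h1
  rw [h1]; simp only [mul_assoc]; abel

theorem t_y' (h : IsTriple ξ x x' y y' c k t X X' C) :
    t * y' = x' * t + ξ • (x' * c * k) - ξ • x' := by
  have h1 := congrArg (fun r => x' * r * y') h.t_y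
  simp only [mul_sub, sub_mul, mul_add, add_mul, mul_smul_comm, smul_mul_assoc, mul_assoc, h.yy',
    mul_one, mul_mul_of_mul_eq h.x'x, one_mul] at h1
  simp only [mul_assoc]
  rw [h1]; abel

set_option linter.unusedSimpArgs false in
theorem numer_rels (h : IsTriple ξ x x' y y' c k t X X' C) :
    numer x' c X X' C * ((y + y') - (X + X')) * t =
      t * (numer y' k X X' C * ((x + x') - (X + X'))) +
        ξ • (((y + y') - (X + X') - numer y' k X X' C) * numer x' c X X' C) ∧
    t * (numer x' c X X' C * ((y + y') - (X + X'))) =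
      ξ • (numer x' c X X' C * ((y + y') - (X + X') - numer y' k X X' C)) +
        numer y' k X X' C * ((x + x') - (X + X')) * t ∧
    t * ((x + x') + (y + y')) = ((x + x') + (y + y')) * t ∧
    t * ((x + x') * (y + y')) = ((x + x') * (y + y')) * t := by
  have y'x : y' * x = x * y' := (comm_inv_of_comm h.yy' h.y'y h.yx.symm).symm
  have yx' : y * x' = x' * y := comm_inv_of_comm h.xx' h.x'x h.yx
  have yxI : y' * x' = x' * y' := comm_inv_of_comm h.xx' h.x'x y'x
  have X'x : X' * x = x * X' := (comm_inv_of_comm h.XX' h.X'X h.Xx.symm).symm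
  have Xx' : X * x' = x' * X := comm_inv_of_comm h.xx' h.x'x h.Xx
  have XxI : X' * x' = x' * X' := comm_inv_of_comm h.xx' h.x'x X'x
  have X'y : X' * y = y * X' := (comm_inv_of_comm h.XX' h.X'X h.Xy.symm).symm
  have Xy' : X * y' = y' * X := comm_inv_of_comm h.yy' h.y'y h.Xy
  have XyI : X' * y' = y' * X' := comm_inv_of_comm h.yy' h.y'y X'y
  have cx' : c * x' = x * c := skew_inv_of_skew h.xx' h.cx
  have cy' : c * y' = y' * c := comm_inv_of_comm h.yy' h.y'y h.cy
  have cX' : c * X' = X' * c := comm_inv_of_comm h.XX' h.X'X h.cX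
  have kx' : k * x' = x' * k := comm_inv_of_comm h.xx' h.x'x h.kx
  have ky' : k * y' = y * k := skew_inv_of_skew h.yy' h.ky
  have kX' : k * X' = X' * k := comm_inv_of_comm h.XX' h.X'X h.kX
  have Cx' : C * x' = x' * C := comm_inv_of_comm h.xx' h.x'x h.Cx
  have Cy' : C * y' = y' * C := comm_inv_of_comm h.yy' h.y'y h.Cy
  have CX' : C * X' = X * C := skew_inv_of_skew h.XX' h.CX
  have tX' : t * X' = X' * t := comm_inv_of_comm h.XX' h.X'X h.tX
  refine ⟨?_, ?_, ?_, ?_⟩ <;>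
  simp only [numer, mul_add, add_mul, mul_sub, sub_mul, mul_smul_comm, smul_mul_assoc, mul_assoc,
    smul_add, smul_sub, smul_neg, mul_neg, neg_mul, mul_one, one_mul,
    h.xx', h.x'x, h.yy', h.y'y, h.XX', h.X'X, h.yx, y'x, yx', yxI, h.Xx, X'x, Xx', XxI,
    h.Xy, X'y, Xy', XyI, h.cc, h.kk, h.CC, h.kc, h.Cc, h.Ck, h.cx, cx', h.cy, cy', h.cX, cX',
    h.kx, kx', h.ky, ky', h.kX, kX', h.Cx, Cx', h.Cy, Cy', h.CX, CX', h.tX, tX', h.tC, h.tc,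
    h.t_x, h.t_y, h.t_x', h.t_y', h.t_k,
    mul_mul_of_mul_eq h.xx', mul_mul_of_mul_eq h.x'x, mul_mul_of_mul_eq h.yy',
    mul_mul_of_mul_eq h.y'y, mul_mul_of_mul_eq h.XX', mul_mul_of_mul_eq h.X'X,
    mul_mul_of_mul_eq h.yx, mul_mul_of_mul_eq y'x, mul_mul_of_mul_eq yx', mul_mul_of_mul_eq yxI,
    mul_mul_of_mul_eq h.Xx, mul_mul_of_mul_eq X'x, mul_mul_of_mul_eq Xx', mul_mul_of_mul_eq XxI,
    mul_mul_of_mul_eq h.Xy, mul_mul_of_mul_eq X'y, mul_mul_of_mul_eq Xy', mul_mul_of_mul_eq XyI,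
    mul_mul_of_mul_eq h.cc, mul_mul_of_mul_eq h.kk, mul_mul_of_mul_eq h.CC,
    mul_mul_of_mul_eq h.kc, mul_mul_of_mul_eq h.Cc, mul_mul_of_mul_eq h.Ck,
    mul_mul_of_mul_eq h.cx, mul_mul_of_mul_eq cx', mul_mul_of_mul_eq h.cy, mul_mul_of_mul_eq cy',
    mul_mul_of_mul_eq h.cX, mul_mul_of_mul_eq cX', mul_mul_of_mul_eq h.kx, mul_mul_of_mul_eq kx',
    mul_mul_of_mul_eq h.ky, mul_mul_of_mul_eq ky', mul_mul_of_mul_eq h.kX, mul_mul_of_mul_eq kX',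
    mul_mul_of_mul_eq h.Cx, mul_mul_of_mul_eq Cx', mul_mul_of_mul_eq h.Cy, mul_mul_of_mul_eq Cy',
    mul_mul_of_mul_eq h.CX, mul_mul_of_mul_eq CX', mul_mul_of_mul_eq h.tX, mul_mul_of_mul_eq tX',
    mul_mul_of_mul_eq h.tC, mul_mul_of_mul_eq h.tc, mul_mul_of_mul_eq h.t_x,
    mul_mul_of_mul_eq h.t_y, mul_mul_of_mul_eq h.t_x', mul_mul_of_mul_eq h.t_y',
    mul_mul_of_mul_eq h.t_k] <;> module

end IsTriple
end Local

section Coefficients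

variable {F}
variable {R : Type} [Ring R] [Algebra F R]

theorem commute_quad_mul_quad {a b β γ t : R} (hab : Commute a b) (haβ : Commute a β)
    (haγ : Commute a γ) (hβγ : Commute β γ)
    (h1 : Commute t (a + b)) (h2 : Commute t (a * b)) (hβ : Commute t β) (hγ : Commute t γ) :
    Commute t ((a * a + β * a + γ) * (b * b + β * b + γ)) := by
  have key : (a * a + β * a + γ) * (b * b + β * b + γ) =
      (a * b) * (a * b) + β * ((a * b) * (a + b)) + γ * ((a + b) * (a + b) - (a * b + a * b)) +
        β * β * (a * b) + β * γ * (a + b) + γ * γ := by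
    simp only [mul_add, add_mul, mul_sub, mul_assoc, hab.symm.eq, haγ.eq,
      mul_mul_of_mul_eq hab.symm.eq, mul_mul_of_mul_eq haβ.eq, mul_mul_of_mul_eq haγ.eq,
      mul_mul_of_mul_eq hβγ.symm.eq]
    abel
  rw [key]
  exact (((((h2.mul_right h2).add_right (hβ.mul_right (h2.mul_right h1))).add_right
    (hγ.mul_right ((h1.mul_right h1).sub_right (h2.add_right h2)))).add_right
    ((hβ.mul_right hβ).mul_right h2)).add_right ((hβ.mul_right hγ).mul_right h1)).add_right
    (hγ.mul_right hγ)

theorem sub_mul_sub_add_smul {z Z : R} (hz : z * Z = Z * z) (η : F) :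
    (z - Z) * (z - Z) + η • (4 - z * Z) =
      z * z + -((2 + η) • Z) * z + (Z * Z + η • 4) := by
  simp only [mul_sub, sub_mul, hz, neg_mul, smul_mul_assoc]
  module

/-- A further site `(X, C)` commuting, in the super sense, with a copy of `H_n`. -/
structure IsSite (q : F) (n : ℕ) (x xi c t : ℕ → R) (X Xi C : R) : Prop where
  hd : IsHData q n x xi c t
  X_Xi : X * Xi = 1
  Xi_X : Xi * X = 1
  CC : C * C = 1
  CX : C * X = Xi * C
  Xx : ∀ i < n, Commute X (x i)
  Xc : ∀ i < n, Commute X (c i)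
  Xt : ∀ i, i + 1 < n → Commute X (t i)
  Cx : ∀ i < n, Commute C (x i)
  Cc : ∀ i < n, C * c i = -(c i * C)
  Ct : ∀ i, i + 1 < n → Commute C (t i)

/-- The coefficients needed to induce a module of `H_n` to `H_{n+1}` by adding a site. -/
structure IsCoeff (q : F) (n : ℕ) (x c t : ℕ → R) (X C : R) (a N : ℕ → R) : Prop where
  N_eq : ∀ i < n, N i = 1 + a i * ((q - q⁻¹) • 1 - a i)
  N_X : ∀ i < n, Commute (N i) X
  N_C : ∀ i < n, Commute (N i) C
  N_x : ∀ i < n, ∀ j < n, Commute (N i) (x j)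
  N_c : ∀ i < n, ∀ j < n, Commute (N i) (c j)
  N_a : ∀ i < n, ∀ j < n, Commute (N i) (a j)
  a_c : ∀ i < n, a i * c i = C * a i
  a_C : ∀ i < n, a i * C = c i * a i + (q - q⁻¹) • (C - c i)
  a_X : ∀ i < n, a i * X = x i * a i + (q - q⁻¹) • (X + C * c i * X)
  a_x : ∀ i < n, a i * x i = X * a i - (q - q⁻¹) • (X + c i * C * x i)
  a_xo : ∀ i < n, ∀ j < n, j ≠ i → Commute (a i) (x j)
  a_co : ∀ i < n, ∀ j < n, j ≠ i → Commute (a i) (c j)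
  a_to : ∀ i < n, ∀ j, j + 1 < n → j ≠ i → j + 1 ≠ i → Commute (a i) (t j)
  a_t : ∀ i, i + 1 < n → a i * t i = t i * a (i + 1) + ((q - q⁻¹) • 1 - a (i + 1)) * a i
  t_a : ∀ i, i + 1 < n → t i * a i = a i * ((q - q⁻¹) • 1 - a (i + 1)) + a (i + 1) * t i
  NN_t : ∀ i, i + 1 < n → Commute (N i * N (i + 1)) (t i)

variable {q : F} {n : ℕ} {x xi c t : ℕ → R} {X Xi C : R}

theorem commute_inv {a x xi : R} (h1 : x * xi = 1) (h2 : xi * x = 1) (h : Commute a x) :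
    Commute a xi :=
  comm_inv_of_comm h1 h2 h

/-- An element exchanging two mutually inverse elements commutes with their sum. -/
theorem commute_add_inv {a x xi : R} (h1 : x * xi = 1) (h : a * x = xi * a) :
    Commute a (x + xi) := by
  rw [commute_iff_eq, mul_add, add_mul, h, skew_inv_of_skew h1 h, add_comm]

namespace IsSite

theorem commute_Z (h : IsSite q n x xi c t X Xi C)
    {s : R} (hX : Commute s X) : Commute s (X + Xi) :=
  hX.add_right (commute_inv h.X_Xi h.Xi_X hX)

theorem X_Z (h : IsSite q n x xi c t X Xi C)
    : Commute X (X + Xi) := h.commute_Z (Commute.refl X)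

theorem C_Z (h : IsSite q n x xi c t X Xi C)
    : Commute C (X + Xi) := commute_add_inv h.X_Xi h.CX

theorem x_z (h : IsSite q n x xi c t X Xi C)
    {i j : ℕ} (hi : i < n) (hj : j < n) : Commute (x i) (x j + xi j) :=
  have hx : Commute (x i) (x j) := h.hd.xx i hi j hj
  hx.add_right (commute_inv (h.hd.x_xi j hj) (h.hd.xi_x j hj) hx)

theorem c_z (h : IsSite q n x xi c t X Xi C)
    {i j : ℕ} (hi : i < n) (hj : j < n) : Commute (c i) (x j + xi j) := by
  obtain rfl | hij := eq_or_ne i j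
  · exact commute_add_inv (h.hd.x_xi i hi) (h.hd.cx i hi)
  · have hx : Commute (c i) (x j) := h.hd.cxo i hi j hj hij
    exact hx.add_right (commute_inv (h.hd.x_xi j hj) (h.hd.xi_x j hj) hx)

theorem t_z (h : IsSite q n x xi c t X Xi C)
    {i j : ℕ} (hi : i + 1 < n) (hj : j < n) (h1 : j ≠ i) (h2 : j ≠ i + 1) :
    Commute (t i) (x j + xi j) :=
  have hx : Commute (t i) (x j) := h.hd.txo i hi j hj h1 h2
  hx.add_right (commute_inv (h.hd.x_xi j hj) (h.hd.xi_x j hj) hx)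

theorem of_site_z (h : IsSite q n x xi c t X Xi C)
    {s : R} {j : ℕ} (hj : j < n) (hs : Commute s (x j)) :
    Commute s (x j + xi j) :=
  hs.add_right (commute_inv (h.hd.x_xi j hj) (h.hd.xi_x j hj) hs)

theorem isPair (h : IsSite q n x xi c t X Xi C)
    {i : ℕ} (hi : i < n) : IsPair (x i) (xi i) (c i) X Xi C where
  xx' := h.hd.x_xi i hi
  x'x := h.hd.xi_x i hi
  XX' := h.X_Xi
  X'X := h.Xi_X
  Xx := h.Xx i hi
  cc := h.hd.cc i hi
  CC := h.CC
  Cc := h.Cc i hi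
  cx := h.hd.cx i hi
  cX := (h.Xc i hi).symm
  Cx := h.Cx i hi
  CX := h.CX

theorem isTriple (h : IsSite q n x xi c t X Xi C)
    {i : ℕ} (hi : i + 1 < n) :
    IsTriple (q - q⁻¹) (x i) (xi i) (x (i + 1)) (xi (i + 1)) (c i) (c (i + 1)) (t i) X Xi C where
  xx' := h.hd.x_xi i (by omega)
  x'x := h.hd.xi_x i (by omega)
  yy' := h.hd.x_xi (i + 1) hi
  y'y := h.hd.xi_x (i + 1) hi
  XX' := h.X_Xi
  X'X := h.Xi_X
  yx := h.hd.xx (i + 1) hi i (by omega)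
  Xx := h.Xx i (by omega)
  Xy := h.Xx (i + 1) hi
  cc := h.hd.cc i (by omega)
  kk := h.hd.cc (i + 1) hi
  CC := h.CC
  kc := h.hd.canti (i + 1) hi i (by omega) (by omega)
  Cc := h.Cc i (by omega)
  Ck := h.Cc (i + 1) hi
  cx := h.hd.cx i (by omega)
  cy := h.hd.cxo i (by omega) (i + 1) hi (by omega)
  cX := (h.Xc i (by omega)).symm
  kx := h.hd.cxo (i + 1) hi i (by omega) (by omega)
  ky := h.hd.cx (i + 1) hi
  kX := (h.Xc (i + 1) hi).symm
  Cx := h.Cx i (by omega)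
  Cy := h.Cx (i + 1) hi
  CX := h.CX
  tX := (h.Xt i hi).symm
  tC := (h.Ct i hi).symm
  tt := h.hd.quad i hi
  tc := h.hd.tc i hi
  cross := h.hd.cross i hi

theorem commute_numer (h : IsSite q n x xi c t X Xi C)
    {s : R} {i : ℕ} (hi : i < n) (hx : Commute s (x i))
    (hX : Commute s X) (hc : Commute s (c i * C)) : Commute s (numer (xi i) (c i) X Xi C) := by
  have hxi := commute_inv (h.hd.x_xi i hi) (h.hd.xi_x i hi) hx
  have hXi := commute_inv h.X_Xi h.Xi_X hX
  exact (hxi.sub_right hX).add_right ((hXi.sub_right hxi).mul_right hc)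

theorem isCoeff (h : IsSite q n x xi c t X Xi C)
    {w : ℕ → R} (hw : ∀ i < n, (x i + xi i - (X + Xi)) * w i = 1)
    (hw' : ∀ i < n, w i * (x i + xi i - (X + Xi)) = 1) :
    IsCoeff q n x c t X C (fun i => (q - q⁻¹) • (w i * numer (xi i) (c i) X Xi C))
      (fun i => 1 + (q - q⁻¹) • (w i * numer (xi i) (c i) X Xi C) *
        ((q - q⁻¹) • 1 - (q - q⁻¹) • (w i * numer (xi i) (c i) X Xi C))) := by
  set ξ : F := q - q⁻¹ with hξ
  have comm_w {s : R} {i : ℕ} (hi : i < n) (hz : Commute s (x i + xi i))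
      (hZ : Commute s (X + Xi)) : Commute s (w i) :=
    commute_inv (hw i hi) (hw' i hi) (hz.sub_right hZ)
  have X_z {i : ℕ} (hi : i < n) : Commute X (x i + xi i) := h.of_site_z hi (h.Xx i hi)
  have C_z {i : ℕ} (hi : i < n) : Commute C (x i + xi i) := h.of_site_z hi (h.Cx i hi)
  have x_Z {i : ℕ} (hi : i < n) : Commute (x i) (X + Xi) := h.commute_Z (h.Xx i hi).symm
  have c_Z {i : ℕ} (hi : i < n) : Commute (c i) (X + Xi) := h.commute_Z (h.Xc i hi).symm
  have t_Z {i : ℕ} (hi : i + 1 < n) : Commute (t i) (X + Xi) := h.commute_Z (h.Xt i hi).symm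
  have z_z {i j : ℕ} (hi : i < n) (hj : j < n) : Commute (x i + xi i) (x j + xi j) :=
    (h.of_site_z hi (h.x_z hi hj).symm).symm
  have z_Z {i : ℕ} (hi : i < n) : Commute (x i + xi i) (X + Xi) :=
    (h.of_site_z hi (x_Z hi).symm).symm
  have X_w {i : ℕ} (hi : i < n) : Commute X (w i) := comm_w hi (X_z hi) h.X_Z
  have C_w {i : ℕ} (hi : i < n) : Commute C (w i) := comm_w hi (C_z hi) h.C_Z
  have x_w {i j : ℕ} (hi : i < n) (hj : j < n) : Commute (x i) (w j) :=
    comm_w hj (h.x_z hi hj) (x_Z hi)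
  have c_w {i j : ℕ} (hi : i < n) (hj : j < n) : Commute (c i) (w j) :=
    comm_w hj (h.c_z hi hj) (c_Z hi)
  have z_w {i j : ℕ} (hi : i < n) (hj : j < n) : Commute (x i + xi i) (w j) :=
    comm_w hj (z_z hi hj) (z_Z hi)
  have Z_w {j : ℕ} (hj : j < n) : Commute (X + Xi) (w j) :=
    comm_w hj (z_Z hj).symm (Commute.refl _)
  have w_w {i j : ℕ} (hi : i < n) (hj : j < n) : Commute (w i) (w j) :=
    comm_w hj (z_w hj hi).symm (Z_w hi).symm
  have num_comm {s : R} {i : ℕ} (hi : i < n) (hx : ∀ j < n, Commute (x j) s)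
      (hc : ∀ j < n, Commute (c j) s) (hX : Commute X s) (hC : Commute C s) :
      Commute (numer (xi i) (c i) X Xi C) s :=
    (h.commute_numer hi (hx i hi).symm hX.symm ((hc i hi).symm.mul_right hC.symm)).symm
  have A_w {i j : ℕ} (hi : i < n) (hj : j < n) : Commute (numer (xi i) (c i) X Xi C) (w j) :=
    num_comm hi (fun k hk => x_w hk hj) (fun k hk => c_w hk hj) (X_w hj) (C_w hj)
  have A_z {i j : ℕ} (hi : i < n) (hj : j < n) :
      Commute (numer (xi i) (c i) X Xi C) (x j + xi j) :=
    num_comm hi (fun k hk => h.x_z hk hj) (fun k hk => h.c_z hk hj) (X_z hj) (C_z hj)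
  have A_Z {i : ℕ} (hi : i < n) : Commute (numer (xi i) (c i) X Xi C) (X + Xi) :=
    num_comm hi (fun k hk => x_Z hk) (fun k hk => c_Z hk) h.X_Z h.C_Z
  have abar {i : ℕ} (hi : i < n) :
      ξ • (1 : R) - ξ • (w i * numer (xi i) (c i) X Xi C) =
        ξ • (w i * (x i + xi i - (X + Xi) - numer (xi i) (c i) X Xi C)) := by
    rw [mul_sub (w i), hw' i hi, smul_sub]
  have hN {i : ℕ} (hi : i < n) : 1 + ξ • (w i * numer (xi i) (c i) X Xi C) *
        (ξ • 1 - ξ • (w i * numer (xi i) (c i) X Xi C)) =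
      1 + (ξ * ξ) • (w i * w i * (4 - (x i + xi i) * (X + Xi))) := by
    rw [abar hi, ← (h.isPair hi).numer_rels.2.2.1, smul_mul_smul_comm, mul_assoc (w i),
      ← mul_assoc _ (w i), (A_w hi hi).eq]
    simp only [mul_assoc]
  have hp {i : ℕ} (hi : i < n) : 1 + ξ • (w i * numer (xi i) (c i) X Xi C) *
        (ξ • 1 - ξ • (w i * numer (xi i) (c i) X Xi C)) =
      w i * w i * ((x i + xi i) * (x i + xi i) + (-((2 + ξ * ξ) • (X + Xi))) * (x i + xi i) +
        ((X + Xi) * (X + Xi) + (ξ * ξ) • 4)) := by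
    have h1 : w i * w i * ((x i + xi i - (X + Xi)) * (x i + xi i - (X + Xi))) = 1 := by
      rw [mul_assoc, ← mul_assoc (w i) (_ - _), hw' i hi, one_mul, hw' i hi]
    rw [hN hi, ← h1, ← mul_smul_comm, ← mul_add]
    congr 1
    exact sub_mul_sub_add_smul (z_Z hi).eq _
  have N_of {s : R} {i : ℕ} (hi : i < n) (hz : Commute s (x i + xi i))
      (hZ : Commute s (X + Xi)) : Commute (1 + ξ • (w i * numer (xi i) (c i) X Xi C) *
        (ξ • 1 - ξ • (w i * numer (xi i) (c i) X Xi C))) s := by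
    rw [hN hi]
    have hws := comm_w hi hz hZ
    exact ((Commute.one_right s).add_right (((hws.mul_right hws).mul_right
      ((Commute.ofNat_right s 4).sub_right (hz.mul_right hZ))).smul_right _)).symm
  have A_D {i j : ℕ} (hi : i < n) (hj : j < n) :
      Commute (numer (xi i) (c i) X Xi C) (x j + xi j - (X + Xi)) :=
    (A_z hi hj).sub_right (A_Z hi)
  have t_ww {i : ℕ} (hi : i + 1 < n) : Commute (t i) (w i * w (i + 1)) := by
    have hi' : i < n := by omega
    have e1 : Commute (t i) (x i + xi i + (x (i + 1) + xi (i + 1))) :=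
      (h.isTriple hi).numer_rels.2.2.1
    have e2 : Commute (t i) ((x i + xi i) * (x (i + 1) + xi (i + 1))) :=
      (h.isTriple hi).numer_rels.2.2.2
    have hD : (x i + xi i - (X + Xi)) * (x (i + 1) + xi (i + 1) - (X + Xi)) =
        (x i + xi i) * (x (i + 1) + xi (i + 1)) -
          (X + Xi) * (x i + xi i + (x (i + 1) + xi (i + 1))) + (X + Xi) * (X + Xi) := by
      rw [mul_sub, sub_mul, sub_mul, (z_Z hi').eq, mul_add (X + Xi) (x i + xi i)]
      abel
    refine commute_inv (x := (x i + xi i - (X + Xi)) * (x (i + 1) + xi (i + 1) - (X + Xi)))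
      ?_ ?_ (hD ▸ ((e2.sub_right ((t_Z hi).mul_right e1)).add_right
        ((t_Z hi).mul_right (t_Z hi))))
    · rw [(w_w hi' hi).eq, mul_assoc, ← mul_assoc _ (w (i + 1)), hw _ hi, one_mul, hw _ hi']
    · rw [(w_w hi' hi).eq, mul_assoc, ← mul_assoc (w i), hw' _ hi', one_mul, hw' _ hi]
  have ww_AD {i j : ℕ} (hi : i < n) (hj : j < n) :
      w i * w j * (numer (xi i) (c i) X Xi C * (x j + xi j - (X + Xi))) =
        w i * numer (xi i) (c i) X Xi C := by
    rw [(A_D hi hj).eq, mul_assoc, mul_mul_of_mul_eq (hw' j hj), one_mul]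
  constructor
  · intro i hi; rfl
  · intro i hi; exact N_of hi (X_z hi) h.X_Z
  · intro i hi; exact N_of hi (C_z hi) h.C_Z
  · intro i hi j hj; exact N_of hi (h.x_z hj hi) (x_Z hj)
  · intro i hi j hj; exact N_of hi (h.c_z hj hi) (c_Z hj)
  · intro i hi j hj
    exact (N_of hi ((z_w hi hj).symm.mul_left (A_z hj hi))
      ((Z_w hj).symm.mul_left (A_Z hj))).smul_right _
  · intro i hi
    simp only [smul_mul_assoc, mul_smul_comm, mul_assoc]
    rw [(h.isPair hi).numer_rels.1, ← mul_assoc, ← (C_w hi).eq, mul_assoc]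
  · intro i hi
    simp only [smul_mul_assoc, mul_smul_comm, mul_assoc]
    rw [(h.isPair hi).numer_rels.2.1, mul_add, mul_mul_of_mul_eq (hw' i hi), one_mul,
      ← mul_assoc, ← (c_w hi hi).eq, mul_assoc, smul_add]
  · intro i hi
    simp only [smul_mul_assoc, mul_smul_comm, mul_assoc]
    rw [(h.isPair hi).numer_rels.2.2.2.1, mul_add, mul_mul_of_mul_eq (hw' i hi), one_mul,
      ← mul_assoc, ← (x_w hi hi).eq, mul_assoc, smul_add, mul_assoc]
  · intro i hi
    simp only [smul_mul_assoc, mul_smul_comm, mul_assoc]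
    rw [(h.isPair hi).numer_rels.2.2.2.2, mul_sub, mul_mul_of_mul_eq (hw' i hi), one_mul,
      ← mul_assoc, ← (X_w hi).eq, mul_assoc, smul_sub, mul_assoc]
  · intro i hi j hj hij
    exact ((x_w hj hi).mul_right (h.commute_numer hi (h.hd.xx j hj i hi) (h.Xx j hj).symm
      (Commute.mul_right (h.hd.cxo i hi j hj hij.symm).symm (h.Cx j hj).symm))).symm.smul_left _
  · intro i hi j hj hij
    refine ((c_w hj hi).mul_right (h.commute_numer hi (h.hd.cxo j hj i hi hij) (h.Xc j hj).symm
      ?_)).symm.smul_left _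
    rw [commute_iff_eq, ← mul_assoc, h.hd.canti j hj i hi hij, mul_assoc, h.Cc j hj]
    simp [mul_assoc]
  · intro i hi j hj hij hij'
    exact ((comm_w hi (h.t_z hj hi hij.symm hij'.symm) (t_Z hj)).mul_right
      (h.commute_numer hi (h.hd.txo j hj i hi hij.symm hij'.symm) (h.Xt j hj).symm
      (Commute.mul_right (h.hd.tco j hj i hi hij.symm hij'.symm)
        (h.Ct j hj).symm))).symm.smul_left _
  · intro i hi
    have hi' : i < n := by omega
    have k := congrArg (fun r => ξ • (w i * w (i + 1) * r)) (h.isTriple hi).numer_rels.1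
    rw [mul_add, ← mul_assoc, ww_AD hi' hi, ← mul_assoc, ← (t_ww hi).eq, mul_assoc (t i),
      (w_w hi' hi).eq, ww_AD hi hi'] at k
    simp only [← hξ, abar hi]
    rw [smul_mul_assoc, k, smul_add, mul_smul_comm, smul_mul_smul_comm, mul_smul_comm, smul_smul]
    congr 2
    rw [mul_assoc, mul_assoc, ← mul_assoc (w i), ← mul_assoc _ (w i),
      ((z_w hi hi').sub_left (Z_w hi')).sub_left (A_w hi hi') |>.eq]
  · intro i hi
    have hi' : i < n := by omega
    have k := congrArg (fun r => ξ • (w i * w (i + 1) * r)) (h.isTriple hi).numer_rels.2.1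
    rw [mul_add, ← mul_assoc, ← (t_ww hi).eq, mul_assoc (t i), ww_AD hi' hi, ← mul_assoc _ _ (t i),
      (w_w hi' hi).eq, ww_AD hi hi', ← (w_w hi' hi).eq] at k
    simp only [← hξ, abar hi]
    rw [mul_smul_comm, k, smul_add, ← hξ, mul_smul_comm, smul_smul, smul_mul_smul_comm,
      smul_mul_assoc]
    congr 2
    rw [mul_assoc, mul_assoc, ← mul_assoc (w (i + 1)), ← mul_assoc _ (w (i + 1)),
      (A_w hi' hi).eq]
  · intro i hi
    have hi' : i < n := by omega
    have e1 : Commute (t i) (x i + xi i + (x (i + 1) + xi (i + 1))) :=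
      (h.isTriple hi).numer_rels.2.2.1
    have e2 : Commute (t i) ((x i + xi i) * (x (i + 1) + xi (i + 1))) :=
      (h.isTriple hi).numer_rels.2.2.2
    have hβ {s : R} (hs : Commute s (X + Xi)) : Commute s (-((2 + ξ * ξ) • (X + Xi))) :=
      (hs.smul_right _).neg_right
    have hγ {s : R} (hs : Commute s (X + Xi)) :
        Commute s ((X + Xi) * (X + Xi) + (ξ * ξ) • 4) :=
      (hs.mul_right hs).add_right ((Commute.ofNat_right s 4).smul_right _)
    have hq := commute_quad_mul_quad (z_z hi' hi) (hβ (z_Z hi')) (hγ (z_Z hi'))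
      (hγ (hβ (Commute.refl _)).symm) e1 e2 (hβ (t_Z hi)) (hγ (t_Z hi))
    simp only [hp hi, hp hi']
    have hwz : Commute (w (i + 1)) ((x i + xi i) * (x i + xi i) +
        -((2 + ξ * ξ) • (X + Xi)) * (x i + xi i) + ((X + Xi) * (X + Xi) + (ξ * ξ) • 4)) :=
      have hz := (z_w hi' hi).symm
      have hZ := (Z_w hi).symm
      ((hz.mul_right hz).add_right ((hβ hZ).mul_right hz)).add_right (hγ hZ)
    rw [(hwz.mul_left hwz).symm.mul_mul_mul_comm, (w_w hi' hi).mul_mul_mul_comm]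
    exact (((t_ww hi).mul_right (t_ww hi)).mul_right hq).symm

end IsSite
end Coefficients

section Shuffle

variable {R : Type} [Ring R] [Algebra F R]

/-- Vectors with `n + 1` coordinates, written as sequences vanishing beyond `n`. -/
def coords (R : Type) [Ring R] [Algebra F R] (n : ℕ) : Submodule F (ℕ → R) where
  carrier := {v | ∀ j, n < j → v j = 0}
  add_mem' hv hw j hj := by rw [Pi.add_apply, hv j hj, hw j hj, add_zero]
  zero_mem' _ _ := rfl
  smul_mem' a v hv j hj := by rw [Pi.smul_apply, hv j hj, smul_zero]

variable {F} in
theorem coords_ext {n : ℕ} {v w : coords F R n} (h : ∀ j ≤ n, v.1 j = w.1 j) : v = w := by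
  ext j
  rcases le_or_gt j n with hj | hj
  · exact h j hj
  · rw [v.2 j hj, w.2 j hj]

/-- The action of the `l`-th of the generators attached to `n + 1` sites on the `j`-th coordinate,
where the new site has been moved to the place `j`. -/
def siteAct (u : ℕ → R) (U : R) (l j : ℕ) : R :=
  if l < j then u l else if l = j then U else u (l - 1)

theorem siteAct_of_lt (u : ℕ → R) (U : R) {l j : ℕ} (h : l < j) : siteAct u U l j = u l :=
  if_pos h

theorem siteAct_of_eq (u : ℕ → R) (U : R) {l j : ℕ} (h : l = j) : siteAct u U l j = U := by
  rw [siteAct, if_neg (by omega), if_pos h]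

theorem siteAct_of_gt (u : ℕ → R) (U : R) {l j : ℕ} (h : j < l) :
    siteAct u U l j = u (l - 1) := by
  rw [siteAct, if_neg (by omega), if_neg (by omega)]

/-- Left multiplication by a scalar on each of the coordinates. -/
def diagOp (n : ℕ) (g : ℕ → R) : Module.End F (coords F R n) where
  toFun v := ⟨fun j => g j * v.1 j, fun j hj => by simp only [v.2 j hj, mul_zero]⟩
  map_add' v w := by ext j; exact mul_add _ _ _
  map_smul' a v := by ext j; exact mul_smul_comm _ _ _

/-- The action of the generator `T_i` in terms of the intertwining coefficients. -/
def shuffleOp (n : ℕ) (ξ : F) (t a N : ℕ → R) (i : ℕ) : Module.End F (coords F R n) where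
  toFun v := ⟨fun j => if n < j then 0 else if j < i then t (i - 1) * v.1 j
    else if j = i then (ξ • 1 - a i) * v.1 i + v.1 (i + 1)
    else if j = i + 1 then a i * v.1 (i + 1) + N i * v.1 i else t i * v.1 j,
    fun j hj => if_pos hj⟩
  map_add' v w := by
    ext j
    simp only [Submodule.coe_add, Pi.add_apply]
    split_ifs <;> simp only [mul_add, add_zero] <;> abel
  map_smul' b v := by
    ext j
    simp only [Submodule.coe_smul, Pi.smul_apply, RingHom.id_apply]
    split_ifs <;> simp only [mul_smul_comm, smul_add, smul_zero]

variable {F} {n : ℕ} {ξ : F} {t a N : ℕ → R}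

theorem diagOp_apply (g : ℕ → R) (v : coords F R n) (j : ℕ) :
    (diagOp F n g v).1 j = g j * v.1 j := rfl

theorem shuffleOp_of_lt {i j : ℕ} (hj : j ≤ n) (h : j < i) (v : coords F R n) :
    (shuffleOp F n ξ t a N i v).1 j = t (i - 1) * v.1 j :=
  (if_neg (by omega)).trans (if_pos h)

theorem shuffleOp_self {i : ℕ} (hi : i ≤ n) (v : coords F R n) :
    (shuffleOp F n ξ t a N i v).1 i = (ξ • 1 - a i) * v.1 i + v.1 (i + 1) :=
  (if_neg (by omega)).trans ((if_neg (by omega)).trans (if_pos rfl))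

theorem shuffleOp_succ {i : ℕ} (hi : i + 1 ≤ n) (v : coords F R n) :
    (shuffleOp F n ξ t a N i v).1 (i + 1) = a i * v.1 (i + 1) + N i * v.1 i :=
  (if_neg (by omega)).trans ((if_neg (by omega)).trans ((if_neg (by omega)).trans (if_pos rfl)))

theorem shuffleOp_of_gt {i j : ℕ} (hj : j ≤ n) (h : i + 1 < j) (v : coords F R n) :
    (shuffleOp F n ξ t a N i v).1 j = t i * v.1 j :=
  (if_neg (by omega)).trans ((if_neg (by omega)).trans ((if_neg (by omega)).trans
    (if_neg (by omega))))

theorem four_cases (i j : ℕ) : j < i ∨ j = i ∨ j = i + 1 ∨ i + 1 < j := by omega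

variable {q : F} {x xi c : ℕ → R} {X Xi C : R}

/-- The relation of `T_i` with the polynomial generators, in additive form. -/
theorem cross_of_sub {R : Type} [Ring R] [Algebra F R] {ξ : F} {T X Y c C : R}
    (hq : T * T = ξ • T + 1)
    (h : T * X = Y * T - ξ • Y - ξ • (c * C * X)) :
    (T + ξ • (c * C)) * X * T = Y := by
  rw [add_mul, h, smul_mul_assoc, sub_add_cancel, sub_mul, mul_assoc, hq, mul_add,
    mul_one, mul_smul_comm, smul_mul_assoc]
  abel

/-- The identities behind the braid relation, `a'` and `b'` being `ξ - a` and `ξ - b`. -/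
theorem braid_rels {a b t N M : R} {a' b' : R} (ha' : a' = ξ • 1 - a) (hb' : b' = ξ • 1 - b)
    (hN : N = 1 + a * a') (hM : M = 1 + b * b') (hNa : Commute N a) (hNb : Commute N b)
    (hMa : Commute M a) (hMb : Commute M b) (hat : a * t = t * b + b' * a)
      (hta : t * a = a * b' + b * t)
    (htt : t * t = ξ • t + 1) :
    a' * t * a' + b' * N = t * a' * t ∧ a' * t + b' * a = t * b' ∧
    a * b' * N + N * t * a' = b' * N * t ∧ a * b' * a + N * t = b' * a * b' + t * M ∧
    t * M * a = b * t * M + M * a * b' ∧ t * b * t = b * t * b + M * a := by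
  have hNb' : Commute N b' := hb' ▸ ((Commute.one_right N).smul_right ξ).sub_right hNb
  have hMb' : Commute M b' := hb' ▸ ((Commute.one_right M).smul_right ξ).sub_right hMb
  have ta' : t * a' = b' * t - a * b' := by
    rw [ha', mul_sub, hta, hb', sub_mul, mul_smul_comm, smul_mul_assoc, one_mul, mul_one]; abel
  have a't : a' * t = t * b' - b' * a := by
    rw [ha', sub_mul, hat, hb', mul_sub t, mul_smul_comm, smul_mul_assoc, one_mul, mul_one]; abel
  have tb : t * b = a * t - b' * a := by rw [hat]; abel
  have a'a : a' * a = N - 1 := by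
    rw [hN, ha']; simp only [mul_sub, sub_mul, smul_mul_assoc, mul_smul_comm, one_mul, mul_one]
    abel
  have bb' : b * b' = M - 1 := by rw [hM]; abel
  have ba : b + b' = ξ • 1 := by rw [hb']; abel
  have aa' : a + a' = ξ • 1 := by rw [ha']; abel
  refine ⟨?_, ?_, ?_, ?_, ?_, ?_⟩
  · have e : (a + a') * (b' * t) = ξ • (b' * t) := by rw [aa', smul_mul_assoc, one_mul]
    rw [add_mul] at e
    rw [mul_assoc a', ta', mul_sub, ← mul_assoc a' a, a'a, sub_mul, sub_mul, mul_assoc b', htt,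
      mul_add, one_mul, mul_one, mul_smul_comm, ← e, hNb'.eq, mul_assoc]
    abel
  · rw [a't]; abel
  · rw [← (hNa.mul_right hNb').eq, mul_assoc N, ta', mul_sub, ← hNb'.eq, mul_assoc N b' t]
    abel
  · rw [hN, hM, add_mul, one_mul, mul_add, mul_one, mul_assoc a a', a't, mul_sub, ← mul_assoc a t,
      hat, add_mul]
    simp only [mul_assoc]
    abel
  · rw [mul_assoc, hMa.eq, ← mul_assoc, hta, add_mul, mul_assoc a b' M, ← hMb'.eq, mul_assoc a M,
      add_comm]
  · have e : (b + b') * (a * t) = ξ • (a * t) := by rw [ba, smul_mul_assoc, one_mul]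
    rw [add_mul] at e
    rw [mul_assoc b, tb, mul_sub, sub_mul, mul_assoc a, htt, mul_add, mul_one, mul_smul_comm, ← e,
      ← mul_assoc b b', bb', sub_mul, one_mul, mul_assoc b']
    abel

theorem isHData_shuffle (hs : IsSite q n x xi c t X Xi C) (ha : IsCoeff q n x c t X C a N) :
    IsHData q (n + 1) (fun l => diagOp F n (siteAct x X l)) (fun l => diagOp F n (siteAct xi Xi l))
      (fun l => diagOp F n (siteAct c C l)) (shuffleOp F n (q - q⁻¹) t a N) := by
  have hd := hs.hd
  have hquad : ∀ i, i + 1 < n + 1 → shuffleOp F n (q - q⁻¹) t a N i *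
      shuffleOp F n (q - q⁻¹) t a N i = (q - q⁻¹) • shuffleOp F n (q - q⁻¹) t a N i + 1 := by
    intro i hi
    refine LinearMap.ext fun v => coords_ext fun j hj => ?_
    simp only [Module.End.mul_apply, LinearMap.add_apply, LinearMap.smul_apply,
      Module.End.one_apply, Submodule.coe_add, Pi.add_apply, Submodule.coe_smul, Pi.smul_apply]
    rcases four_cases i j with h | rfl | rfl | h
    · simp only [shuffleOp_of_lt hj h]
      rw [← mul_assoc, hd.quad (i - 1) (by omega), add_mul, one_mul, smul_mul_assoc]
    · simp only [shuffleOp_self hj, shuffleOp_succ (show j + 1 ≤ n by omega),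
        ha.N_eq j (by omega), mul_add, add_mul, mul_sub, sub_mul, smul_mul_assoc, mul_smul_comm,
        one_mul, mul_one, mul_assoc]
      module
    · simp only [shuffleOp_self (show i ≤ n by omega), shuffleOp_succ hj,
        ha.N_eq i (by omega), mul_add, add_mul, mul_sub, sub_mul, smul_mul_assoc, mul_smul_comm,
        one_mul, mul_one, mul_assoc]
      module
    · simp only [shuffleOp_of_gt hj h]
      rw [← mul_assoc, hd.quad i (by omega), add_mul, one_mul, smul_mul_assoc]
  have htc : ∀ i, i + 1 < n + 1 → shuffleOp F n (q - q⁻¹) t a N i * diagOp F n (siteAct c C i) =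
      diagOp F n (siteAct c C (i + 1)) * shuffleOp F n (q - q⁻¹) t a N i := by
    intro i hi
    refine LinearMap.ext fun v => coords_ext fun j hj => ?_
    simp only [Module.End.mul_apply]
    rcases four_cases i j with h | rfl | rfl | h
    · obtain ⟨i, rfl⟩ := Nat.exists_eq_add_one_of_ne_zero (show i ≠ 0 by omega)
      simp only [shuffleOp_of_lt hj h, diagOp_apply, siteAct_of_gt _ _ h,
        siteAct_of_gt _ _ (show j < i + 1 + 1 by omega), Nat.add_sub_cancel, ← mul_assoc,
        hd.tc i (show i + 1 < n by omega)]
    · simp only [shuffleOp_self hj, diagOp_apply, siteAct_of_eq _ _ (rfl : j = j),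
        siteAct_of_lt _ _ (lt_add_one j), siteAct_of_gt _ _ (lt_add_one j), Nat.add_sub_cancel]
      simp only [sub_mul, smul_mul_assoc, one_mul, mul_add, mul_sub, mul_smul_comm,
        mul_mul_of_mul_eq (ha.a_C j (by omega)), add_mul, smul_sub, mul_assoc]
      abel
    · simp only [shuffleOp_succ hj, diagOp_apply, siteAct_of_eq _ _ (rfl : i = i),
        siteAct_of_eq _ _ (rfl : i + 1 = i + 1), siteAct_of_lt _ _ (lt_add_one i)]
      simp only [mul_add, mul_mul_of_mul_eq (ha.a_c i (by omega)),
        mul_mul_of_mul_eq (ha.N_C i (by omega)).eq, mul_assoc]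
    · simp only [shuffleOp_of_gt hj h, diagOp_apply, siteAct_of_lt _ _ h,
        siteAct_of_lt _ _ (show i < j by omega), ← mul_assoc, hd.tc i (show i + 1 < n by omega)]
  apply IsHData.of_basic
  · intro l hl
    refine LinearMap.ext fun v => coords_ext fun j hj => ?_
    simp only [Module.End.mul_apply, diagOp_apply, Module.End.one_apply, ← mul_assoc]
    rcases lt_trichotomy l j with h | h | h
    · simp only [siteAct_of_lt _ _ h, hd.x_xi l (by omega), one_mul]
    · simp only [siteAct_of_eq _ _ h, hs.X_Xi, one_mul]
    · simp only [siteAct_of_gt _ _ h, hd.x_xi (l - 1) (by omega), one_mul]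
  · intro l hl
    refine LinearMap.ext fun v => coords_ext fun j hj => ?_
    simp only [Module.End.mul_apply, diagOp_apply, Module.End.one_apply, ← mul_assoc]
    rcases lt_trichotomy l j with h | h | h
    · simp only [siteAct_of_lt _ _ h, hd.xi_x l (by omega), one_mul]
    · simp only [siteAct_of_eq _ _ h, hs.Xi_X, one_mul]
    · simp only [siteAct_of_gt _ _ h, hd.xi_x (l - 1) (by omega), one_mul]
  · intro l hl m hm
    refine LinearMap.ext fun v => coords_ext fun j hj => ?_
    simp only [Module.End.mul_apply, diagOp_apply, ← mul_assoc]
    congr 1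
    rcases lt_trichotomy l j with h | h | h <;> rcases lt_trichotomy m j with h' | h' | h'
    · rw [siteAct_of_lt _ _ h, siteAct_of_lt _ _ h', hd.xx l (by omega) m (by omega)]
    · rw [siteAct_of_lt _ _ h, siteAct_of_eq _ _ h', (hs.Xx l (by omega)).eq]
    · rw [siteAct_of_lt _ _ h, siteAct_of_gt _ _ h', hd.xx l (by omega) (m - 1) (by omega)]
    · rw [siteAct_of_eq _ _ h, siteAct_of_lt _ _ h', (hs.Xx m (by omega)).eq]
    · rw [siteAct_of_eq _ _ h, siteAct_of_eq _ _ h']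
    · rw [siteAct_of_eq _ _ h, siteAct_of_gt _ _ h', (hs.Xx (m - 1) (by omega)).eq]
    · rw [siteAct_of_gt _ _ h, siteAct_of_lt _ _ h', hd.xx (l - 1) (by omega) m (by omega)]
    · rw [siteAct_of_gt _ _ h, siteAct_of_eq _ _ h', (hs.Xx (l - 1) (by omega)).eq]
    · rw [siteAct_of_gt _ _ h, siteAct_of_gt _ _ h', hd.xx (l - 1) (by omega) (m - 1) (by omega)]
  · intro l hl
    refine LinearMap.ext fun v => coords_ext fun j hj => ?_
    simp only [Module.End.mul_apply, diagOp_apply, Module.End.one_apply, ← mul_assoc]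
    rcases lt_trichotomy l j with h | h | h
    · simp only [siteAct_of_lt _ _ h, hd.cc l (by omega), one_mul]
    · simp only [siteAct_of_eq _ _ h, hs.CC, one_mul]
    · simp only [siteAct_of_gt _ _ h, hd.cc (l - 1) (by omega), one_mul]
  · intro l hl m hm hlm
    refine LinearMap.ext fun v => coords_ext fun j hj => ?_
    simp only [Module.End.mul_apply, diagOp_apply, ← mul_assoc, LinearMap.neg_apply,
      Submodule.coe_neg, Pi.neg_apply, ← neg_mul]
    congr 1
    rcases lt_trichotomy l j with h | h | h <;> rcases lt_trichotomy m j with h' | h' | h'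
    · rw [siteAct_of_lt _ _ h, siteAct_of_lt _ _ h', hd.canti l (by omega) m (by omega) hlm,
        neg_mul]
    · rw [siteAct_of_lt _ _ h, siteAct_of_eq _ _ h', neg_mul, hs.Cc l (by omega), neg_neg]
    · rw [siteAct_of_lt _ _ h, siteAct_of_gt _ _ h', neg_mul,
        hd.canti l (by omega) (m - 1) (by omega) (by omega)]
    · rw [siteAct_of_eq _ _ h, siteAct_of_lt _ _ h', hs.Cc m (by omega), neg_mul]
    · exact absurd (h.trans h'.symm) hlm
    · rw [siteAct_of_eq _ _ h, siteAct_of_gt _ _ h', hs.Cc (m - 1) (by omega), neg_mul]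
    · rw [siteAct_of_gt _ _ h, siteAct_of_lt _ _ h', neg_mul,
        hd.canti (l - 1) (by omega) m (by omega) (by omega)]
    · rw [siteAct_of_gt _ _ h, siteAct_of_eq _ _ h', neg_mul, hs.Cc (l - 1) (by omega), neg_neg]
    · rw [siteAct_of_gt _ _ h, siteAct_of_gt _ _ h', neg_mul,
        hd.canti (l - 1) (by omega) (m - 1) (by omega) (by omega)]
  · intro l hl
    refine LinearMap.ext fun v => coords_ext fun j hj => ?_
    simp only [Module.End.mul_apply, diagOp_apply, ← mul_assoc]
    congr 1
    rcases lt_trichotomy l j with h | h | h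
    · simp only [siteAct_of_lt _ _ h, hd.cx l (by omega)]
    · simp only [siteAct_of_eq _ _ h, hs.CX]
    · simp only [siteAct_of_gt _ _ h, hd.cx (l - 1) (by omega)]
  · intro l hl m hm hlm
    refine LinearMap.ext fun v => coords_ext fun j hj => ?_
    simp only [Module.End.mul_apply, diagOp_apply, ← mul_assoc]
    congr 1
    rcases lt_trichotomy l j with h | h | h <;> rcases lt_trichotomy m j with h' | h' | h'
    · rw [siteAct_of_lt _ _ h, siteAct_of_lt _ _ h', hd.cxo l (by omega) m (by omega) hlm]
    · rw [siteAct_of_lt _ _ h, siteAct_of_eq _ _ h', (hs.Xc l (by omega)).eq]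
    · rw [siteAct_of_lt _ _ h, siteAct_of_gt _ _ h',
        hd.cxo l (by omega) (m - 1) (by omega) (by omega)]
    · rw [siteAct_of_eq _ _ h, siteAct_of_lt _ _ h', (hs.Cx m (by omega)).eq]
    · exact absurd (h.trans h'.symm) hlm
    · rw [siteAct_of_eq _ _ h, siteAct_of_gt _ _ h', (hs.Cx (m - 1) (by omega)).eq]
    · rw [siteAct_of_gt _ _ h, siteAct_of_lt _ _ h',
        hd.cxo (l - 1) (by omega) m (by omega) (by omega)]
    · rw [siteAct_of_gt _ _ h, siteAct_of_eq _ _ h', (hs.Xc (l - 1) (by omega)).eq]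
    · rw [siteAct_of_gt _ _ h, siteAct_of_gt _ _ h',
        hd.cxo (l - 1) (by omega) (m - 1) (by omega) (by omega)]
  · exact hquad
  · intro i hi
    refine LinearMap.ext fun v => coords_ext fun j hj => ?_
    simp only [Module.End.mul_apply]
    have hi₁ : i ≤ n := by omega
    have hi₂ : i + 1 ≤ n := by omega
    have hi₃ : i + 1 + 1 ≤ n := by omega
    have hat := ha.a_t i (by omega)
    obtain ⟨e₁, e₂, e₃, e₄, e₅, e₆⟩ := braid_rels rfl rfl (ha.N_eq i (by omega))
      (ha.N_eq (i + 1) (by omega)) (ha.N_a i (by omega) i (by omega))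
      (ha.N_a i (by omega) (i + 1) (by omega)) (ha.N_a (i + 1) (by omega) i (by omega))
      (ha.N_a (i + 1) (by omega) (i + 1) (by omega)) hat (ha.t_a i (by omega))
        (hd.quad i (by omega))
    have hNM : Commute (N i) (N (i + 1)) := by
      rw [ha.N_eq (i + 1) (by omega)]
      have e := ha.N_a i (by omega) (i + 1) (by omega)
      exact (Commute.one_right _).add_right (e.mul_right
        (((Commute.one_right _).smul_right _).sub_right e))
    have e₇ := (ha.NN_t i (by omega)).symm.eq
    rw [hNM.eq] at e₇
    rcases (show j < i ∨ j = i ∨ j = i + 1 ∨ j = i + 1 + 1 ∨ i + 1 + 1 < j by omega) with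
      h | rfl | rfl | rfl | h
    · obtain ⟨i, rfl⟩ := Nat.exists_eq_add_one_of_ne_zero (show i ≠ 0 by omega)
      simp only [shuffleOp_of_lt hj h, shuffleOp_of_lt hj (show j < i + 1 + 1 by omega),
        Nat.add_sub_cancel]
      simp only [← mul_assoc, hd.braid i (by omega)]
    · simp only [shuffleOp_self hi₁, shuffleOp_succ hi₂, shuffleOp_self hi₂, shuffleOp_succ hi₃,
        shuffleOp_of_lt hi₁ (lt_add_one j), shuffleOp_of_gt hi₃ (lt_add_one (j + 1)),
        Nat.add_sub_cancel]
      generalize (q - q⁻¹) • 1 - a j = a' at *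
      generalize (q - q⁻¹) • 1 - a (j + 1) = b' at *
      linear_combination (norm := noncomm_ring) e₁ * v.1 j + e₂ * v.1 (j + 1)
    · simp only [shuffleOp_self hi₁, shuffleOp_succ hi₂, shuffleOp_self hi₂, shuffleOp_succ hi₃,
        shuffleOp_of_lt hi₁ (lt_add_one i), shuffleOp_of_gt hi₃ (lt_add_one (i + 1)),
        Nat.add_sub_cancel]
      generalize (q - q⁻¹) • 1 - a i = a' at *
      generalize (q - q⁻¹) • 1 - a (i + 1) = b' at *
      linear_combination (norm := noncomm_ring)
        e₃ * v.1 i + e₄ * v.1 (i + 1) + hat * v.1 (i + 1 + 1)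
    · simp only [shuffleOp_self hi₁, shuffleOp_succ hi₂, shuffleOp_self hi₂, shuffleOp_succ hi₃,
        shuffleOp_of_lt hi₁ (lt_add_one i), shuffleOp_of_gt hi₃ (lt_add_one (i + 1)),
        Nat.add_sub_cancel]
      generalize (q - q⁻¹) • 1 - a i = a' at *
      generalize (q - q⁻¹) • 1 - a (i + 1) = b' at *
      linear_combination (norm := noncomm_ring)
        e₇ * v.1 i + e₅ * v.1 (i + 1) + e₆ * v.1 (i + 1 + 1)
    · simp only [shuffleOp_of_gt hj h, shuffleOp_of_gt hj (show i + 1 < j by omega)]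
      simp only [← mul_assoc, hd.braid i (by omega)]
  · intro i k hik hk
    refine LinearMap.ext fun v => coords_ext fun j hj => ?_
    simp only [Module.End.mul_apply]
    have hi₁ : i ≤ n := by omega
    have hi₂ : i + 1 ≤ n := by omega
    have hk₁ : k ≤ n := by omega
    have hk₂ : k + 1 ≤ n := by omega
    rcases (show j < i ∨ j = i ∨ j = i + 1 ∨ (i + 1 < j ∧ j < k) ∨ j = k ∨ j = k + 1 ∨ k + 1 < j
      by omega) with h | rfl | rfl | ⟨h, h'⟩ | rfl | rfl | h
    · simp only [shuffleOp_of_lt hj h, shuffleOp_of_lt hj (show j < k by omega)]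
      rw [← mul_assoc, hd.far (i - 1) (k - 1) (by omega) (by omega), mul_assoc]
    · have e := (ha.a_to j (by omega) (k - 1) (by omega) (by omega) (by omega)).eq
      simp only [shuffleOp_self hj, shuffleOp_of_lt hj (show j < k by omega),
        shuffleOp_of_lt hi₂ (show j + 1 < k by omega), mul_add, sub_mul, mul_sub,
        mul_mul_of_mul_eq e, smul_mul_assoc, one_mul, mul_smul_comm, mul_assoc]
    · have e := (ha.a_to i (by omega) (k - 1) (by omega) (by omega) (by omega))
      have e' : Commute (N i) (t (k - 1)) := by
        rw [ha.N_eq i (by omega)]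
        exact (Commute.one_left _).add_left (e.mul_left
          (((Commute.one_left _).smul_left _).sub_left e))
      simp only [shuffleOp_succ hj, shuffleOp_of_lt hi₁ (show i < k by omega),
        shuffleOp_of_lt hi₂ (show i + 1 < k by omega), mul_add,
        mul_mul_of_mul_eq e.eq, mul_mul_of_mul_eq e'.eq, mul_assoc]
    · simp only [shuffleOp_of_gt hj h, shuffleOp_of_lt hj h']
      rw [← mul_assoc, hd.far i (k - 1) (by omega) (by omega), mul_assoc]
    · have e := (ha.a_to j (by omega) i (by omega) (by omega) (by omega)).eq
      simp only [shuffleOp_self hj, shuffleOp_of_gt hj (show i + 1 < j by omega),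
        shuffleOp_of_gt hk₂ (show i + 1 < j + 1 by omega), mul_add, sub_mul, mul_sub,
        mul_mul_of_mul_eq e, smul_mul_assoc, one_mul, mul_smul_comm, mul_assoc]
    · have e := (ha.a_to k (by omega) i (by omega) (by omega) (by omega))
      have e' : Commute (N k) (t i) := by
        rw [ha.N_eq k (by omega)]
        exact (Commute.one_left _).add_left (e.mul_left
          (((Commute.one_left _).smul_left _).sub_left e))
      simp only [shuffleOp_succ hj, shuffleOp_of_gt hk₁ (show i + 1 < k by omega),
        shuffleOp_of_gt hk₂ (show i + 1 < k + 1 by omega), mul_add,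
        mul_mul_of_mul_eq e.eq, mul_mul_of_mul_eq e'.eq, mul_assoc]
    · simp only [shuffleOp_of_gt hj h, shuffleOp_of_gt hj (show i + 1 < j by omega)]
      rw [← mul_assoc, hd.far i k (by omega) (by omega), mul_assoc]
  · exact htc
  · intro i hi m hm h₁ h₂
    refine LinearMap.ext fun v => coords_ext fun j hj => ?_
    simp only [Module.End.mul_apply]
    rcases four_cases i j with h | rfl | rfl | h
    · simp only [shuffleOp_of_lt hj h, diagOp_apply, ← mul_assoc]
      congr 1
      rcases lt_trichotomy m j with h' | h' | h'
      · rw [siteAct_of_lt _ _ h', hd.tco (i - 1) (by omega) m (by omega) (by omega) (by omega)]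
      · rw [siteAct_of_eq _ _ h', (hs.Ct (i - 1) (by omega)).eq]
      · rw [siteAct_of_gt _ _ h',
          hd.tco (i - 1) (by omega) (m - 1) (by omega) (by omega) (by omega)]
    · simp only [shuffleOp_self hj, diagOp_apply]
      obtain ⟨m', hm', hmj, e₁, e₂⟩ : ∃ m' < n, m' ≠ j ∧ siteAct c C m j = c m' ∧
          siteAct c C m (j + 1) = c m' := by
        rcases lt_or_gt_of_ne h₁ with h' | h'
        · exact ⟨m, by omega, by omega, siteAct_of_lt _ _ h', siteAct_of_lt _ _ (by omega)⟩
        · exact ⟨m - 1, by omega, by omega, siteAct_of_gt _ _ h', siteAct_of_gt _ _ (by omega)⟩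
      simp only [e₁, e₂, mul_add, sub_mul, mul_sub, smul_mul_assoc, one_mul, mul_smul_comm,
        mul_mul_of_mul_eq (ha.a_co j (by omega) m' hm' hmj).eq, mul_assoc]
    · simp only [shuffleOp_succ hj, diagOp_apply]
      obtain ⟨m', hm', hmj, e₁, e₂⟩ : ∃ m' < n, m' ≠ i ∧ siteAct c C m i = c m' ∧
          siteAct c C m (i + 1) = c m' := by
        rcases lt_or_gt_of_ne h₁ with h' | h'
        · exact ⟨m, by omega, by omega, siteAct_of_lt _ _ h', siteAct_of_lt _ _ (by omega)⟩
        · exact ⟨m - 1, by omega, by omega, siteAct_of_gt _ _ h', siteAct_of_gt _ _ (by omega)⟩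
      simp only [e₁, e₂, mul_add, mul_mul_of_mul_eq (ha.a_co i (by omega) m' hm' hmj).eq,
        mul_mul_of_mul_eq (ha.N_c i (by omega) m' hm').eq, mul_assoc]
    · simp only [shuffleOp_of_gt hj h, diagOp_apply, ← mul_assoc]
      congr 1
      rcases lt_trichotomy m j with h' | h' | h'
      · rw [siteAct_of_lt _ _ h', hd.tco i (by omega) m (by omega) (by omega) (by omega)]
      · rw [siteAct_of_eq _ _ h', (hs.Ct i (by omega)).eq]
      · rw [siteAct_of_gt _ _ h',
          hd.tco i (by omega) (m - 1) (by omega) (by omega) (by omega)]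
  · intro i hi m hm h₁ h₂
    refine LinearMap.ext fun v => coords_ext fun j hj => ?_
    simp only [Module.End.mul_apply]
    rcases four_cases i j with h | rfl | rfl | h
    · simp only [shuffleOp_of_lt hj h, diagOp_apply, ← mul_assoc]
      congr 1
      rcases lt_trichotomy m j with h' | h' | h'
      · rw [siteAct_of_lt _ _ h', hd.txo (i - 1) (by omega) m (by omega) (by omega) (by omega)]
      · rw [siteAct_of_eq _ _ h', (hs.Xt (i - 1) (by omega)).eq]
      · rw [siteAct_of_gt _ _ h',
          hd.txo (i - 1) (by omega) (m - 1) (by omega) (by omega) (by omega)]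
    · simp only [shuffleOp_self hj, diagOp_apply]
      obtain ⟨m', hm', hmj, e₁, e₂⟩ : ∃ m' < n, m' ≠ j ∧ siteAct x X m j = x m' ∧
          siteAct x X m (j + 1) = x m' := by
        rcases lt_or_gt_of_ne h₁ with h' | h'
        · exact ⟨m, by omega, by omega, siteAct_of_lt _ _ h', siteAct_of_lt _ _ (by omega)⟩
        · exact ⟨m - 1, by omega, by omega, siteAct_of_gt _ _ h', siteAct_of_gt _ _ (by omega)⟩
      simp only [e₁, e₂, mul_add, sub_mul, mul_sub, smul_mul_assoc, one_mul, mul_smul_comm,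
        mul_mul_of_mul_eq (ha.a_xo j (by omega) m' hm' hmj).eq, mul_assoc]
    · simp only [shuffleOp_succ hj, diagOp_apply]
      obtain ⟨m', hm', hmj, e₁, e₂⟩ : ∃ m' < n, m' ≠ i ∧ siteAct x X m i = x m' ∧
          siteAct x X m (i + 1) = x m' := by
        rcases lt_or_gt_of_ne h₁ with h' | h'
        · exact ⟨m, by omega, by omega, siteAct_of_lt _ _ h', siteAct_of_lt _ _ (by omega)⟩
        · exact ⟨m - 1, by omega, by omega, siteAct_of_gt _ _ h', siteAct_of_gt _ _ (by omega)⟩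
      simp only [e₁, e₂, mul_add, mul_mul_of_mul_eq (ha.a_xo i (by omega) m' hm' hmj).eq,
        mul_mul_of_mul_eq (ha.N_x i (by omega) m' hm').eq, mul_assoc]
    · simp only [shuffleOp_of_gt hj h, diagOp_apply, ← mul_assoc]
      congr 1
      rcases lt_trichotomy m j with h' | h' | h'
      · rw [siteAct_of_lt _ _ h', hd.txo i (by omega) m (by omega) (by omega) (by omega)]
      · rw [siteAct_of_eq _ _ h', (hs.Xt i (by omega)).eq]
      · rw [siteAct_of_gt _ _ h',
          hd.txo i (by omega) (m - 1) (by omega) (by omega) (by omega)]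
  · intro i hi
    refine cross_of_sub (hquad i hi) ?_
    refine LinearMap.ext fun v => coords_ext fun j hj => ?_
    simp only [Module.End.mul_apply, LinearMap.sub_apply, LinearMap.smul_apply,
      Submodule.coe_sub, Pi.sub_apply, Submodule.coe_smul, Pi.smul_apply]
    rcases four_cases i j with h | rfl | rfl | h
    · obtain ⟨i, rfl⟩ := Nat.exists_eq_add_one_of_ne_zero (show i ≠ 0 by omega)
      simp only [shuffleOp_of_lt hj h, diagOp_apply, siteAct_of_gt _ _ h,
        siteAct_of_gt _ _ (show j < i + 1 + 1 by omega), Nat.add_sub_cancel]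
      rw [← mul_assoc, (hs.isTriple (show i + 1 < n by omega)).t_x]
      simp only [sub_mul, smul_mul_assoc, mul_assoc]
    · simp only [shuffleOp_self hj, diagOp_apply, siteAct_of_eq _ _ (rfl : j = j),
        siteAct_of_lt _ _ (lt_add_one j), siteAct_of_gt _ _ (lt_add_one j), Nat.add_sub_cancel]
      have e := ha.a_X j (by omega)
      simp only [sub_mul, smul_mul_assoc, one_mul, mul_add, mul_sub, mul_smul_comm,
        mul_mul_of_mul_eq e, add_mul, smul_add, mul_assoc]
      abel
    · simp only [shuffleOp_succ hj, diagOp_apply, siteAct_of_eq _ _ (rfl : i = i),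
        siteAct_of_eq _ _ (rfl : i + 1 = i + 1),
        siteAct_of_lt _ _ (lt_add_one i)]
      have e := ha.a_x i (by omega)
      simp only [sub_mul, smul_mul_assoc, mul_add, mul_mul_of_mul_eq e, add_mul, smul_add,
        mul_mul_of_mul_eq (ha.N_X i (by omega)).eq, mul_assoc]
      abel
    · simp only [shuffleOp_of_gt hj h, diagOp_apply, siteAct_of_lt _ _ h,
        siteAct_of_lt _ _ (show i < j by omega)]
      rw [← mul_assoc, (hs.isTriple (show i + 1 < n by omega)).t_x]
      simp only [sub_mul, smul_mul_assoc, mul_assoc]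

end Shuffle

section Cosets

variable {F}
variable {A : Type} [Ring A] [Algebra F A]

/-- The relations of the finite Hecke algebra with `n` generators. -/
structure IsBraided (ξ : F) (n : ℕ) (t : ℕ → A) : Prop where
  quad : ∀ i < n, t i * t i = ξ • t i + 1
  far : ∀ i j, i + 1 < j → j < n → t i * t j = t j * t i
  braid : ∀ i, i + 1 < n → t i * t (i + 1) * t i = t (i + 1) * t i * t (i + 1)

/-- The product `t (k - 1) * ⋯ * t 0`. -/
def descend (t : ℕ → A) : ℕ → A
  | 0 => 1
  | k + 1 => t k * descend t k

/-- The product `t 0 * ⋯ * t (k - 1)`. -/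
def ascend (t : ℕ → A) : ℕ → A
  | 0 => 1
  | k + 1 => ascend t k * t k

variable {ξ : F} {n : ℕ} {t : ℕ → A}

theorem IsBraided.mul_descend_of_gt (h : IsBraided ξ n t) {j k : ℕ} (hk : k < j) (hj : j < n) :
    t j * descend t k = descend t k * t j := by
  induction k with
  | zero => simp [descend]
  | succ k ih =>
    rw [descend, ← mul_assoc, ← h.far k j hk hj, mul_assoc, ih (by omega), mul_assoc]

theorem IsBraided.mul_descend_of_lt (h : IsBraided ξ n t) {i k : ℕ} (hi : i + 1 < k)
    (hk : k ≤ n) : t i * descend t k = descend t k * t (i + 1) := by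
  induction k with
  | zero => omega
  | succ k ih =>
    rcases Nat.lt_or_ge (i + 1) k with h' | h'
    · rw [descend, ← mul_assoc, h.far i k h' hk, mul_assoc, ih h' (by omega), mul_assoc]
    · obtain rfl : k = i + 1 := by omega
      rw [descend, descend, ← mul_assoc, ← mul_assoc, h.braid i hk, mul_assoc _ (t (i + 1)),
        h.mul_descend_of_gt (lt_add_one i) hk]
      simp only [mul_assoc]

/-- A parabolic subalgebra has the products `t (k - 1) * ⋯ * t 0` as coset representatives. -/
theorem IsBraided.descend_span (h : IsBraided ξ n t) (P : Subalgebra F A)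
    (hP : ∀ i, i + 1 < n → t (i + 1) ∈ P) (G : Set A) (hG : Algebra.adjoin F G = ⊤)
    (hGP : ∀ u ∈ G, (∃ i < n, u = t i) ∨
      u ∈ P ∧ (∀ i, i + 1 < n → Commute u (t (i + 1))) ∧
        (0 < n → ∃ g ∈ P, ∃ g' ∈ P, u * t 0 = t 0 * g + g')) :
    AddSubgroup.closure {z | ∃ k ≤ n, ∃ g ∈ P, z = descend t k * g} = ⊤ := by
  set S := AddSubgroup.closure {z | ∃ k ≤ n, ∃ g ∈ P, z = descend t k * g} with hS
  have hmem : ∀ k ≤ n, ∀ g ∈ P, descend t k * g ∈ S := fun k hk g hg =>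
    AddSubgroup.subset_closure ⟨k, hk, g, hg, rfl⟩
  have stable : ∀ u : A, (∀ k ≤ n, ∀ g ∈ P, u * (descend t k * g) ∈ S) → ∀ s ∈ S, u * s ∈ S := by
    intro u hu s hs
    rw [hS] at hs
    induction hs using AddSubgroup.closure_induction with
    | mem s hs => obtain ⟨k, hk, g, hg, rfl⟩ := hs; exact hu k hk g hg
    | zero => rw [mul_zero]; exact zero_mem _
    | add a b _ _ ha hb => rw [mul_add]; exact add_mem ha hb
    | neg a _ ha => rw [mul_neg]; exact neg_mem ha
  have factor : ∀ k, k + 1 ≤ n → ∃ p ∈ P, descend t (k + 1) = p * t 0 ∧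
      ∀ u, (∀ i, i + 1 < n → Commute u (t (i + 1))) → Commute u p := by
    intro k
    induction k with
    | zero => exact fun _ => ⟨1, one_mem _, by simp [descend], fun u _ => .one_right u⟩
    | succ k ih =>
      intro hk
      obtain ⟨p, hp, e, hc⟩ := ih (by omega)
      exact ⟨t (k + 1) * p, mul_mem (hP k hk) hp, by rw [descend, e, mul_assoc],
        fun u hu => (hu k hk).mul_right (hc u hu)⟩
  refine eq_top_of_mul_left_mem S G hG
    (by simpa [descend] using hmem 0 (Nat.zero_le n) 1 (one_mem _)) ?_ ?_
  · intro r s hs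
    rw [Algebra.smul_def]
    refine stable _ (fun k hk g hg => ?_) s hs
    rw [← Algebra.smul_def, ← mul_smul_comm]
    exact hmem k hk _ (P.smul_mem hg r)
  · intro u hu
    refine stable u fun k hk g hg => ?_
    rcases hGP u hu with ⟨i, hi, rfl⟩ | ⟨huP, huc, hu0⟩
    · rw [← mul_assoc]
      rcases lt_trichotomy i k with h' | rfl | h'
      · rcases Nat.lt_or_ge (i + 1) k with h'' | h''
        · rw [h.mul_descend_of_lt h'' hk, mul_assoc]
          exact hmem k hk _ (mul_mem (hP i (by omega)) hg)
        · obtain rfl : k = i + 1 := by omega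
          rw [descend, ← mul_assoc, h.quad i hi, add_mul, one_mul, smul_mul_assoc, ← descend,
            add_mul, smul_mul_assoc, ← mul_smul_comm]
          exact add_mem (hmem _ hk _ (P.smul_mem hg ξ)) (hmem _ hi.le _ hg)
      · rw [← descend]
        exact hmem _ hi _ hg
      · obtain ⟨j, rfl⟩ : ∃ j, i = j + 1 := ⟨i - 1, by omega⟩
        rw [h.mul_descend_of_gt h' hi, mul_assoc]
        exact hmem k hk _ (mul_mem (hP j hi) hg)
    · rcases k with _ | k
      · rw [descend, one_mul]
        simpa [descend] using hmem 0 hk _ (mul_mem huP hg)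
      · obtain ⟨p, hp, e, hc⟩ := factor k hk
        obtain ⟨a, ha, b, hb, e'⟩ := hu0 (by omega)
        have e2 : u * (descend t (k + 1) * g) =
            descend t (k + 1) * (a * g) + descend t 0 * (p * b * g) := by
          rw [e, descend, one_mul, ← mul_assoc, ← mul_assoc, (hc u huc).eq, mul_assoc p u, e']
          simp only [mul_add, add_mul, mul_assoc]
        rw [e2]
        exact add_mem (hmem _ hk _ (mul_mem ha hg))
          (hmem 0 (Nat.zero_le n) _ (mul_mem (mul_mem hp hb) hg))

open MulOpposite in
/-- The mirror image of `IsBraided.descend_span`. -/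
theorem IsBraided.ascend_span (h : IsBraided ξ n t) (P : Subalgebra F A)
    (hP : ∀ i, i + 1 < n → t (i + 1) ∈ P) (G : Set A) (hG : Algebra.adjoin F G = ⊤)
    (hGP : ∀ u ∈ G, (∃ i < n, u = t i) ∨
      u ∈ P ∧ (∀ i, i + 1 < n → Commute u (t (i + 1))) ∧
        (0 < n → ∃ g ∈ P, ∃ g' ∈ P, t 0 * u = g * t 0 + g')) :
    AddSubgroup.closure {z | ∃ k ≤ n, ∃ g ∈ P, z = g * ascend t k} = ⊤ := by
  have hop : IsBraided ξ n (fun i => op (t i)) :=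
    { quad := fun i hi => by rw [← op_mul, h.quad i hi]; rfl
      far := fun i j hi hj => by rw [← op_mul, ← op_mul, h.far i j hi hj]
      braid := fun i hi => by simp only [← op_mul, ← mul_assoc, h.braid i hi] }
  have hdesc : ∀ k, descend (fun i => op (t i)) k = op (ascend t k) := by
    intro k
    induction k with
    | zero => rfl
    | succ k ih => rw [descend, ih, ascend, op_mul]
  have key := hop.descend_span P.op hP (unop ⁻¹' G) (by rw [← Subalgebra.op_adjoin, hG]; rfl) ?_
  · rw [eq_top_iff]
    intro a _
    have ha : op a ∈ (⊤ : AddSubgroup Aᵐᵒᵖ) := trivial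
    rw [← key] at ha
    have : ∀ b ∈ AddSubgroup.closure {z | ∃ k ≤ n, ∃ g ∈ P.op,
        z = descend (fun i => op (t i)) k * g}, unop b ∈
        AddSubgroup.closure {z | ∃ k ≤ n, ∃ g ∈ P, z = g * ascend t k} := by
      intro b hb
      induction hb using AddSubgroup.closure_induction with
      | mem s hs =>
        obtain ⟨k, hk, g, hg, rfl⟩ := hs
        refine AddSubgroup.subset_closure ⟨k, hk, unop g, hg, ?_⟩
        rw [hdesc, unop_mul, unop_op]
      | zero => exact zero_mem _
      | add a b _ _ ha hb => exact add_mem ha hb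
      | neg a _ ha => exact neg_mem ha
    exact this _ ha
  · intro u hu
    rcases hGP _ hu with ⟨i, hi, e⟩ | ⟨h1, h2, h3⟩
    · exact Or.inl ⟨i, hi, by rw [← e, op_unop]⟩
    · refine Or.inr ⟨h1, fun i hi => congrArg op (h2 i hi).eq.symm, fun hn => ?_⟩
      obtain ⟨g, hg, g', hg', e⟩ := h3 hn
      exact ⟨op g, hg, op g', hg', congrArg op e⟩

/-- A Hecke–Clifford algebra is generated by the first polynomial and Clifford generators together
with the `T_i`. -/
theorem IsHData.adjoin_eq_top {q : F} {x xi c : ℕ → A} (hd : IsHData q (n + 1) x xi c t)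
    (hG : Algebra.adjoin F (genSet (n + 1) x xi c t) = ⊤) :
    Algebra.adjoin F ({x 0, c 0} ∪ {z | ∃ i < n, z = t i}) = ⊤ := by
  set S := Algebra.adjoin F ({x 0, c 0} ∪ {z | ∃ i < n, z = t i}) with hS
  have ht : ∀ i < n, t i ∈ S := fun i hi => Algebra.subset_adjoin (Or.inr ⟨i, hi, rfl⟩)
  have hc : ∀ i ≤ n, c i ∈ S := by
    intro i
    induction i with
    | zero => exact fun _ => Algebra.subset_adjoin (by simp)
    | succ i ih =>
      intro hi
      have e : c (i + 1) = t i * c i * (t i - (q - q⁻¹) • 1) := by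
        rw [hd.tc i (by omega), mul_assoc, mul_sub, hd.quad i (by omega), mul_smul_comm, mul_one,
          add_sub_cancel_left, mul_one]
      rw [e]
      exact mul_mem (mul_mem (ht i hi) (ih (by omega)))
        (sub_mem (ht i hi) (S.smul_mem (one_mem _) _))
  have hx : ∀ i ≤ n, x i ∈ S := by
    intro i
    induction i with
    | zero => exact fun _ => Algebra.subset_adjoin (by simp)
    | succ i ih =>
      intro hi
      rw [← hd.cross i (by omega)]
      exact mul_mem (mul_mem (add_mem (ht i hi)
        (S.smul_mem (mul_mem (hc i (by omega)) (hc _ hi)) _)) (ih (by omega))) (ht i hi)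
  rw [eq_top_iff, ← hG, Algebra.adjoin_le_iff]
  rintro _ (⟨i, hi, rfl⟩ | ⟨i, hi, rfl⟩ | ⟨i, hi, rfl⟩ | ⟨i, hi, rfl⟩)
  · exact hx i (by omega)
  · have e : xi i = c i * x i * c i := by rw [hd.cx i hi, mul_assoc, hd.cc i hi, mul_one]
    rw [SetLike.mem_coe, e]
    exact mul_mem (mul_mem (hc i (by omega)) (hx i (by omega))) (hc i (by omega))
  · exact hc i (by omega)
  · exact ht i (by omega)

/-- The parabolic subalgebra fixing the first site. -/
def parabolic (F : Type) [Field F] {A : Type} [Ring A] [Algebra F A] (n : ℕ) (x xi c t : ℕ → A) :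
    Subalgebra F A :=
  Algebra.adjoin F ({z | ∃ i ≤ n, z = x i ∨ z = xi i ∨ z = c i} ∪
    {z | ∃ i, i + 1 < n ∧ z = t (i + 1)})

section Parabolic

variable {q : F} {x xi c : ℕ → A}

theorem x_mem_parabolic {i : ℕ} (hi : i ≤ n) : x i ∈ parabolic F n x xi c t :=
  Algebra.subset_adjoin (Or.inl ⟨i, hi, Or.inl rfl⟩)

theorem c_mem_parabolic {i : ℕ} (hi : i ≤ n) : c i ∈ parabolic F n x xi c t :=
  Algebra.subset_adjoin (Or.inl ⟨i, hi, Or.inr (Or.inr rfl)⟩)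

theorem t_mem_parabolic {i : ℕ} (hi : i + 1 < n) : t (i + 1) ∈ parabolic F n x xi c t :=
  Algebra.subset_adjoin (Or.inr ⟨i, hi, rfl⟩)

theorem IsHData.isBraided (hd : IsHData q (n + 1) x xi c t) : IsBraided (q - q⁻¹) n t where
  quad i hi := hd.quad i (by omega)
  far i j h hj := hd.far i j h (by omega)
  braid i hi := hd.braid i (by omega)

theorem IsHData.descend_span (hd : IsHData q (n + 1) x xi c t)
    (hG : Algebra.adjoin F (genSet (n + 1) x xi c t) = ⊤) :
    AddSubgroup.closure {z | ∃ k ≤ n, ∃ g ∈ parabolic F n x xi c t, z = descend t k * g} = ⊤ := by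
  refine hd.isBraided.descend_span _ (fun i hi => t_mem_parabolic hi) _ (hd.adjoin_eq_top hG) ?_
  rintro _ ((rfl | rfl) | ⟨i, hi, rfl⟩)
  · refine Or.inr ⟨x_mem_parabolic (Nat.zero_le n), fun i hi =>
      (hd.txo (i + 1) (by omega) 0 (by omega) (by omega) (by omega)).symm, fun hn => ?_⟩
    have e := T_mul_X_of_rel (hd.quad 0 (by omega)) (hd.tc 0 (by omega)) (hd.cross 0 (by omega))
      (hd.cc 0 (by omega)) (hd.cc 1 (by omega)) (hd.canti 1 (by omega) 0 (by omega) (by omega))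
    refine ⟨x 1, x_mem_parabolic hn, (q - q⁻¹) • (c 0 * c 1 * x 1) - (q - q⁻¹) • x 1, ?_, ?_⟩
    · exact sub_mem (Subalgebra.smul_mem _ (mul_mem (mul_mem (c_mem_parabolic (Nat.zero_le n))
        (c_mem_parabolic hn)) (x_mem_parabolic hn)) _)
        (Subalgebra.smul_mem _ (x_mem_parabolic hn) _)
    · rw [zero_add] at e
      rw [e]; abel
  · refine Or.inr ⟨c_mem_parabolic (Nat.zero_le n), fun i hi =>
      (hd.tco (i + 1) (by omega) 0 (by omega) (by omega) (by omega)).symm, fun hn => ?_⟩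
    have e := T_mul_C_of_rel (hd.quad 0 (by omega)) (hd.tc 0 (by omega))
    refine ⟨c 1, c_mem_parabolic hn, (q - q⁻¹) • c 0 - (q - q⁻¹) • c 1, ?_, ?_⟩
    · exact sub_mem (Subalgebra.smul_mem _ (c_mem_parabolic (Nat.zero_le n)) _)
        (Subalgebra.smul_mem _ (c_mem_parabolic hn) _)
    · rw [zero_add] at e
      rw [e]; abel
  · exact Or.inl ⟨i, hi, rfl⟩

theorem IsHData.ascend_span (hd : IsHData q (n + 1) x xi c t)
    (hG : Algebra.adjoin F (genSet (n + 1) x xi c t) = ⊤) :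
    AddSubgroup.closure {z | ∃ k ≤ n, ∃ g ∈ parabolic F n x xi c t, z = g * ascend t k} = ⊤ := by
  refine hd.isBraided.ascend_span _ (fun i hi => t_mem_parabolic hi) _ (hd.adjoin_eq_top hG) ?_
  rintro _ ((rfl | rfl) | ⟨i, hi, rfl⟩)
  · refine Or.inr ⟨x_mem_parabolic (Nat.zero_le n), fun i hi =>
      (hd.txo (i + 1) (by omega) 0 (by omega) (by omega) (by omega)).symm, fun hn => ?_⟩
    have e := X_mul_T_of_rel (hd.quad 0 (by omega)) (hd.cross 0 (by omega))
    refine ⟨x 1, x_mem_parabolic hn, -((q - q⁻¹) • x 1) - (q - q⁻¹) • (c 0 * c 1 * x 0), ?_, ?_⟩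
    · exact sub_mem (neg_mem (Subalgebra.smul_mem _ (x_mem_parabolic hn) _))
        (Subalgebra.smul_mem _ (mul_mem (mul_mem (c_mem_parabolic (Nat.zero_le n))
        (c_mem_parabolic hn)) (x_mem_parabolic (Nat.zero_le n))) _)
    · rw [zero_add] at e
      rw [e]; abel
  · refine Or.inr ⟨c_mem_parabolic (Nat.zero_le n), fun i hi =>
      (hd.tco (i + 1) (by omega) 0 (by omega) (by omega) (by omega)).symm, fun hn => ?_⟩
    exact ⟨c 1, c_mem_parabolic hn, 0, zero_mem _, by rw [hd.tc 0 (by omega), add_zero]⟩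
  · exact Or.inl ⟨i, hi, rfl⟩

end Parabolic


end Cosets

section Representation

variable {F}
variable {R : Type} [Ring R] [Algebra F R] {n : ℕ}

/-- The vector supported at the place `m`. -/
def coordSingle (F : Type) [Field F] {R : Type} [Ring R] [Algebra F R] {n m : ℕ} (hm : m ≤ n)
    (r : R) : coords F R n :=
  ⟨fun j => if j = m then r else 0, fun j hj => if_neg (by omega)⟩

theorem coordSingle_self {m : ℕ} (hm : m ≤ n) (r : R) : (coordSingle F hm r).1 m = r := if_pos rfl

theorem coordSingle_of_ne {m j : ℕ} (hm : m ≤ n) (r : R) (h : j ≠ m) :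
    (coordSingle F hm r).1 j = 0 := if_neg h

/-- The operator acts by `γ` on the `m`-th coordinate, and preserves the vectors supported there. -/
def IsDiagAt (m : ℕ) (γ : R) (T : Module.End F (coords F R n)) : Prop :=
  (∀ v, (T v).1 m = γ * v.1 m) ∧ ∀ v, (∀ j ≠ m, v.1 j = 0) → ∀ j ≠ m, (T v).1 j = 0

section IsDiagAt

variable {m : ℕ} {γ γ' : R} {T T' : Module.End F (coords F R n)}

theorem IsDiagAt.mul (h : IsDiagAt m γ T) (h' : IsDiagAt m γ' T') :
    IsDiagAt m (γ * γ') (T * T') :=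
  ⟨fun v => by rw [Module.End.mul_apply, h.1, h'.1, mul_assoc],
    fun v hv => h.2 _ (h'.2 v hv)⟩

theorem IsDiagAt.add (h : IsDiagAt m γ T) (h' : IsDiagAt m γ' T') :
    IsDiagAt m (γ + γ') (T + T') :=
  ⟨fun v => by rw [LinearMap.add_apply, Submodule.coe_add, Pi.add_apply, h.1, h'.1, add_mul],
    fun v hv j hj => by
      rw [LinearMap.add_apply, Submodule.coe_add, Pi.add_apply, h.2 v hv j hj, h'.2 v hv j hj,
        add_zero]⟩

theorem isDiagAt_algebraMap (m : ℕ) (r : F) :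
    IsDiagAt m (algebraMap F R r) (algebraMap F (Module.End F (coords F R n)) r) :=
  ⟨fun v => by rw [Module.algebraMap_end_apply, ← Algebra.smul_def]; rfl,
    fun v hv j hj => by
      rw [Module.algebraMap_end_apply, Submodule.coe_smul, Pi.smul_apply, hv j hj, smul_zero]⟩

theorem isDiagAt_diagOp (m : ℕ) (g : ℕ → R) : IsDiagAt m (g m) (diagOp F n g) :=
  ⟨fun v => diagOp_apply g v m, fun v hv j hj => by rw [diagOp_apply, hv j hj, mul_zero]⟩

variable {ξ : F} {t a N : ℕ → R}

theorem shuffleOp_eq_zero {i : ℕ} (hi : i < n) (hm : m ≠ i) (hm' : m ≠ i + 1)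
    (v : coords F R n) (hv : ∀ j ≠ m, v.1 j = 0) {j : ℕ} (hj : j ≠ m) :
    (shuffleOp F n ξ t a N i v).1 j = 0 := by
  rcases le_or_gt j n with hjn | hjn
  · rcases four_cases i j with h | rfl | rfl | h
    · rw [shuffleOp_of_lt hjn h, hv j hj, mul_zero]
    · rw [shuffleOp_self hjn, hv j hj, hv _ hm'.symm, mul_zero, add_zero]
    · rw [shuffleOp_succ hjn, hv _ hj, hv i hm.symm, mul_zero, mul_zero, add_zero]
    · rw [shuffleOp_of_gt hjn h, hv j hj, mul_zero]
  · exact (shuffleOp F n ξ t a N i v).2 j hjn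

theorem isDiagAt_shuffleOp_of_lt {i : ℕ} (hi : i < n) (hm : m < i) :
    IsDiagAt m (t (i - 1)) (shuffleOp F n ξ t a N i) :=
  ⟨fun v => shuffleOp_of_lt (by omega) hm v,
    fun v hv j hj => shuffleOp_eq_zero hi (by omega) (by omega) v hv hj⟩

theorem isDiagAt_shuffleOp_of_gt {i : ℕ} (hm : m ≤ n) (hi : i + 1 < m) :
    IsDiagAt m (t i) (shuffleOp F n ξ t a N i) :=
  ⟨fun v => shuffleOp_of_gt hm hi v,
    fun v hv j hj => shuffleOp_eq_zero (by omega) (by omega) (by omega) v hv hj⟩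

end IsDiagAt

variable {ξ : F} {t a N : ℕ → R}

theorem ascend_shuffleOp_apply_zero {k : ℕ} (hk : k ≤ n) (v : coords F R n)
    (hv : ∀ j < k, v.1 j = 0) :
    (ascend (shuffleOp F n ξ t a N) k v).1 0 = v.1 k := by
  induction k generalizing v with
  | zero => rfl
  | succ k ih =>
    rw [ascend, Module.End.mul_apply, ih (by omega), shuffleOp_self (by omega),
      hv k (lt_add_one k), mul_zero, zero_add]
    intro j hj
    rw [shuffleOp_of_lt (by omega) hj, hv j (by omega), mul_zero]

theorem descend_shuffleOp_apply {k : ℕ} (hk : k ≤ n) (v : coords F R n)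
    (hv : ∀ j ≠ 0, v.1 j = 0) :
    (descend (shuffleOp F n ξ t a N) k v).1 k = descend N k * v.1 0 ∧
      ∀ j, k < j → (descend (shuffleOp F n ξ t a N) k v).1 j = 0 := by
  induction k with
  | zero => exact ⟨(one_mul _).symm, fun j hj => hv j hj.ne'⟩
  | succ k ih =>
    obtain ⟨h1, h2⟩ := ih (by omega)
    refine ⟨?_, fun j hj => ?_⟩
    · rw [descend, Module.End.mul_apply, shuffleOp_succ hk, h1, h2 _ (lt_add_one k), mul_zero,
        zero_add, descend, mul_assoc]
    · rcases le_or_gt j n with hjn | hjn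
      · rw [descend, Module.End.mul_apply, shuffleOp_of_gt hjn hj, h2 j (by omega), mul_zero]
      · exact Subtype.property (descend (shuffleOp F n ξ t a N) (k + 1) v) j hjn

/-- Right multiplication by a scalar. -/
def rightOp (F : Type) [Field F] {R : Type} [Ring R] [Algebra F R] (n : ℕ) (r : R) :
    Module.End F (coords F R n) where
  toFun v := ⟨fun j => v.1 j * r, fun j hj => by simp only [v.2 j hj, zero_mul]⟩
  map_add' v w := by ext j; exact add_mul _ _ _
  map_smul' a v := by ext j; exact smul_mul_assoc _ _ _

theorem rightOp_apply (r : R) (v : coords F R n) (j : ℕ) :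
    (rightOp F n r v).1 j = v.1 j * r := rfl

theorem commute_rightOp_diagOp (r : R) (g : ℕ → R) : Commute (diagOp F n g) (rightOp F n r) :=
  LinearMap.ext fun v => Subtype.ext (funext fun j => (mul_assoc (g j) (v.1 j) r).symm)

theorem commute_rightOp_shuffleOp (r : R) (i : ℕ) :
    Commute (shuffleOp F n ξ t a N i) (rightOp F n r) := by
  refine LinearMap.ext fun v => coords_ext fun j hj => ?_
  simp only [Module.End.mul_apply]
  rw [rightOp_apply]
  rcases four_cases i j with h | rfl | rfl | h
  · simp only [shuffleOp_of_lt hj h, rightOp_apply, mul_assoc]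
  · simp only [shuffleOp_self hj, rightOp_apply, mul_assoc, add_mul]
  · simp only [shuffleOp_succ hj, rightOp_apply, mul_assoc, add_mul]
  · simp only [shuffleOp_of_gt hj h, rightOp_apply, mul_assoc]

end Representation

section ShuffleRep

variable {F}

variable {R : Type} [Ring R] [Algebra F R] {n : ℕ}
variable {q : F} {x xi c t a N : ℕ → R} {X Xi C : R}

/-- The representation of `H_{n+1}` on the vectors with `n + 1` coordinates. -/
noncomputable def shuffleRep (hs : IsSite q n x xi c t X Xi C) (ha : IsCoeff q n x c t X C a N) :
    H F q (n + 1) →ₐ[F] Module.End F (coords F R n) :=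
  (isHData_shuffle hs ha).lift

variable (hs : IsSite q n x xi c t X Xi C) (ha : IsCoeff q n x c t X C a N)

theorem shuffleRep_Xn {l : ℕ} (hl : l ≤ n) :
    shuffleRep hs ha (Xn F q (n + 1) l) = diagOp F n (siteAct x X l) :=
  (isHData_shuffle hs ha).lift_Xn (by omega)

theorem shuffleRep_Xin {l : ℕ} (hl : l ≤ n) :
    shuffleRep hs ha (Xin F q (n + 1) l) = diagOp F n (siteAct xi Xi l) :=
  (isHData_shuffle hs ha).lift_Xin (by omega)

theorem shuffleRep_Cn {l : ℕ} (hl : l ≤ n) :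
    shuffleRep hs ha (Cn F q (n + 1) l) = diagOp F n (siteAct c C l) :=
  (isHData_shuffle hs ha).lift_Cn (by omega)

theorem shuffleRep_Tn {i : ℕ} (hi : i < n) :
    shuffleRep hs ha (Tn F q (n + 1) i) = shuffleOp F n (q - q⁻¹) t a N i :=
  (isHData_shuffle hs ha).lift_Tn (by omega)

theorem shuffleRep_ascend {k : ℕ} (hk : k ≤ n) : shuffleRep hs ha (ascend (Tn F q (n + 1)) k) =
    ascend (shuffleOp F n (q - q⁻¹) t a N) k := by
  induction k with
  | zero => exact map_one _
  | succ k ih => rw [ascend, map_mul, ih (by omega), shuffleRep_Tn hs ha hk, ascend]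

theorem shuffleRep_descend {k : ℕ} (hk : k ≤ n) : shuffleRep hs ha (descend (Tn F q (n + 1)) k) =
    descend (shuffleOp F n (q - q⁻¹) t a N) k := by
  induction k with
  | zero => exact map_one _
  | succ k ih => rw [descend, map_mul, ih (by omega), shuffleRep_Tn hs ha hk, descend]

theorem commute_shuffleRep_rightOp (h : H F q (n + 1)) (r : R) :
    Commute (shuffleRep hs ha h) (rightOp F n r) := by
  have hh : h ∈ Algebra.adjoin F (genSet (n + 1) (Xn F q (n + 1)) (Xin F q (n + 1))
      (Cn F q (n + 1)) (Tn F q (n + 1))) := by rw [adjoin_genSet_H]; trivial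
  induction hh using Algebra.adjoin_induction with
  | mem g hg =>
    rcases hg with ⟨i, hi, rfl⟩ | ⟨i, hi, rfl⟩ | ⟨i, hi, rfl⟩ | ⟨i, hi, rfl⟩
    · rw [shuffleRep_Xn hs ha (by omega)]; exact commute_rightOp_diagOp r _
    · rw [shuffleRep_Xin hs ha (by omega)]; exact commute_rightOp_diagOp r _
    · rw [shuffleRep_Cn hs ha (by omega)]; exact commute_rightOp_diagOp r _
    · rw [shuffleRep_Tn hs ha (by omega)]; exact commute_rightOp_shuffleOp r i
  | algebraMap r' => rw [AlgHom.commutes]; exact Algebra.commute_algebraMap_left _ _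
  | add u v _ _ hu hv => rw [map_add]; exact hu.add_left hv
  | mul u v _ _ hu hv => rw [map_mul]; exact hu.mul_left hv

/-- The canonical morphism `H_n → H_{n+1}`. -/
noncomputable def affEmb (F : Type) [Field F] (q : F) (n : ℕ) : H F q n →ₐ[F] H F q (n + 1) :=
  ((isHData_H F q (n + 1)).mono n.le_succ).lift

theorem isDiagAt_affEmb (h : H F q n) :
    IsDiagAt n (hs.hd.lift h) (shuffleRep hs ha (affEmb F q n h)) := by
  have hh : h ∈ Algebra.adjoin F (genSet n (Xn F q n) (Xin F q n)
      (Cn F q n) (Tn F q n)) := by rw [adjoin_genSet_H]; trivial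
  have he := (isHData_H F q (n + 1)).mono n.le_succ
  induction hh using Algebra.adjoin_induction with
  | mem g hg =>
    rcases hg with ⟨i, hi, rfl⟩ | ⟨i, hi, rfl⟩ | ⟨i, hi, rfl⟩ | ⟨i, hi, rfl⟩
    · rw [affEmb, he.lift_Xn hi, shuffleRep_Xn hs ha (by omega), hs.hd.lift_Xn hi,
        ← siteAct_of_lt x X hi]
      exact isDiagAt_diagOp n _
    · rw [affEmb, he.lift_Xin hi, shuffleRep_Xin hs ha (by omega), hs.hd.lift_Xin hi,
        ← siteAct_of_lt xi Xi hi]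
      exact isDiagAt_diagOp n _
    · rw [affEmb, he.lift_Cn hi, shuffleRep_Cn hs ha (by omega), hs.hd.lift_Cn hi,
        ← siteAct_of_lt c C hi]
      exact isDiagAt_diagOp n _
    · rw [affEmb, he.lift_Tn hi, shuffleRep_Tn hs ha (by omega), hs.hd.lift_Tn hi]
      exact isDiagAt_shuffleOp_of_gt le_rfl hi
  | algebraMap r' =>
      rw [AlgHom.commutes, AlgHom.commutes, AlgHom.commutes]; exact isDiagAt_algebraMap n r'
  | add u v _ _ hu hv => rw [map_add, map_add, map_add]; exact hu.add hv
  | mul u v _ _ hu hv => rw [map_mul, map_mul, map_mul]; exact hu.mul hv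

/-- The subalgebra `S` contains all coefficients of the first site, and `f` skew commutes with
them. -/
structure IsSkew (n : ℕ) (x xi c t : ℕ → R) (X Xi C : R) (S : Subalgebra F R) (f : R) : Prop where
  x_mem : ∀ i < n, x i ∈ S
  xi_mem : ∀ i < n, xi i ∈ S
  c_mem : ∀ i < n, c i ∈ S
  t_mem : ∀ i, i + 1 < n → t i ∈ S
  X_mem : X ∈ S
  Xi_mem : Xi ∈ S
  C_mem : C ∈ S
  x_f : ∀ i < n, Commute (x i) f
  xi_f : ∀ i < n, Commute (xi i) f
  c_f : ∀ i < n, Commute (c i) f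
  t_f : ∀ i, i + 1 < n → Commute (t i) f
  X_f : Commute X f
  Xi_f : Commute Xi f
  C_f : ∃ s ∈ S, C * f = f * s

variable {S : Subalgebra F R} {f : R}

theorem exists_isDiagAt_of_mem_parabolic (hf : IsSkew n x xi c t X Xi C S f) {g : H F q (n + 1)}
    (hg : g ∈ parabolic F n (Xn F q (n + 1)) (Xin F q (n + 1)) (Cn F q (n + 1)) (Tn F q (n + 1))) :
    ∃ γ ∈ S, ∃ γ' ∈ S, γ * f = f * γ' ∧ IsDiagAt 0 γ (shuffleRep hs ha g) := by
  rw [parabolic] at hg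
  induction hg using Algebra.adjoin_induction with
  | mem g hg =>
    rcases hg with ⟨i, hi, rfl | rfl | rfl⟩ | ⟨i, hi, rfl⟩
    · rw [shuffleRep_Xn hs ha hi]
      suffices h : siteAct x X i 0 ∈ S ∧ Commute (siteAct x X i 0) f from
        ⟨_, h.1, _, h.1, h.2, isDiagAt_diagOp 0 _⟩
      rcases Nat.eq_zero_or_pos i with rfl | h0
      · rw [siteAct_of_eq _ _ rfl]; exact ⟨hf.X_mem, hf.X_f⟩
      · rw [siteAct_of_gt _ _ h0]; exact ⟨hf.x_mem _ (by omega), hf.x_f _ (by omega)⟩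
    · rw [shuffleRep_Xin hs ha hi]
      suffices h : siteAct xi Xi i 0 ∈ S ∧ Commute (siteAct xi Xi i 0) f from
        ⟨_, h.1, _, h.1, h.2, isDiagAt_diagOp 0 _⟩
      rcases Nat.eq_zero_or_pos i with rfl | h0
      · rw [siteAct_of_eq _ _ rfl]; exact ⟨hf.Xi_mem, hf.Xi_f⟩
      · rw [siteAct_of_gt _ _ h0]; exact ⟨hf.xi_mem _ (by omega), hf.xi_f _ (by omega)⟩
    · rw [shuffleRep_Cn hs ha hi]
      suffices h : siteAct c C i 0 ∈ S ∧ ∃ s ∈ S, siteAct c C i 0 * f = f * s by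
        obtain ⟨h1, s, h2, h3⟩ := h
        exact ⟨_, h1, s, h2, h3, isDiagAt_diagOp 0 _⟩
      rcases Nat.eq_zero_or_pos i with rfl | h0
      · rw [siteAct_of_eq _ _ rfl]; exact ⟨hf.C_mem, hf.C_f⟩
      · rw [siteAct_of_gt _ _ h0]
        exact ⟨hf.c_mem _ (by omega), _, hf.c_mem _ (by omega), hf.c_f _ (by omega)⟩
    · rw [shuffleRep_Tn hs ha hi]
      exact ⟨t i, hf.t_mem i hi, t i, hf.t_mem i hi, hf.t_f i hi,
        isDiagAt_shuffleOp_of_lt hi (Nat.succ_pos i)⟩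
  | algebraMap r =>
    rw [AlgHom.commutes]
    exact ⟨_, S.algebraMap_mem r, _, S.algebraMap_mem r, Algebra.commutes r f,
      isDiagAt_algebraMap 0 r⟩
  | add u v _ _ hu hv =>
    obtain ⟨γ, h1, γ', h2, h3, h4⟩ := hu
    obtain ⟨δ, k1, δ', k2, k3, k4⟩ := hv
    rw [map_add]
    exact ⟨_, add_mem h1 k1, _, add_mem h2 k2, by rw [add_mul, mul_add, h3, k3], h4.add k4⟩
  | mul u v _ _ hu hv =>
    obtain ⟨γ, h1, γ', h2, h3, h4⟩ := hu
    obtain ⟨δ, k1, δ', k2, k3, k4⟩ := hv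
    rw [map_mul]
    exact ⟨_, mul_mem h1 k1, _, mul_mem h2 k2,
      by rw [mul_assoc, k3, ← mul_assoc, h3, mul_assoc], h4.mul k4⟩

theorem shuffleRep_apply_zero_mem (hf : IsSkew n x xi c t X Xi C S f) (h : H F q (n + 1)) :
    (shuffleRep hs ha h (coordSingle F le_rfl 1)).1 0 ∈ S := by
  have hh : h ∈ (⊤ : AddSubgroup (H F q (n + 1))) := trivial
  rw [← (isHData_H F q (n + 1)).ascend_span (adjoin_genSet_H F q (n + 1))] at hh
  induction hh using AddSubgroup.closure_induction with
  | mem h hh =>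
    obtain ⟨k, hk, g, hg, rfl⟩ := hh
    obtain ⟨γ, h1, -, -, -, h4⟩ := exists_isDiagAt_of_mem_parabolic hs ha hf hg
    rw [map_mul, Module.End.mul_apply, h4.1]
    refine mul_mem h1 ?_
    rw [shuffleRep_ascend hs ha hk,
      ascend_shuffleOp_apply_zero hk]
    · by_cases h : k = n
      · subst h; rw [coordSingle_self]; exact one_mem S
      · rw [coordSingle_of_ne _ _ h]; exact zero_mem S
    · exact fun j hj => coordSingle_of_ne _ _ (by omega)
  | zero => rw [map_zero]; exact zero_mem S
  | add u v _ _ hu hv => rw [map_add]; exact add_mem hu hv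
  | neg u _ hu => rw [map_neg]; exact neg_mem hu

theorem exists_shuffleRep_apply_last (hf : IsSkew n x xi c t X Xi C S f) (h : H F q (n + 1))
    {s : R} (hs' : s ∈ S) :
    ∃ s' ∈ S, (shuffleRep hs ha h (coordSingle F (Nat.zero_le n) (f * s))).1 n =
      descend N n * (f * s') := by
  have hh : h ∈ (⊤ : AddSubgroup (H F q (n + 1))) := trivial
  rw [← (isHData_H F q (n + 1)).descend_span (adjoin_genSet_H F q (n + 1))] at hh
  induction hh using AddSubgroup.closure_induction with
  | mem h hh =>
    obtain ⟨k, hk, g, hg, rfl⟩ := hh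
    obtain ⟨γ, h1, γ', h2, h3, h4⟩ := exists_isDiagAt_of_mem_parabolic hs ha hf hg
    rw [map_mul, Module.End.mul_apply,
      shuffleRep_descend hs ha hk]
    obtain ⟨k1, k2⟩ := descend_shuffleOp_apply (ξ := q - q⁻¹) (t := t) (a := a) (N := N) hk
      (shuffleRep hs ha g (coordSingle F (Nat.zero_le n) (f * s)))
      (h4.2 _ fun j hj => coordSingle_of_ne _ _ hj)
    rcases hk.lt_or_eq with h | rfl
    · exact ⟨0, zero_mem S, by rw [k2 n h, mul_zero, mul_zero]⟩
    · refine ⟨γ' * s, mul_mem h2 hs', ?_⟩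
      rw [k1, h4.1, coordSingle_self, ← mul_assoc γ, h3, mul_assoc]
  | zero => exact ⟨0, zero_mem S, by rw [map_zero, mul_zero, mul_zero]; rfl⟩
  | add u v _ _ hu hv =>
    obtain ⟨u', h1, h2⟩ := hu
    obtain ⟨v', k1, k2⟩ := hv
    refine ⟨u' + v', add_mem h1 k1, ?_⟩
    rw [map_add, LinearMap.add_apply, Submodule.coe_add, Pi.add_apply, h2, k2, mul_add, mul_add]
  | neg u _ hu =>
    obtain ⟨u', h1, h2⟩ := hu
    refine ⟨-u', neg_mem h1, ?_⟩
    rw [map_neg, LinearMap.neg_apply, Submodule.coe_neg, Pi.neg_apply, h2, mul_neg, mul_neg]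

theorem diagOp_pow_apply (g : ℕ → R) (k : ℕ) (v : coords F R n) (j : ℕ) :
    ((diagOp F n g ^ k) v).1 j = g j ^ k * v.1 j := by
  induction k with
  | zero => rw [pow_zero, pow_zero, one_mul]; rfl
  | succ k ih => rw [pow_succ', Module.End.mul_apply, diagOp_apply, ih, pow_succ', mul_assoc]

theorem shuffleRep_felem {d : ℕ} {aa : ℕ → F}
    (hr : 0 < n → ∑ i ∈ Finset.range (d + 1), aa i • x 0 ^ i = 0) (v : coords F R n) :
    shuffleRep hs ha (felem F q (n + 1) d aa) v =
      coordSingle F (Nat.zero_le n) ((∑ i ∈ Finset.range (d + 1), aa i • X ^ i) * v.1 0) := by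
  have e : shuffleRep hs ha (felem F q (n + 1) d aa) =
      ∑ i ∈ Finset.range (d + 1), aa i • diagOp F n (siteAct x X 0) ^ i := by
    rw [felem, dif_pos n.succ_pos, map_sum]
    refine Finset.sum_congr rfl fun i _ => ?_
    rw [map_smul, map_pow, ← shuffleRep_Xn hs ha (Nat.zero_le n), Xn, dif_pos n.succ_pos]
  refine coords_ext fun j hj => ?_
  have e2 : (shuffleRep hs ha (felem F q (n + 1) d aa) v).1 j =
      (∑ i ∈ Finset.range (d + 1), aa i • siteAct x X 0 j ^ i) * v.1 j := by
    rw [e, LinearMap.sum_apply, AddSubmonoidClass.coe_finsetSum, Finset.sum_apply, Finset.sum_mul]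
    refine Finset.sum_congr rfl fun i _ => ?_
    rw [LinearMap.smul_apply, Submodule.coe_smul, Pi.smul_apply, diagOp_pow_apply, smul_mul_assoc]
  rw [e2]
  rcases Nat.eq_zero_or_pos j with rfl | h
  · rw [siteAct_of_eq _ _ rfl, coordSingle_self]
  · rw [siteAct_of_lt _ _ h, hr (by omega), zero_mul, coordSingle_of_ne _ _ h.ne']

theorem exists_shuffleRep_ideal {d : ℕ} {aa : ℕ → F}
    (hr : 0 < n → ∑ i ∈ Finset.range (d + 1), aa i • x 0 ^ i = 0)
    (hf : IsSkew n x xi c t X Xi C S (∑ i ∈ Finset.range (d + 1), aa i • X ^ i))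
    (u v : H F q (n + 1)) :
    ∃ s ∈ S, (shuffleRep hs ha (u * felem F q (n + 1) d aa * v) (coordSingle F le_rfl 1)).1 n =
      descend N n * ((∑ i ∈ Finset.range (d + 1), aa i • X ^ i) * s) := by
  rw [map_mul, map_mul, Module.End.mul_apply, Module.End.mul_apply, shuffleRep_felem hs ha hr]
  exact exists_shuffleRep_apply_last hs ha hf u (shuffleRep_apply_zero_mem hs ha hf v)

end ShuffleRep

section Descent

variable {F}
variable {q : F} {n d : ℕ} {aa : ℕ → F}

/-- A functional vanishing on a two-sided ideal is constant on the classes of a congruence. -/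
theorem exists_ringCon {A B : Type} [Ring A] [Algebra F A] [AddCommGroup B] [Module F B]
    (θ : A →ₗ[F] B) (f : A) (h : ∀ u v, θ (u * f * v) = 0) :
    ∃ r : RingCon A, r f 0 ∧ ∀ b b', r b b' → θ b = θ b' := by
  let r : RingCon A :=
    { r := fun a b => ∀ u v, θ (u * (a - b) * v) = 0
      iseqv :=
        { refl := fun a u v => by rw [sub_self, mul_zero, zero_mul, map_zero]
          symm := fun {a b} hab u v => by
            rw [← neg_sub, mul_neg, neg_mul, map_neg, hab u v, neg_zero]
          trans := fun {a b c} hab hbc u v => by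
            rw [← sub_add_sub_cancel a b c, mul_add, add_mul, map_add, hab, hbc, add_zero] }
      add' := fun {a b c e} hab hce u v => by
        rw [add_sub_add_comm, mul_add, add_mul, map_add, hab, hce, add_zero]
      mul' := fun {a b c e} hab hce u v => by
        have e1 : u * (a * c - b * e) * v = u * (a - b) * (c * v) + u * b * (c - e) * v := by
          noncomm_ring
        rw [e1, map_add, hab, hce, add_zero] }
  refine ⟨r, fun u v => by rw [sub_zero]; exact h u v, fun b b' e => ?_⟩
  have e' := e 1 1
  rw [one_mul, mul_one, map_sub] at e'
  exact sub_eq_zero.1 e'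

theorem exists_descent {B : Type} [AddCommGroup B] [Module F B] (θ : H F q n →ₗ[F] B)
    (h : ∀ u v, θ (u * felem F q n d aa * v) = 0) :
    ∃ θ' : CycAlg F q n d aa →ₗ[F] B, ∀ b, θ' (cycHom F q n d aa b) = θ b := by
  obtain ⟨r, hr, hr'⟩ := exists_ringCon θ (felem F q n d aa) h
  let φ : CycAlg F q n d aa →ₐ[F] r.Quotient := RingQuot.liftAlgHom F ⟨r.mkₐ F, by
    rintro _ _ ⟨⟩
    exact (RingCon.eq r).2 hr⟩
  have hφ : ∀ b, φ (cycHom F q n d aa b) = r.mkₐ F b := fun b =>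
    RingQuot.liftAlgHom_mkAlgHom_apply ..
  have hker : ∀ b b', cycHom F q n d aa b = cycHom F q n d aa b' → θ b = θ b' := fun b b' e =>
    hr' _ _ ((RingCon.eq r).1 ((hφ b).symm.trans ((congrArg φ e).trans (hφ b'))))
  obtain ⟨s, hs⟩ := LinearMap.exists_rightInverse_of_surjective (cycHom F q n d aa).toLinearMap
    (LinearMap.range_eq_top.2 (cycHom_surjective F q n d aa))
  exact ⟨θ ∘ₗ s, fun b => hker _ _ (LinearMap.congr_fun hs _)⟩

end Descent

section Functional

variable {F}
variable {q : F} {n d : ℕ} {aa : ℕ → F}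

theorem cycEmb_cycHom (h : H F q n) :
    cycEmb F q n d aa (cycHom F q n d aa h) = cycHom F q (n + 1) d aa (affEmb F q n h) := by
  have hh : h ∈ Algebra.adjoin F (genSet n (Xn F q n) (Xin F q n)
      (Cn F q n) (Tn F q n)) := by rw [adjoin_genSet_H]; trivial
  have he := (isHData_H F q (n + 1)).mono n.le_succ
  induction hh using Algebra.adjoin_induction with
  | mem g hg =>
    rcases hg with ⟨i, hi, rfl⟩ | ⟨i, hi, rfl⟩ | ⟨i, hi, rfl⟩ | ⟨i, hi, rfl⟩
    · rw [affEmb, he.lift_Xn hi]; exact cycEmb_xf F q d aa hi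
    · rw [affEmb, he.lift_Xin hi]; exact cycEmb_xif F q d aa hi
    · rw [affEmb, he.lift_Cn hi]; exact cycEmb_cf F q d aa hi
    · rw [affEmb, he.lift_Tn hi]; exact cycEmb_tf F q d aa hi
  | algebraMap r => simp only [AlgHom.commutes]
  | add u v _ _ hu hv => simp only [map_add, hu, hv]
  | mul u v _ _ hu hv => simp only [map_mul, hu, hv]

variable {R : Type} [Ring R] [Algebra F R]

/-- Restriction of the last coordinate of the shuffle representation. -/
theorem exists_cyc_functional (β : CycAlg F q n d aa →ₐ[F] R) {X Xi C : R} {a N : ℕ → R}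
    (hs : IsSite q n (fun i => β (xf F q n d aa i)) (fun i => β (xif F q n d aa i))
      (fun i => β (cf F q n d aa i)) (fun i => β (tf F q n d aa i)) X Xi C)
    (ha : IsCoeff q n (fun i => β (xf F q n d aa i)) (fun i => β (cf F q n d aa i))
      (fun i => β (tf F q n d aa i)) X C a N) {S : Subalgebra F R}
    (hf : IsSkew n (fun i => β (xf F q n d aa i)) (fun i => β (xif F q n d aa i))
      (fun i => β (cf F q n d aa i)) (fun i => β (tf F q n d aa i)) X Xi C S
      (∑ i ∈ Finset.range (d + 1), aa i • X ^ i))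
    (μ : R →ₗ[F] CycAlg F q n d aa) (hμ : IsBimoduleMap β μ) (hμS : ∀ s ∈ S, μ s = 0)
    {w : R} (hw : w * (descend N n * ∑ i ∈ Finset.range (d + 1), aa i • X ^ i) = 1)
    (hwβ : ∀ b, Commute w (β b)) :
    ∃ θ : CycAlg F q (n + 1) d aa →ₗ[F] CycAlg F q n d aa, IsBimoduleMap (cycEmb F q n d aa) θ ∧
      (∀ k, θ (xf F q (n + 1) d aa n ^ k) = μ (w * X ^ k)) ∧
      (∀ k, θ (xf F q (n + 1) d aa n ^ k * cf F q (n + 1) d aa n) = μ (w * (X ^ k * C))) ∧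
      (∀ k, θ (cf F q (n + 1) d aa n * xf F q (n + 1) d aa n ^ k) = μ (w * (C * X ^ k))) ∧
      ∀ m, n = m + 1 → θ (tf F q (n + 1) d aa m) = μ (w * a m) := by
  have hβ : ∀ h, hs.hd.lift h = β (cycHom F q n d aa h) := by
    intro h
    have hh : h ∈ Algebra.adjoin F (genSet n (Xn F q n) (Xin F q n)
        (Cn F q n) (Tn F q n)) := by rw [adjoin_genSet_H]; trivial
    induction hh using Algebra.adjoin_induction with
    | mem g hg =>
      rcases hg with ⟨i, hi, rfl⟩ | ⟨i, hi, rfl⟩ | ⟨i, hi, rfl⟩ | ⟨i, hi, rfl⟩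
      · rw [hs.hd.lift_Xn hi]; rfl
      · rw [hs.hd.lift_Xin hi]; rfl
      · rw [hs.hd.lift_Cn hi]; rfl
      · rw [hs.hd.lift_Tn hi]; rfl
    | algebraMap r => simp only [AlgHom.commutes]
    | add u v _ _ hu hv => simp only [map_add, hu, hv]
    | mul u v _ _ hu hv => simp only [map_mul, hu, hv]
  let e : coords F R n := coordSingle F le_rfl 1
  let θ₀ : H F q (n + 1) →ₗ[F] CycAlg F q n d aa :=
    { toFun := fun h => μ (w * (shuffleRep hs ha h e).1 n)
      map_add' := fun h h' => by
        rw [map_add, LinearMap.add_apply, Submodule.coe_add, Pi.add_apply, mul_add, map_add]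
      map_smul' := fun r h => by
        rw [map_smul, LinearMap.smul_apply, Submodule.coe_smul, Pi.smul_apply, mul_smul_comm,
          map_smul, RingHom.id_apply] }
  have hθ₀ : ∀ h, θ₀ h = μ (w * (shuffleRep hs ha h e).1 n) := fun _ => rfl
  have hr : 0 < n → ∑ i ∈ Finset.range (d + 1), aa i • β (xf F q n d aa 0) ^ i = 0 := by
    intro hn
    rw [← map_zero β, ← root_CycAlg F q n d aa hn, map_sum]
    exact Finset.sum_congr rfl fun i _ => by rw [map_smul, map_pow]
  obtain ⟨θ, hθ⟩ := exists_descent (d := d) (aa := aa) θ₀ (fun u v => by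
    obtain ⟨s, hsS, e1⟩ := exists_shuffleRep_ideal hs ha hr hf u v
    rw [hθ₀, e1, ← mul_assoc (descend N n), ← mul_assoc, hw, one_mul, hμS s hsS])
  have e_n : e.1 n = 1 := coordSingle_self _ _
  have right_e : ∀ r, rightOp F n r e = coordSingle F le_rfl r := fun r =>
    coords_ext fun j hj => by
      rw [rightOp_apply]
      by_cases h : j = n
      · subst h; rw [e_n, one_mul, coordSingle_self]
      · rw [coordSingle_of_ne _ _ h, coordSingle_of_ne _ _ h, zero_mul]
  have hX : ∀ k (v : coords F R n), (shuffleRep hs ha (Xn F q (n + 1) n ^ k) v).1 n =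
      X ^ k * v.1 n := by
    intro k v
    rw [map_pow, shuffleRep_Xn hs ha le_rfl, diagOp_pow_apply, siteAct_of_eq _ _ rfl]
  have hC : ∀ v : coords F R n, (shuffleRep hs ha (Cn F q (n + 1) n) v).1 n = C * v.1 n := by
    intro v
    rw [shuffleRep_Cn hs ha le_rfl, diagOp_apply, siteAct_of_eq _ _ rfl]
  refine ⟨θ, ⟨fun b y => ?_, fun y b => ?_⟩, fun k => ?_, fun k => ?_, fun k => ?_, ?_⟩
  · obtain ⟨h, rfl⟩ := cycHom_surjective F q n d aa b
    obtain ⟨y, rfl⟩ := cycHom_surjective F q (n + 1) d aa y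
    rw [cycEmb_cycHom, ← map_mul, hθ, hθ, hθ₀, hθ₀, map_mul (shuffleRep hs ha),
      Module.End.mul_apply,
      (isDiagAt_affEmb hs ha h).1, hβ, ← mul_assoc, (hwβ _).eq, mul_assoc, hμ.left]
  · obtain ⟨h, rfl⟩ := cycHom_surjective F q n d aa b
    obtain ⟨y, rfl⟩ := cycHom_surjective F q (n + 1) d aa y
    have e2 : shuffleRep hs ha (affEmb F q n h) e = rightOp F n (β (cycHom F q n d aa h)) e := by
      refine coords_ext fun j hj => ?_
      rw [right_e]
      by_cases h' : j = n
      · subst h'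
        rw [(isDiagAt_affEmb hs ha h).1, hβ, e_n, mul_one, coordSingle_self]
      · rw [(isDiagAt_affEmb hs ha h).2 _ (fun j hj => coordSingle_of_ne _ _ hj) j h',
          coordSingle_of_ne _ _ h']
    rw [cycEmb_cycHom, ← map_mul, hθ, hθ, hθ₀, hθ₀, map_mul (shuffleRep hs ha),
      Module.End.mul_apply, e2,
      ← Module.End.mul_apply, (commute_shuffleRep_rightOp hs ha y _).eq, Module.End.mul_apply,
      rightOp_apply, ← mul_assoc, hμ.right]
  · rw [xf, ← map_pow, hθ, hθ₀, hX, e_n, mul_one]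
  · rw [xf, cf, ← map_pow, ← map_mul, hθ, hθ₀, map_mul (shuffleRep hs ha), Module.End.mul_apply,
      hX, hC, e_n, mul_one]
  · rw [xf, cf, ← map_pow, ← map_mul, hθ, hθ₀, map_mul (shuffleRep hs ha), Module.End.mul_apply,
      hC, hX, e_n, mul_one]
  · rintro m rfl
    rw [tf, hθ, hθ₀, shuffleRep_Tn hs ha (lt_add_one m), shuffleOp_succ le_rfl, e_n, mul_one,
      show e.1 m = 0 from coordSingle_of_ne _ _ (by omega), mul_zero, add_zero]

end Functional

section Laurent

variable {F} {B L : Type} [Ring B] [Algebra F B] [Ring L] [Algebra F L]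

/-- The properties of the ring of formal Laurent series over `B` in a central variable `X` that
are used below: `κ` extracts the constant coefficient and `L₀` is the subring of power series. -/
structure IsLaurent (ι : B →ₐ[F] L) (X Xi : L) (κ : L →ₗ[F] B) (L₀ : Subalgebra F L) : Prop where
  X_Xi : X * Xi = 1
  Xi_X : Xi * X = 1
  X_comm : ∀ y, Commute X y
  bim : IsBimoduleMap ι κ
  coeff_pow : ∀ k l, κ (X ^ k * Xi ^ l) = if k = l then 1 else 0
  ι_mem : ∀ b, ι b ∈ L₀
  X_mem : X ∈ L₀
  coeff_X_mul : ∀ y ∈ L₀, κ (X * y) = 0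
  exists_inv : ∀ y ∈ L₀, ∃ v ∈ L₀, (1 + X * y) * v = 1

theorem exists_isLaurent (F B : Type) [Field F] [Ring B] [Algebra F B] :
    ∃ (L : Type) (_ : Ring L) (_ : Algebra F L) (ι : B →ₐ[F] L) (X Xi : L) (κ : L →ₗ[F] B)
      (L₀ : Subalgebra F L), IsLaurent ι X Xi κ L₀ := by
  let ι : B →ₐ[F] HahnSeries ℤ B :=
    { (HahnSeries.C : B →+* HahnSeries ℤ B) with
      commutes' := fun r => (HahnSeries.algebraMap_apply (r := r)).symm }
  let κ : HahnSeries ℤ B →ₗ[F] B :=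
    { toFun := fun y => y.coeff 0
      map_add' := fun _ _ => rfl
      map_smul' := fun _ _ => rfl }
  let L₀ : Subalgebra F (HahnSeries ℤ B) :=
    { (HahnSeries.ofPowerSeries ℤ B).range with
      algebraMap_mem' := fun r => ⟨PowerSeries.C (algebraMap F B r), by
        rw [HahnSeries.ofPowerSeries_C, HahnSeries.algebraMap_apply]⟩ }
  have hι : ∀ b, ι b = HahnSeries.single 0 b := fun _ => rfl
  have hX : HahnSeries.ofPowerSeries ℤ B PowerSeries.X = HahnSeries.single 1 1 :=
    HahnSeries.ofPowerSeries_X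
  have hpow : ∀ k : ℕ, (HahnSeries.single (1 : ℤ) (1 : B)) ^ k = HahnSeries.single (k : ℤ) 1 := by
    intro k
    rw [HahnSeries.single_pow, one_pow, nsmul_eq_mul, mul_one]
  have hpow' : ∀ k : ℕ, (HahnSeries.single (-1 : ℤ) (1 : B)) ^ k =
      HahnSeries.single (-k : ℤ) 1 := by
    intro k
    rw [HahnSeries.single_pow, one_pow, nsmul_eq_mul, mul_neg, mul_one]
  refine ⟨HahnSeries ℤ B, inferInstance, inferInstance, ι, HahnSeries.single 1 1,
    HahnSeries.single (-1) 1, κ, L₀, ?_, ?_, fun y => ?_, ⟨fun b x => ?_, fun x b => ?_⟩,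
    fun k l => ?_, fun b => ?_, ⟨_, hX⟩, ?_, ?_⟩
  · rw [HahnSeries.single_mul_single, mul_one]; rfl
  · rw [HahnSeries.single_mul_single, mul_one]; rfl
  · ext a
    have e1 := HahnSeries.coeff_single_mul_add (r := (1 : B)) (x := y) (a := a - 1) (b := (1 : ℤ))
    have e2 := HahnSeries.coeff_mul_single_add (r := (1 : B)) (x := y) (a := a - 1) (b := (1 : ℤ))
    rw [sub_add_cancel] at e1 e2
    rw [e1, e2, one_mul, mul_one]
  · exact HahnSeries.coeff_single_zero_mul
  · exact HahnSeries.coeff_mul_single_zero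
  · rw [hpow, hpow', HahnSeries.single_mul_single, mul_one]
    change (HahnSeries.single ((k : ℤ) + -l) (1 : B)).coeff 0 = _
    split_ifs with hkl
    · rw [hkl, add_neg_cancel, HahnSeries.coeff_single_same]
    · exact HahnSeries.coeff_single_of_ne (by omega)
  · exact ⟨PowerSeries.C b, HahnSeries.ofPowerSeries_C b⟩
  · rintro _ ⟨y, rfl⟩
    change ((HahnSeries.single (1 : ℤ) (1 : B)) * HahnSeries.ofPowerSeries ℤ B y).coeff 0 = 0
    rw [← hX, ← map_mul]
    have := HahnSeries.ofPowerSeries_apply_coeff (Γ := ℤ) (PowerSeries.X * y) 0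
    rw [Nat.cast_zero] at this
    rw [this, PowerSeries.coeff_zero_X_mul]
  · rintro _ ⟨y, rfl⟩
    have h1 : PowerSeries.constantCoeff (1 + PowerSeries.X * y) = ((1 : Bˣ) : B) := by simp
    refine ⟨_, ⟨PowerSeries.invOfUnit (1 + PowerSeries.X * y) 1, rfl⟩, ?_⟩
    change (1 + HahnSeries.single (1 : ℤ) (1 : B) * HahnSeries.ofPowerSeries ℤ B y) *
      HahnSeries.ofPowerSeries ℤ B _ = 1
    rw [← hX, ← map_mul, ← map_one (HahnSeries.ofPowerSeries ℤ B), ← map_add, ← map_mul,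
      PowerSeries.mul_invOfUnit _ _ h1]

namespace IsLaurent

variable {ι : B →ₐ[F] L} {X Xi : L} {κ : L →ₗ[F] B} {L₀ : Subalgebra F L}

/-- Power series with constant term one are invertible, with inverse of the same shape. -/
theorem exists_inv_two_sided (h : IsLaurent ι X Xi κ L₀) {y : L} (hy : y ∈ L₀) :
    ∃ v ∈ L₀, (1 + X * y) * (1 + X * v) = 1 ∧ (1 + X * v) * (1 + X * y) = 1 := by
  obtain ⟨v, hv, e⟩ := h.exists_inv y hy
  have e' : v = 1 + X * -(y * v) := by
    linear_combination (norm := noncomm_ring) e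
  have hm : -(y * v) ∈ L₀ := neg_mem (mul_mem hy hv)
  obtain ⟨v', -, e2⟩ := h.exists_inv _ hm
  rw [← e'] at e2
  have e3 : v' = 1 + X * y := by
    calc v' = (1 + X * y) * v * v' := by rw [e, one_mul]
      _ = 1 + X * y := by rw [mul_assoc, e2, mul_one]
  refine ⟨_, hm, ?_, ?_⟩
  · rw [← e', e]
  · rw [← e', ← e3, e2]

theorem coeff_one (h : IsLaurent ι X Xi κ L₀) : κ 1 = 1 := by
  simpa using h.coeff_pow 0 0

end IsLaurent

end Laurent

section Twisted

variable {F} {B L : Type} [Ring B] [Algebra F B] [Ring L] [Algebra F L]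

/-- The diagonal two by two matrix. -/
def diagTwo (u v : L) : Matrix (Fin 2) (Fin 2) L := !![u, 0; 0, v]

/-- The matrix exchanging the two coordinates. -/
def swapTwo (L : Type) [Ring L] : Matrix (Fin 2) (Fin 2) L := !![0, 1; 1, 0]

theorem diagTwo_mul (u v u' v' : L) : diagTwo u v * diagTwo u' v' = diagTwo (u * u') (v * v') := by
  simp [diagTwo, Matrix.mul_fin_two]

theorem diagTwo_one : diagTwo (1 : L) 1 = 1 := by
  simp [diagTwo, Matrix.one_fin_two]

theorem diagTwo_pow (u v : L) (k : ℕ) : diagTwo u v ^ k = diagTwo (u ^ k) (v ^ k) := by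
  induction k with
  | zero => rw [pow_zero, pow_zero, pow_zero, diagTwo_one]
  | succ k ih => rw [pow_succ, ih, diagTwo_mul, pow_succ, pow_succ]

theorem diagTwo_add (u v u' v' : L) : diagTwo u v + diagTwo u' v' = diagTwo (u + u') (v + v') := by
  simp [diagTwo]

theorem diagTwo_sub (u v u' v' : L) : diagTwo u v - diagTwo u' v' = diagTwo (u - u') (v - v') := by
  rw [sub_eq_iff_eq_add, diagTwo_add, sub_add_cancel, sub_add_cancel]

theorem diagTwo_zero : diagTwo (0 : L) 0 = 0 := by
  ext i j
  fin_cases i <;> fin_cases j <;> rfl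

theorem diagTwo_smul (r : F) (u v : L) : r • diagTwo u v = diagTwo (r • u) (r • v) := by
  simp [diagTwo]

theorem diagTwo_sum {s : Finset ℕ} (u v : ℕ → L) :
    ∑ i ∈ s, diagTwo (u i) (v i) = diagTwo (∑ i ∈ s, u i) (∑ i ∈ s, v i) := by
  induction s using Finset.induction_on with
  | empty => simp [diagTwo_zero]
  | insert a s ha ih =>
    rw [Finset.sum_insert ha, Finset.sum_insert ha, Finset.sum_insert ha, ih, diagTwo_add]

theorem swapTwo_mul_self : swapTwo L * swapTwo L = 1 := by
  simp [swapTwo, Matrix.one_fin_two]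

theorem swapTwo_mul_diagTwo (u v : L) : swapTwo L * diagTwo u v = diagTwo v u * swapTwo L := by
  simp [swapTwo, diagTwo]

theorem diagTwo_mul_apply_zero (u v : L) (r : Matrix (Fin 2) (Fin 2) L) (j : Fin 2) :
    (diagTwo u v * r) 0 j = u * r 0 j := by
  simp [diagTwo, Matrix.mul_apply]

theorem diagTwo_mul_apply_one (u v : L) (r : Matrix (Fin 2) (Fin 2) L) (j : Fin 2) :
    (diagTwo u v * r) 1 j = v * r 1 j := by
  simp [diagTwo, Matrix.mul_apply]

theorem mul_diagTwo_apply_zero (u v : L) (r : Matrix (Fin 2) (Fin 2) L) (i : Fin 2) :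
    (r * diagTwo u v) i 0 = r i 0 * u := by
  simp [diagTwo, Matrix.mul_apply]

theorem mul_diagTwo_apply_one (u v : L) (r : Matrix (Fin 2) (Fin 2) L) (i : Fin 2) :
    (r * diagTwo u v) i 1 = r i 1 * v := by
  simp [diagTwo, Matrix.mul_apply]

/-- The diagonal embedding of `B` twisted by `δ` in the second coordinate. -/
def twistEmb (ι : B →ₐ[F] L) (δ : B →ₐ[F] B) : B →ₐ[F] Matrix (Fin 2) (Fin 2) L :=
  AlgHom.ofLinearMap
    { toFun := fun b => diagTwo (ι b) (ι (δ b))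
      map_add' := fun b b' => by simp only [map_add, diagTwo_add]
      map_smul' := fun r b => by simp only [map_smul, diagTwo_smul, RingHom.id_apply] }
    (by simp only [LinearMap.coe_mk, AddHom.coe_mk, map_one, diagTwo_one])
    (fun b b' => by simp only [LinearMap.coe_mk, AddHom.coe_mk, map_mul, diagTwo_mul])

theorem twistEmb_apply (ι : B →ₐ[F] L) (δ : B →ₐ[F] B) (b : B) :
    twistEmb ι δ b = diagTwo (ι b) (ι (δ b)) := rfl

/-- The difference of the constant coefficients of the two diagonal entries. -/
def twistTrace (κ : L →ₗ[F] B) (δ : B →ₐ[F] B) : Matrix (Fin 2) (Fin 2) L →ₗ[F] B where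
  toFun r := κ (r 0 0) - δ (κ (r 1 1))
  map_add' r s := by simp only [Matrix.add_apply, map_add]; abel
  map_smul' a r := by
    simp only [Matrix.smul_apply, map_smul, RingHom.id_apply, smul_sub]

theorem twistTrace_apply (κ : L →ₗ[F] B) (δ : B →ₐ[F] B) (r : Matrix (Fin 2) (Fin 2) L) :
    twistTrace κ δ r = κ (r 0 0) - δ (κ (r 1 1)) := rfl

theorem twistTrace_diagTwo (κ : L →ₗ[F] B) (δ : B →ₐ[F] B) (u v : L) :
    twistTrace κ δ (diagTwo u v) = κ u - δ (κ v) := rfl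

theorem twistTrace_diagTwo_mul_swapTwo (κ : L →ₗ[F] B) (δ : B →ₐ[F] B) (u v : L) :
    twistTrace κ δ (diagTwo u v * swapTwo L) = 0 := by
  rw [twistTrace_apply, diagTwo_mul_apply_zero, diagTwo_mul_apply_one]
  simp [swapTwo]

namespace IsLaurent

variable {ι : B →ₐ[F] L} {X Xi : L} {κ : L →ₗ[F] B} {L₀ : Subalgebra F L} {δ : B →ₐ[F] B}

theorem Xi_comm (h : IsLaurent ι X Xi κ L₀) (y : L) : Commute Xi y :=
  (commute_inv h.X_Xi h.Xi_X (h.X_comm y).symm).symm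

theorem isBimoduleMap_twistTrace (h : IsLaurent ι X Xi κ L₀) (hδ : ∀ b, δ (δ b) = b) :
    IsBimoduleMap (twistEmb ι δ) (twistTrace κ δ) := by
  constructor
  · intro b r
    rw [twistTrace_apply, twistEmb_apply, diagTwo_mul_apply_zero, diagTwo_mul_apply_one,
      h.bim.left, h.bim.left, map_mul δ, hδ, twistTrace_apply, mul_sub]
  · intro r b
    rw [twistTrace_apply, twistEmb_apply, mul_diagTwo_apply_zero, mul_diagTwo_apply_one,
      h.bim.right, h.bim.right, map_mul δ, hδ, twistTrace_apply, sub_mul]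

theorem diagTwo_X_Xi (h : IsLaurent ι X Xi κ L₀) : diagTwo X Xi * diagTwo Xi X = 1 := by
  rw [diagTwo_mul, h.X_Xi, h.Xi_X, diagTwo_one]

theorem diagTwo_Xi_X (h : IsLaurent ι X Xi κ L₀) : diagTwo Xi X * diagTwo X Xi = 1 := by
  rw [diagTwo_mul, h.X_Xi, h.Xi_X, diagTwo_one]

theorem commute_diagTwo (h : IsLaurent ι X Xi κ L₀) (u v : L) :
    Commute (diagTwo X Xi) (diagTwo u v) := by
  rw [commute_iff_eq, diagTwo_mul, diagTwo_mul, (h.X_comm u).eq, (h.Xi_comm v).eq]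

theorem swapTwo_mul_twistEmb (hδ : ∀ b, δ (δ b) = b) (b : B) :
    swapTwo L * twistEmb ι δ b = twistEmb ι δ (δ b) * swapTwo L := by
  rw [twistEmb_apply, twistEmb_apply, swapTwo_mul_diagTwo, hδ]

/-- The subalgebra generated by `B`, the two variables and the exchange. -/
def twistSub (ι : B →ₐ[F] L) (δ : B →ₐ[F] B) (X Xi : L) :
    Subalgebra F (Matrix (Fin 2) (Fin 2) L) :=
  Algebra.adjoin F (Set.range (twistEmb ι δ) ∪ {diagTwo X Xi, diagTwo Xi X, swapTwo L})

theorem twistEmb_mem_twistSub (b : B) : twistEmb ι δ b ∈ twistSub ι δ X Xi :=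
  Algebra.subset_adjoin (Or.inl ⟨b, rfl⟩)

theorem diagTwo_mem_twistSub : diagTwo X Xi ∈ twistSub ι δ X Xi :=
  Algebra.subset_adjoin (Or.inr (Or.inl rfl))

theorem diagTwo_mem_twistSub_inv : diagTwo Xi X ∈ twistSub ι δ X Xi :=
  Algebra.subset_adjoin (Or.inr (Or.inr (Or.inl rfl)))

theorem swapTwo_mem_twistSub : swapTwo L ∈ twistSub ι δ X Xi :=
  Algebra.subset_adjoin (Or.inr (Or.inr (Or.inr rfl)))

theorem twistTrace_of_mem (h : IsLaurent ι X Xi κ L₀) (hδ : ∀ b, δ (δ b) = b)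
    {s : Matrix (Fin 2) (Fin 2) L} (hs : s ∈ twistSub ι δ X Xi) : twistTrace κ δ s = 0 := by
  let U : Matrix (Fin 2) (Fin 2) L := diagTwo X Xi
  let V : Matrix (Fin 2) (Fin 2) L := diagTwo Xi X
  let C : Matrix (Fin 2) (Fin 2) L := swapTwo L
  let P : Submodule F (Matrix (Fin 2) (Fin 2) L) := Submodule.span F
    {r | (∃ b k l, r = twistEmb ι δ b * (U ^ k * V ^ l)) ∨
      ∃ b k l, r = twistEmb ι δ b * (U ^ k * V ^ l) * C}
  have hUV : Commute U V := by
    rw [commute_iff_eq, h.diagTwo_X_Xi, h.diagTwo_Xi_X]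
  have hUb : ∀ b, Commute U (twistEmb ι δ b) := fun b => h.commute_diagTwo _ _
  have hVb : ∀ b, Commute V (twistEmb ι δ b) := fun b =>
    (commute_inv h.diagTwo_X_Xi h.diagTwo_Xi_X (hUb b).symm).symm
  have hC : ∀ b k l, C * (twistEmb ι δ b * (U ^ k * V ^ l)) =
      twistEmb ι δ (δ b) * (U ^ l * V ^ k) * C := by
    intro b k l
    have e1 : C * U ^ k = V ^ k * C := SemiconjBy.pow_right (swapTwo_mul_diagTwo X Xi) k
    have e2 : C * V ^ l = U ^ l * C := SemiconjBy.pow_right (swapTwo_mul_diagTwo Xi X) l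
    rw [← mul_assoc, swapTwo_mul_twistEmb hδ, mul_assoc, mul_assoc, ← mul_assoc C, e1, mul_assoc,
      e2, ← mul_assoc (V ^ k), (hUV.symm.pow_pow k l).eq]
  have key : ∀ a ∈ twistSub ι δ X Xi, ∀ r ∈ P, a * r ∈ P := by
    intro a ha
    induction ha using Algebra.adjoin_induction with
    | algebraMap a => intro r hr; rw [← Algebra.smul_def]; exact P.smul_mem a hr
    | add a b _ _ ha hb => intro r hr; rw [add_mul]; exact P.add_mem (ha r hr) (hb r hr)
    | mul a b _ _ ha hb => intro r hr; rw [mul_assoc]; exact ha _ (hb r hr)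
    | mem g hg =>
      intro r hr
      induction hr using Submodule.span_induction with
      | zero => rw [mul_zero]; exact P.zero_mem
      | add r r' _ _ hr hr' => rw [mul_add]; exact P.add_mem hr hr'
      | smul a r _ hr => rw [mul_smul_comm]; exact P.smul_mem a hr
      | mem r hr =>
        have hUm : ∀ b k l, U * (twistEmb ι δ b * (U ^ k * V ^ l)) =
            twistEmb ι δ b * (U ^ (k + 1) * V ^ l) := fun b k l => by
          rw [← mul_assoc, (hUb b).eq, pow_succ', mul_assoc, mul_assoc]
        have hVm : ∀ b k l, V * (twistEmb ι δ b * (U ^ k * V ^ l)) =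
            twistEmb ι δ b * (U ^ k * V ^ (l + 1)) := fun b k l => by
          rw [← mul_assoc, (hVb b).eq, mul_assoc, ← mul_assoc V, (hUV.symm.pow_right k).eq,
            pow_succ', mul_assoc]
        apply Submodule.subset_span
        rcases hr with ⟨b, k, l, rfl⟩ | ⟨b, k, l, rfl⟩ <;>
          rcases hg with ⟨b', rfl⟩ | rfl | rfl | rfl
        · exact Or.inl ⟨b' * b, k, l, by rw [map_mul, mul_assoc]⟩
        · exact Or.inl ⟨b, k + 1, l, hUm b k l⟩
        · exact Or.inl ⟨b, k, l + 1, hVm b k l⟩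
        · exact Or.inr ⟨δ b, l, k, hC b k l⟩
        · exact Or.inr ⟨b' * b, k, l, by rw [map_mul]; simp only [mul_assoc]⟩
        · exact Or.inr ⟨b, k + 1, l, by rw [← hUm b k l, ← mul_assoc]⟩
        · exact Or.inr ⟨b, k, l + 1, by rw [← hVm b k l, ← mul_assoc]⟩
        · refine Or.inl ⟨δ b, l, k, ?_⟩
          rw [← mul_assoc]
          exact (congrArg (· * C) (hC b k l)).trans (by
            rw [mul_assoc _ C C, swapTwo_mul_self, mul_one])
  have hP : ∀ r ∈ P, twistTrace κ δ r = 0 := by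
    intro r hr
    induction hr using Submodule.span_induction with
    | zero => exact map_zero _
    | add r r' _ _ hr hr' => rw [map_add, hr, hr', add_zero]
    | smul a r _ hr => rw [map_smul, hr, smul_zero]
    | mem r hr =>
      rcases hr with ⟨b, k, l, rfl⟩ | ⟨b, k, l, rfl⟩
      · have e : twistTrace κ δ (U ^ k * V ^ l) = 0 := by
          rw [diagTwo_pow, diagTwo_pow, diagTwo_mul, twistTrace_diagTwo, h.coeff_pow,
            ((h.Xi_comm X).pow_pow k l).eq, h.coeff_pow]
          by_cases hkl : k = l
          · rw [if_pos hkl, if_pos hkl.symm, map_one δ, sub_self]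
          · rw [if_neg hkl, if_neg (Ne.symm hkl), map_zero δ, sub_self]
        rw [(h.isBimoduleMap_twistTrace hδ).left, e, mul_zero]
      · rw [diagTwo_pow, diagTwo_pow, diagTwo_mul, twistEmb_apply, diagTwo_mul,
          twistTrace_diagTwo_mul_swapTwo]
  refine hP s ?_
  rw [← mul_one s]
  exact key s hs 1 (Submodule.subset_span (Or.inl ⟨1, 0, 0, by
    rw [map_one, pow_zero, pow_zero, one_mul, one_mul]⟩))

end IsLaurent

end Twisted

section Coefficients

variable {F} {B L : Type} [Ring B] [Algebra F B] [Ring L] [Algebra F L]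

namespace IsLaurent

variable {ι : B →ₐ[F] L} {X Xi : L} {κ : L →ₗ[F] B} {L₀ : Subalgebra F L} {δ : B →ₐ[F] B}

/-- A matrix over the power series that is strictly upper triangular, up to its lower right
entry, modulo `X`. -/
structure IsUpper (X : L) (L₀ : Subalgebra F L) (r : Matrix (Fin 2) (Fin 2) L) : Prop where
  zero_zero : ∃ p ∈ L₀, r 0 0 = X * p
  zero_one : r 0 1 ∈ L₀
  one_zero : ∃ p ∈ L₀, r 1 0 = X * p
  one_one : r 1 1 ∈ L₀

theorem IsUpper.smul {r : Matrix (Fin 2) (Fin 2) L} (hr : IsUpper X L₀ r) (a : F) :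
    IsUpper X L₀ (a • r) := by
  obtain ⟨p, hp, e⟩ := hr.zero_zero
  obtain ⟨p', hp', e'⟩ := hr.one_zero
  exact ⟨⟨a • p, L₀.smul_mem hp a, by rw [Matrix.smul_apply, e, mul_smul_comm]⟩,
    L₀.smul_mem hr.zero_one a, ⟨a • p', L₀.smul_mem hp' a, by
      rw [Matrix.smul_apply, e', mul_smul_comm]⟩, L₀.smul_mem hr.one_one a⟩

theorem exists_coeff (h : IsLaurent ι X Xi κ L₀) {x xi c : B} (hx : δ x = x) (hxi : δ xi = xi)
    (hc : δ c = -c) :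
    ∃ w, (twistEmb ι δ x + twistEmb ι δ xi - (diagTwo X Xi + diagTwo Xi X)) * w = 1 ∧
      w * (twistEmb ι δ x + twistEmb ι δ xi - (diagTwo X Xi + diagTwo Xi X)) = 1 ∧
      IsUpper X L₀ (w * numer (twistEmb ι δ xi) (twistEmb ι δ c) (diagTwo X Xi) (diagTwo Xi X)
        (swapTwo L)) := by
  have hy : X - ι (x + xi) ∈ L₀ := sub_mem h.X_mem (h.ι_mem _)
  obtain ⟨v, hv, e1, e2⟩ := h.exists_inv_two_sided hy
  have hu : 1 + X * v ∈ L₀ := add_mem (one_mem _) (mul_mem h.X_mem hv)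
  set u := 1 + X * v with hu_def
  have hz : ι (x + xi) - (X + Xi) = -(Xi * (1 + X * (X - ι (x + xi)))) := by
    rw [mul_add, ← mul_assoc, h.Xi_X]; noncomm_ring
  have hE : twistEmb ι δ x + twistEmb ι δ xi - (diagTwo X Xi + diagTwo Xi X) =
      diagTwo (ι (x + xi) - (X + Xi)) (ι (x + xi) - (X + Xi)) := by
    rw [twistEmb_apply, twistEmb_apply, hx, hxi, diagTwo_add, diagTwo_add, diagTwo_sub, map_add,
      add_comm Xi X]
  have hXu : (X * u) * Xi = u := by
    rw [(h.X_comm u).eq, mul_assoc, h.X_Xi, mul_one]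
  refine ⟨diagTwo (-(X * u)) (-(X * u)), ?_, ?_, ?_⟩
  · rw [hE, diagTwo_mul, hz, neg_mul_neg, mul_assoc, ← mul_assoc _ X u, ← (h.X_comm _).eq,
      mul_assoc X, e1, mul_one, h.Xi_X, diagTwo_one]
  · rw [hE, diagTwo_mul, hz, neg_mul_neg, ← mul_assoc, hXu, e2, diagTwo_one]
  · have hn : diagTwo (-(X * u)) (-(X * u)) * numer (twistEmb ι δ xi) (twistEmb ι δ c)
        (diagTwo X Xi) (diagTwo Xi X) (swapTwo L) =
        !![X * -(u * (ι xi - X)), (X * u * ι xi - u) * ι c;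
          X * (u * (X - ι xi) * ι c), u - X * u * ι xi] := by
      have hsw : swapTwo L = !![0, 1; 1, 0] := rfl
      rw [numer, twistEmb_apply, twistEmb_apply, hxi, hc, diagTwo_sub, diagTwo_sub, hsw, diagTwo,
        diagTwo, diagTwo, diagTwo, Matrix.mul_fin_two, Matrix.mul_fin_two]
      ext i j
      fin_cases i <;> fin_cases j <;> simp [Matrix.mul_apply, Fin.sum_univ_two]
      · noncomm_ring
      · linear_combination (norm := noncomm_ring) (-1 : L) * hXu * ι c
      · noncomm_ring
      · linear_combination (norm := noncomm_ring) hXu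
    rw [hn]
    have hxiL := h.ι_mem xi
    have hcL := h.ι_mem c
    exact ⟨⟨_, neg_mem (mul_mem hu (sub_mem hxiL h.X_mem)), rfl⟩,
      mul_mem (sub_mem (mul_mem (mul_mem h.X_mem hu) hxiL) hu) hcL,
      ⟨_, mul_mem (mul_mem hu (sub_mem h.X_mem hxiL)) hcL, rfl⟩,
      sub_mem hu (mul_mem (mul_mem h.X_mem hu) hxiL)⟩

/-- A matrix commuting with the two variables and the exchange is scalar. -/
theorem eq_diagTwo_of_commute (h : IsLaurent ι X Xi κ L₀) {r : Matrix (Fin 2) (Fin 2) L}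
    (hX : Commute r (diagTwo X Xi)) (hC : Commute r (swapTwo L)) :
    r = diagTwo (r 0 0) (r 0 0) := by
  have h01 := congrFun (congrFun hC.eq 0) 1
  have h00 := congrFun (congrFun hC.eq 0) 0
  have hX01 := congrFun (congrFun hX.eq 0) 1
  rw [mul_diagTwo_apply_one, diagTwo_mul_apply_zero] at hX01
  simp [swapTwo, Matrix.mul_apply, Fin.sum_univ_two] at h01 h00
  obtain ⟨v, -, -, e⟩ := h.exists_inv_two_sided (neg_mem h.X_mem)
  have h0 : r 0 1 = 0 := by
    have e1 : (1 + X * -X) * r 0 1 = 0 := by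
      have e2 : X * (r 0 1 * Xi) = r 0 1 := by
        rw [← (h.Xi_comm _).eq, ← mul_assoc, h.X_Xi, one_mul]
      linear_combination (norm := noncomm_ring) X * hX01 - e2
    rw [← one_mul (r 0 1), ← e, mul_assoc, e1, mul_zero]
  ext i j
  fin_cases i <;> fin_cases j
  · rfl
  · exact h0
  · exact h00.symm.trans h0
  · exact h01.symm

theorem exists_norm (h : IsLaurent ι X Xi κ L₀) {a N : Matrix (Fin 2) (Fin 2) L} {ξ : F}
    (ha : IsUpper X L₀ a) (hN : N = 1 + a * (ξ • 1 - a)) (hX : Commute N (diagTwo X Xi))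
    (hC : Commute N (swapTwo L)) : ∃ p ∈ L₀, N = diagTwo (1 + X * p) (1 + X * p) := by
  obtain ⟨p, hp, e⟩ := ha.zero_zero
  obtain ⟨p', hp', e'⟩ := ha.one_zero
  have e00 : N 0 0 = 1 + X * (ξ • p - p * (X * p) - a 0 1 * p') := by
    rw [hN]
    simp [Matrix.mul_apply, Fin.sum_univ_two, e, e']
    rw [← mul_assoc (a 0 1), ← (h.X_comm _).eq]
    noncomm_ring
  refine ⟨ξ • p - p * (X * p) - a 0 1 * p', ?_, e00 ▸ h.eq_diagTwo_of_commute hX hC⟩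
  exact sub_mem (sub_mem (L₀.smul_mem hp _) (mul_mem hp (mul_mem h.X_mem hp)))
    (mul_mem ha.zero_one hp')

theorem exists_descend (h : IsLaurent ι X Xi κ L₀) {N : ℕ → Matrix (Fin 2) (Fin 2) L} {n : ℕ}
    (hN : ∀ i < n, ∃ p ∈ L₀, N i = diagTwo (1 + X * p) (1 + X * p)) :
    ∃ p ∈ L₀, descend N n = diagTwo (1 + X * p) (1 + X * p) := by
  induction n with
  | zero => exact ⟨0, zero_mem _, by rw [descend, mul_zero, add_zero, diagTwo_one]⟩
  | succ n ih =>
    obtain ⟨p, hp, e⟩ := ih fun i hi => hN i (by omega)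
    obtain ⟨p', hp', e'⟩ := hN n (lt_add_one n)
    have hm : p' + p + p' * (X * p) ∈ L₀ :=
      add_mem (add_mem hp' hp) (mul_mem hp' (mul_mem h.X_mem hp))
    refine ⟨_, hm, ?_⟩
    rw [descend, e, e', diagTwo_mul,
      show (1 + X * p') * (1 + X * p) = 1 + X * (p' + p + p' * (X * p)) by noncomm_ring]

end IsLaurent

section Commuting

variable {R : Type} [Ring R] [Algebra F R] {q : F} {n : ℕ} {x xi c t : ℕ → R} {X Xi C : R}
  {a N : ℕ → R}

theorem commute_descend {r : R} {k : ℕ} (h : ∀ i < k, Commute (N i) r) :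
    Commute (descend N k) r := by
  induction k with
  | zero => exact Commute.one_left r
  | succ k ih => exact (h k (lt_add_one k)).mul_left (ih fun i hi => h i (by omega))

theorem IsCoeff.commute_N_t (ha : IsCoeff q n x c t X C a N) {i j : ℕ} (hi : i < n)
    (hj : j + 1 < n) (h1 : j ≠ i) (h2 : j + 1 ≠ i) : Commute (N i) (t j) := by
  have h := ha.a_to i hi j hj h1 h2
  rw [ha.N_eq i hi]
  exact (Commute.one_left _).add_left
    (h.mul_left (((Commute.one_left _).smul_left _).sub_left h))

theorem IsCoeff.commute_descend_t (ha : IsCoeff q n x c t X C a N) {j k : ℕ} (hk : k ≤ n)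
    (hj : j + 1 < k) : Commute (descend N k) (t j) := by
  induction k with
  | zero => omega
  | succ k ih =>
    by_cases h : j + 1 < k
    · exact (ha.commute_N_t (by omega) (by omega) (by omega) (by omega)).mul_left
        (ih (by omega) h)
    · obtain rfl : k = j + 1 := by omega
      have hNN : Commute (N (j + 1)) (N j) := by
        have h' := ha.N_a (j + 1) (by omega) j (by omega)
        rw [ha.N_eq j (by omega)]
        exact (Commute.one_right _).add_right
          (h'.mul_right (((Commute.one_right _).smul_right _).sub_right h'))
      rw [descend, descend, ← mul_assoc, hNN.eq]
      exact (ha.NN_t j (by omega)).mul_left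
        (commute_descend fun i hi => ha.commute_N_t (by omega) (by omega) (by omega) (by omega))

end Commuting

end Coefficients

section Weight

variable {F} {B L : Type} [Ring B] [Algebra F B] [Ring L] [Algebra F L]

namespace IsLaurent

variable {ι : B →ₐ[F] L} {X Xi : L} {κ : L →ₗ[F] B} {L₀ : Subalgebra F L} {δ : B →ₐ[F] B}
variable {d : ℕ} {aa : ℕ → F}

theorem sum_smul_diagTwo_pow (aa : ℕ → F) (d : ℕ) (u v : L) :
    ∑ i ∈ Finset.range (d + 1), aa i • diagTwo u v ^ i =
      diagTwo (∑ i ∈ Finset.range (d + 1), aa i • u ^ i)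
        (∑ i ∈ Finset.range (d + 1), aa i • v ^ i) := by
  rw [← diagTwo_sum]
  exact Finset.sum_congr rfl fun i _ => by rw [diagTwo_pow, diagTwo_smul]

theorem pow_mul_sum_inv (h : IsLaurent ι X Xi κ L₀) (hs : ∀ i ≤ d, aa i = aa 0 * aa (d - i)) :
    X ^ d * ∑ i ∈ Finset.range (d + 1), aa i • Xi ^ i =
      aa 0 • ∑ i ∈ Finset.range (d + 1), aa i • X ^ i := by
  rw [← Finset.sum_range_reflect (fun i => aa i • X ^ i), Finset.mul_sum, Finset.smul_sum]
  refine Finset.sum_congr rfl fun i hi => ?_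
  have hi' : i ≤ d := Nat.lt_succ_iff.mp (Finset.mem_range.mp hi)
  have e : X ^ d * Xi ^ i = X ^ (d - i) := by
    rw [← Nat.sub_add_cancel hi', pow_add, mul_assoc, Nat.add_sub_cancel,
      ← (h.X_comm Xi).mul_pow, h.X_Xi, one_pow, mul_one]
  rw [mul_smul_comm, e, smul_smul, show d + 1 - 1 - i = d - i by omega, ← hs i hi']

theorem sum_eq_smul (h : IsLaurent ι X Xi κ L₀) (h0 : aa 0 ≠ 0) :
    ∃ g ∈ L₀, ∑ i ∈ Finset.range (d + 1), aa i • X ^ i = aa 0 • (1 + X * g) := by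
  refine ⟨(aa 0)⁻¹ • ∑ i ∈ Finset.range d, aa (i + 1) • X ^ i,
    L₀.smul_mem (sum_mem fun i _ => L₀.smul_mem (pow_mem h.X_mem i) _) _, ?_⟩
  rw [Finset.sum_range_succ', pow_zero, smul_add, add_comm, mul_smul_comm, smul_smul,
    mul_inv_cancel₀ h0, one_smul, Finset.mul_sum]
  exact congrArg _ (Finset.sum_congr rfl fun i _ => by rw [pow_succ', mul_smul_comm])

theorem exists_weight (h : IsLaurent ι X Xi κ L₀) (hs : ∀ i ≤ d, aa i = aa 0 * aa (d - i))
    (h1 : aa 0 * aa 0 = 1) {p : L} (hp : p ∈ L₀) :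
    ∃ u ∈ L₀,
      diagTwo (aa 0 • (1 + X * u)) (X ^ d * (1 + X * u)) * (diagTwo (1 + X * p) (1 + X * p) *
        ∑ i ∈ Finset.range (d + 1), aa i • diagTwo X Xi ^ i) = 1 ∧
      (diagTwo (1 + X * p) (1 + X * p) * ∑ i ∈ Finset.range (d + 1), aa i • diagTwo X Xi ^ i) *
        diagTwo (aa 0 • (1 + X * u)) (X ^ d * (1 + X * u)) = 1 := by
  have h0 : aa 0 ≠ 0 := fun h => by simp [h] at h1
  obtain ⟨g, hg, e⟩ := h.sum_eq_smul (d := d) h0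
  obtain ⟨u, hu, e1, e2⟩ := h.exists_inv_two_sided
    (add_mem (add_mem hp hg) (mul_mem hp (mul_mem h.X_mem hg)))
  have e3 : 1 + X * (p + g + p * (X * g)) = (1 + X * p) * (1 + X * g) := by
    noncomm_ring
  rw [e3] at e1 e2
  have e4 := h.pow_mul_sum_inv hs
  rw [e, smul_smul, h1, one_smul] at e4
  have hXd : ∀ y, Commute (X ^ d) y := fun y => (h.X_comm y).pow_left d
  refine ⟨u, hu, ?_, ?_⟩
  · rw [sum_smul_diagTwo_pow, diagTwo_mul, diagTwo_mul, e, mul_smul_comm, smul_mul_smul_comm, h1,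
      one_smul, e2, (hXd _).eq, mul_assoc, ← mul_assoc (X ^ d), (hXd _).eq, mul_assoc (1 + X * p),
      e4, e2, diagTwo_one]
  · rw [sum_smul_diagTwo_pow, diagTwo_mul, diagTwo_mul, e, mul_smul_comm, mul_smul_comm,
      smul_mul_assoc, smul_smul, h1, one_smul, e1, ← mul_assoc, mul_assoc (1 + X * p),
        ← (hXd _).eq, e4, e1, diagTwo_one]

theorem isSkew (h : IsLaurent ι X Xi κ L₀) (hs : ∀ i ≤ d, aa i = aa 0 * aa (d - i))
    (h1 : aa 0 * aa 0 = 1) (n : ℕ) (x xi c t : ℕ → B) :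
    IsSkew n (fun i => twistEmb ι δ (x i)) (fun i => twistEmb ι δ (xi i))
      (fun i => twistEmb ι δ (c i)) (fun i => twistEmb ι δ (t i)) (diagTwo X Xi) (diagTwo Xi X)
      (swapTwo L) (twistSub ι δ X Xi) (∑ i ∈ Finset.range (d + 1), aa i • diagTwo X Xi ^ i) := by
  have hcomm : ∀ r, Commute r (diagTwo X Xi) →
      Commute r (∑ i ∈ Finset.range (d + 1), aa i • diagTwo X Xi ^ i) := fun r hr =>
    Commute.sum_right _ _ _ fun i _ => (hr.pow_right i).smul_right _
  have hb : ∀ b, Commute (twistEmb ι δ b)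
      (∑ i ∈ Finset.range (d + 1), aa i • diagTwo X Xi ^ i) := fun b =>
    hcomm _ (h.commute_diagTwo _ _).symm
  refine ⟨fun i _ => twistEmb_mem_twistSub _, fun i _ => twistEmb_mem_twistSub _,
    fun i _ => twistEmb_mem_twistSub _, fun i _ => twistEmb_mem_twistSub _, diagTwo_mem_twistSub,
    diagTwo_mem_twistSub_inv, swapTwo_mem_twistSub, fun i _ => hb _, fun i _ => hb _,
    fun i _ => hb _, fun i _ => hb _, hcomm _ (Commute.refl _),
    hcomm _ (h.commute_diagTwo _ _).symm, aa 0 • (diagTwo Xi X ^ d * swapTwo L),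
    Subalgebra.smul_mem _ (mul_mem (pow_mem diagTwo_mem_twistSub_inv d) swapTwo_mem_twistSub) _,
    ?_⟩
  have e4 := h.pow_mul_sum_inv hs
  have hXd : ∀ y, Commute (X ^ d) y := fun y => (h.X_comm y).pow_left d
  have hXX : X ^ d * Xi ^ d = 1 := by rw [← (h.X_comm Xi).mul_pow, h.X_Xi, one_pow]
  have e5 : aa 0 • ((∑ i ∈ Finset.range (d + 1), aa i • X ^ i) * Xi ^ d) =
      ∑ i ∈ Finset.range (d + 1), aa i • Xi ^ i := by
    rw [← smul_mul_assoc, ← e4, (hXd _).eq, mul_assoc, hXX, mul_one]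
  have e6 : aa 0 • ((∑ i ∈ Finset.range (d + 1), aa i • Xi ^ i) * X ^ d) =
      ∑ i ∈ Finset.range (d + 1), aa i • X ^ i := by
    rw [← (hXd _).eq, e4, smul_smul, h1, one_smul]
  rw [sum_smul_diagTwo_pow, swapTwo_mul_diagTwo, mul_smul_comm, ← mul_assoc, ← smul_mul_assoc,
    diagTwo_pow, diagTwo_mul, diagTwo_smul, e5, e6]

theorem isSite (h : IsLaurent ι X Xi κ L₀) (hδ : ∀ b, δ (δ b) = b) {q : F} {n : ℕ}
    {x xi c t : ℕ → B} (hd : IsHData q n x xi c t) (hx : ∀ i < n, δ (x i) = x i)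
    (hc : ∀ i < n, δ (c i) = -c i) (ht : ∀ i, i + 1 < n → δ (t i) = t i) :
    IsSite q n (fun i => twistEmb ι δ (x i)) (fun i => twistEmb ι δ (xi i))
      (fun i => twistEmb ι δ (c i)) (fun i => twistEmb ι δ (t i)) (diagTwo X Xi) (diagTwo Xi X)
      (swapTwo L) := by
  refine ⟨hd.map _, h.diagTwo_X_Xi, h.diagTwo_Xi_X, swapTwo_mul_self, swapTwo_mul_diagTwo _ _,
    fun i _ => h.commute_diagTwo _ _, fun i _ => h.commute_diagTwo _ _,
    fun i _ => h.commute_diagTwo _ _, fun i hi => ?_, fun i hi => ?_, fun i hi => ?_⟩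
  · rw [commute_iff_eq, swapTwo_mul_twistEmb hδ, hx i hi]
  · rw [swapTwo_mul_twistEmb hδ, hc i hi, map_neg, neg_mul]
  · rw [commute_iff_eq, swapTwo_mul_twistEmb hδ, ht i hi]

theorem coeff_pow_mul (h : IsLaurent ι X Xi κ L₀) {y : L} (hy : y ∈ L₀) {k : ℕ} (hk : 0 < k) :
    κ (X ^ k * y) = 0 := by
  obtain ⟨k, rfl⟩ : ∃ m, k = m + 1 := ⟨k - 1, by omega⟩
  rw [pow_succ', mul_assoc]
  exact h.coeff_X_mul _ (mul_mem (pow_mem h.X_mem k) hy)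

theorem coeff_one_add (h : IsLaurent ι X Xi κ L₀) {u : L} (hu : u ∈ L₀) : κ (1 + X * u) = 1 := by
  rw [map_add, h.coeff_one, h.coeff_X_mul u hu, add_zero]

theorem one_add_mem (h : IsLaurent ι X Xi κ L₀) {u : L} (hu : u ∈ L₀) : 1 + X * u ∈ L₀ :=
  add_mem (one_mem _) (mul_mem h.X_mem hu)

theorem twistTrace_weight_mul_pow (h : IsLaurent ι X Xi κ L₀) {u : L} (hu : u ∈ L₀)
    (a : F) (k : ℕ) (hk : k ≤ d) :
    twistTrace κ δ (diagTwo (a • (1 + X * u)) (X ^ d * (1 + X * u)) * diagTwo X Xi ^ k) =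
      (if k = 0 then a • 1 else 0) - if k = d then 1 else 0 := by
  have hXi : X ^ d * (1 + X * u) * Xi ^ k = X ^ (d - k) * (1 + X * u) := by
    have e : X ^ d * Xi ^ k = X ^ (d - k) := by
      rw [← Nat.sub_add_cancel hk, pow_add, mul_assoc, Nat.add_sub_cancel,
        ← (h.X_comm Xi).mul_pow, h.X_Xi, one_pow, mul_one]
    rw [mul_assoc, ← ((h.Xi_comm _).pow_left k).eq, ← mul_assoc, e]
  rw [diagTwo_pow, diagTwo_mul, twistTrace_diagTwo, smul_mul_assoc, map_smul, hXi,
    ← ((h.X_comm _).pow_left k).eq]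
  congr 1
  · split_ifs with h0
    · rw [h0, pow_zero, one_mul, h.coeff_one_add hu]
    · rw [h.coeff_pow_mul (h.one_add_mem hu) (by omega), smul_zero]
  · split_ifs with h0
    · rw [h0, Nat.sub_self, pow_zero, one_mul, h.coeff_one_add hu, map_one δ]
    · rw [h.coeff_pow_mul (h.one_add_mem hu) (by omega), map_zero δ]

theorem twistTrace_weight_mul_upper (h : IsLaurent ι X Xi κ L₀) {u : L} (hu : u ∈ L₀) (hd : 0 < d)
    (a : F) {r : Matrix (Fin 2) (Fin 2) L} (hr : IsUpper X L₀ r) :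
    twistTrace κ δ (diagTwo (a • (1 + X * u)) (X ^ d * (1 + X * u)) * r) = 0 := by
  obtain ⟨p, hp, e⟩ := hr.zero_zero
  have hm := h.one_add_mem hu
  rw [twistTrace_apply, diagTwo_mul_apply_zero, diagTwo_mul_apply_one, e, smul_mul_assoc, map_smul,
    ← mul_assoc, ← (h.X_comm _).eq, mul_assoc, h.coeff_X_mul _ (mul_mem hm hp), mul_assoc,
    h.coeff_pow_mul (mul_mem hm hr.one_one) hd, map_zero δ, smul_zero, sub_zero]

end IsLaurent

end Weight

section Existence

variable (q : F) (n d : ℕ) (aa : ℕ → F)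

theorem cycGrad_cycGrad (b : CycAlg F q n d aa) :
    cycGrad F q n d aa (cycGrad F q n d aa b) = b := by
  have h := skew_of_adjoin_eq_top (adjoin_genSet_CycAlg F q n d aa)
    ((cycGrad F q n d aa).comp (cycGrad F q n d aa)) (AlgHom.id F _) 1 ?_ b
  · simpa using h
  rintro _ (⟨i, hi, rfl⟩ | ⟨i, hi, rfl⟩ | ⟨i, hi, rfl⟩ | ⟨i, hi, rfl⟩) <;>
    rw [one_mul, mul_one, AlgHom.comp_apply, AlgHom.id_apply]
  · rw [cycGrad_xf F q d aa hi, cycGrad_xf F q d aa hi]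
  · rw [cycGrad_xif F q d aa hi, cycGrad_xif F q d aa hi]
  · rw [cycGrad_cf F q d aa hi, map_neg, cycGrad_cf F q d aa hi, neg_neg]
  · rw [cycGrad_tf F q d aa hi, cycGrad_tf F q d aa hi]

variable {d aa}

theorem exists_isCycTrace (hd : 0 < d) (hs : ∀ i ≤ d, aa i = aa 0 * aa (d - i))
    (h1 : aa 0 * aa 0 = 1) : ∃ θ, IsCycTrace F q n d aa θ := by
  obtain ⟨L, _, _, ι, X, Xi, κ, L₀, hL⟩ := exists_isLaurent F (CycAlg F q n d aa)
  set δ := cycGrad F q n d aa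
  have hδ : ∀ b, δ (δ b) = b := cycGrad_cycGrad F q n d aa
  have hH := isHData_CycAlg F q n d aa
  have hsite := hL.isSite hδ hH (fun i hi => cycGrad_xf F q d aa hi)
    (fun i hi => cycGrad_cf F q d aa hi) (fun i hi => cycGrad_tf F q d aa hi)
  have hw : ∀ i, ∃ w, i < n → _ := fun i => by
    by_cases hi : i < n
    · obtain ⟨w, hw⟩ := hL.exists_coeff (δ := δ) (cycGrad_xf F q d aa hi)
        (cycGrad_xif F q d aa hi) (cycGrad_cf F q d aa hi)
      exact ⟨w, fun _ => hw⟩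
    · exact ⟨0, fun h => absurd h hi⟩
  choose w hw using hw
  have hco := hsite.isCoeff (w := w) (fun i hi => (hw i hi).1) (fun i hi => (hw i hi).2.1)
  set a : ℕ → Matrix (Fin 2) (Fin 2) L := fun i => (q - q⁻¹) • (w i * numer
    (twistEmb ι δ (xif F q n d aa i)) (twistEmb ι δ (cf F q n d aa i)) (diagTwo X Xi)
    (diagTwo Xi X) (swapTwo L))
  have ha : ∀ i < n, IsLaurent.IsUpper X L₀ (a i) := fun i hi => (hw i hi).2.2.smul _
  set N : ℕ → Matrix (Fin 2) (Fin 2) L := fun i => 1 + a i * ((q - q⁻¹) • 1 - a i)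
  have hco' : IsCoeff q n (fun i => twistEmb ι δ (xf F q n d aa i))
    (fun i => twistEmb ι δ (cf F q n d aa i)) (fun i => twistEmb ι δ (tf F q n d aa i))
    (diagTwo X Xi) (swapTwo L) a N := hco
  obtain ⟨p, hp, hdesc⟩ := hL.exists_descend (N := N) (n := n) fun i hi =>
    hL.exists_norm (ha i hi) (hco'.N_eq i hi) (hco'.N_X i hi) (hco'.N_C i hi)
  obtain ⟨u, hu, hw1, hw2⟩ := hL.exists_weight hs h1 hp
  rw [← hdesc] at hw1 hw2
  have hNb : ∀ b, Commute (descend N n) (twistEmb ι δ b) := by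
    intro b
    refine skew_of_adjoin_eq_top (adjoin_genSet_CycAlg F q n d aa) (twistEmb ι δ) (twistEmb ι δ) _
      ?_ b
    have hx : ∀ i < n, Commute (descend N n) (twistEmb ι δ (xf F q n d aa i)) := fun i hi =>
      commute_descend fun j hj => hco'.N_x j hj i hi
    rintro _ (⟨i, hi, rfl⟩ | ⟨i, hi, rfl⟩ | ⟨i, hi, rfl⟩ | ⟨i, hi, rfl⟩)
    · exact hx i hi
    · exact commute_inv (hsite.hd.x_xi i hi) (hsite.hd.xi_x i hi) (hx i hi)
    · exact commute_descend fun j hj => hco'.N_c j hj i hi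
    · exact hco'.commute_descend_t le_rfl hi
  have hfb : ∀ b, Commute (twistEmb ι δ b)
      (∑ i ∈ Finset.range (d + 1), aa i • diagTwo X Xi ^ i) := fun b =>
    Commute.sum_right _ _ _ fun i _ =>
      ((hL.commute_diagTwo _ _).symm.pow_right i).smul_right _
  obtain ⟨θ, hθ, hpow, hpowC, hCpow, hT⟩ := exists_cyc_functional (twistEmb ι δ) hsite hco'
    (hL.isSkew hs h1 n _ _ _ _) (twistTrace κ δ) (hL.isBimoduleMap_twistTrace hδ)
    (fun s hs' => hL.twistTrace_of_mem hδ hs') hw1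
    (fun b => (commute_inv hw2 hw1 ((hNb b).symm.mul_right (hfb b))).symm)
  have hn := isHData_CycAlg F q (n + 1) d aa
  have hln : n < n + 1 := lt_add_one n
  have h0 : aa 0 ≠ 0 := fun h => by simp [h] at h1
  refine ⟨θ, ⟨hθ, h0, hd, hn.x_xi n hln, hn.xi_x n hln, hn.cc n hln, hn.cx n hln,
    xf_cycEmb F q n d aa, cf_cycEmb F q n d aa, ?_, fun k hk hkd => ?_, ?_, fun k => ?_,
    fun k => ?_, fun k _ => ?_, fun k _ => ?_, fun k _ => ?_, fun k _ _ => ?_⟩, ?_⟩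
  · rw [← pow_zero (xf F q (n + 1) d aa n), hpow, hL.twistTrace_weight_mul_pow hu _ 0 hd.le,
      if_pos rfl, if_neg hd.ne, sub_zero, inv_eq_of_mul_eq_one_left h1]
  · rw [hpow, hL.twistTrace_weight_mul_pow hu _ k hkd.le, if_neg hk.ne', if_neg hkd.ne,
      sub_zero]
  · rw [hpow, hL.twistTrace_weight_mul_pow hu _ d le_rfl, if_neg hd.ne', if_pos rfl, zero_sub]
  · rw [hpowC, diagTwo_pow, ← mul_assoc, diagTwo_mul, twistTrace_diagTwo_mul_swapTwo]
  · rw [hCpow, diagTwo_pow, swapTwo_mul_diagTwo, ← mul_assoc, diagTwo_mul,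
      twistTrace_diagTwo_mul_swapTwo]
  · rw [mul_zero, map_zero]
  · rw [mul_zero, mul_zero, map_zero]
  · rw [zero_mul, map_zero]
  · rw [zero_mul, map_zero]
  · rcases n with - | m
    · simp [tlast]
    · rw [tlast_add_two, hT m rfl, hL.twistTrace_weight_mul_upper hu hd _ (ha m (lt_add_one m))]

end Existence

section Main

variable {F} {q : F} {n d : ℕ} {aa : ℕ → F}

theorem eq_cycEmb_of_isCycEmb {e : CycAlg F q n d aa →ₐ[F] CycAlg F q (n + 1) d aa}
    (he : IsCycEmb F q n (n + 1) d aa 0 e) : e = cycEmb F q n d aa := by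
  obtain ⟨hx, hxi, hc, ht⟩ := he
  have hxf : ∀ {m i : ℕ} (hi : i < m), xf F q m d aa i = Xf F q m d aa ⟨i, hi⟩ := fun hi =>
    congrArg (cyc F q _ d aa) (dif_pos hi)
  have hxif : ∀ {m i : ℕ} (hi : i < m), xif F q m d aa i = Xinvf F q m d aa ⟨i, hi⟩ := fun hi =>
    congrArg (cyc F q _ d aa) (dif_pos hi)
  have hcf : ∀ {m i : ℕ} (hi : i < m), cf F q m d aa i = Cf F q m d aa ⟨i, hi⟩ := fun hi =>
    congrArg (cyc F q _ d aa) (dif_pos hi)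
  have htf : ∀ {m i : ℕ} (hi : i < m - 1), tf F q m d aa i = Tf F q m d aa ⟨i, hi⟩ := fun hi =>
    congrArg (cyc F q _ d aa) (dif_pos hi)
  refine AlgHom.ext_of_adjoin_eq_top (adjoin_genSet_CycAlg F q n d aa) ?_
  rintro _ (⟨i, hi, rfl⟩ | ⟨i, hi, rfl⟩ | ⟨i, hi, rfl⟩ | ⟨i, hi, rfl⟩)
  · rw [cycEmb_xf F q d aa hi, hxf hi, hxf (hi.trans (lt_add_one n))]
    exact hx _ _ (zero_add _).symm
  · rw [cycEmb_xif F q d aa hi, hxif hi, hxif (hi.trans (lt_add_one n))]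
    exact hxi _ _ (zero_add _).symm
  · rw [cycEmb_cf F q d aa hi, hcf hi, hcf (hi.trans (lt_add_one n))]
    exact hc _ _ (zero_add _).symm
  · rw [cycEmb_tf F q d aa hi, htf (by omega), htf (by omega)]
    exact ht _ _ (zero_add _).symm

theorem GoodPoly.exists_isFrobeniusForm (hf : GoodPoly F d aa)
    {e : CycAlg F q n d aa →ₐ[F] CycAlg F q (n + 1) d aa}
    (he : IsCycEmb F q n (n + 1) d aa 0 e) : ∃ θ, IsFrobeniusForm e θ := by
  obtain ⟨hd, hmonic, hs, -⟩ := hf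
  have h1 : aa 0 * aa 0 = 1 := by
    have := hs d le_rfl
    rw [Nat.sub_self, hmonic] at this
    exact this.symm
  have h0 : aa 0 ≠ 0 := fun h => by simp [h] at h1
  obtain ⟨θ, -, hθ⟩ := isFrobeniusForm_CycAlg F q n hd h0 hmonic fun m =>
    exists_isCycTrace F q m hd hs h1
  exact ⟨θ, eq_cycEmb_of_isCycEmb he ▸ hθ⟩

end Main

/-- **Induction is isomorphic to coinduction for cyclotomic Hecke–Clifford
superalgebras** (Theorem `indcoind` of Brundan–Kleshchev): for every
`H_n^f`-module `M` there is an isomorphism of `H_{n+1}^f`-modules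
`H_{n+1}^f ⊗_{H_n^f} M ≅ Hom_{H_n^f}(H_{n+1}^f, M)`.  Consequently induction is
both left and right adjoint to restriction. -/
theorem cyclotomic_ind_iso_coind
    (F : Type) [Field F] [IsAlgClosed F] (h2 : (2 : F) ≠ 0)
    (q : F) (hq : GoodParam F q) (n : ℕ)
    (d : ℕ) (aa : ℕ → F) (hf : GoodPoly F d aa)
    (en : Hf F q n d aa →ₐ[F] Hf F q (n + 1) d aa)
    (hen : IsCycEmb F q n (n + 1) d aa 0 en)
    (M : Type) [AddCommGroup M] [Module F M]
    (ρ : Hf F q n d aa →ₐ[F] Module.End F M)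
    (E : Type) [AddCommGroup E] [Module F E]
    (ρE : Hf F q (n + 1) d aa →ₐ[F] Module.End F E) (ι : M →ₗ[F] E)
    (hInd : IsInducedAlong F (A := Hf F q (n + 1) d aa) (B := Hf F q n d aa) en ρ ρE ι) :
    (∃ Φ : E ≃ₗ[F] ↥(coindAlong F (A := Hf F q (n + 1) d aa) (B := Hf F q n d aa) en ρ),
      ∀ (x y : Hf F q (n + 1) d aa) (e : E),
        (Φ (ρE x e)).val y = (Φ e).val (y * x)) ∧
    ∀ (P : Type) [AddCommGroup P] [Module F P],
      ∀ ρP : Hf F q (n + 1) d aa →ₐ[F] Module.End F P,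
        Nonempty (↥(eqvHoms F (A := Hf F q (n + 1) d aa) ρE ρP) ≃ₗ[F]
          ↥(eqvHoms F (A := Hf F q n d aa) ρ (ρP.comp en))) ∧
        Nonempty (↥(eqvHoms F (A := Hf F q (n + 1) d aa) ρP ρE) ≃ₗ[F]
          ↥(eqvHoms F (A := Hf F q n d aa) (ρP.comp en) ρ)) := by
  have key : ∃ θ, IsFrobeniusForm (F := F) (A := Hf F q (n + 1) d aa) (B := Hf F q n d aa) en θ :=
    GoodPoly.exists_isFrobeniusForm (e := en) hf hen
  obtain ⟨θ, hθ⟩ := key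
  refine ⟨?_, fun P _ _ ρP => ⟨?_, ?_⟩⟩
  · exact IsFrobeniusForm.exists_equiv F ρ hθ hInd
  · exact IsInducedAlong.adjunction F (A := Hf F q (n + 1) d aa) (B := Hf F q n d aa) ρ hInd ρP
  · exact IsFrobeniusForm.coadjunction F ρ hθ hInd ρP

end HC
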